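/- Under Assumptions 1, 2 and 3, the Bahadur remainder R_n = U_n⁻¹(p) − U⁻¹(p) + (U_n(U⁻¹(p)) − p)/u(U⁻¹(p)) satisfies R_n = O(n^{−5/8}) almost surely; that is, almost surely limsup_{n→∞} n^{5/8}|R_n| < ∞. -/

import Mathlib

open MeasureTheory Filter Set
open scoped ENNReal NNReal Topology BigOperators

noncomputable section

namespace UQuantile

variable {Ω : Type*} [MeasurableSpace Ω]

/-- Strict stationarity of the pair process `((X_i, Z_i))_{i ∈ ℤ}`. -/
def IsPairStationary (P : Measure Ω) (X Z : ℤ → Ω → ℝ) : Prop :=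
  ∀ (k : ℤ) (n : ℕ) (idx : Fin n → ℤ),
    P.map (fun ω i => (X (idx i) ω, Z (idx i) ω)) =
      P.map (fun ω i => (X (idx i + k) ω, Z (idx i + k) ω))

/-- Near epoch dependence in probability (PNED) of `X` on `Z` with approximation
constants `a` and gauge function `φ`. -/
def PNED (P : Measure Ω) (X Z : ℤ → Ω → ℝ) (a : ℕ → ℝ) (φ : ℝ → ℝ) : Prop :=
  ∃ f : (l : ℕ) → ((Fin (2 * l + 1) → ℝ) → ℝ),
    (∀ l, Measurable (f l)) ∧
      ∀ (l : ℕ), ∀ ε > (0 : ℝ),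
        (P {ω | ε < |X 0 ω - f l fun i => Z (((i : ℕ) : ℤ) - (l : ℤ)) ω|}).toReal ≤ a l * φ ε

/-- The σ-field generated by `..., Z_{-1}, Z_0`. -/
def pastSigma (Z : ℤ → Ω → ℝ) : MeasurableSpace Ω :=
  ⨆ i : {i : ℤ // i ≤ 0}, MeasurableSpace.comap (Z i) Real.measurableSpace

/-- The σ-field generated by `Z_k, Z_{k+1}, ...`. -/
def futureSigma (Z : ℤ → Ω → ℝ) (k : ℕ) : MeasurableSpace Ω :=
  ⨆ i : {i : ℤ // (k : ℤ) ≤ i}, MeasurableSpace.comap (Z i) Real.measurableSpace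

/-- The σ-field generated by `Z_{-l}, ..., Z_l`. -/
def rangeSigma (Z : ℤ → Ω → ℝ) (l : ℕ) : MeasurableSpace Ω :=
  ⨆ i : {i : ℤ // -(l : ℤ) ≤ i ∧ i ≤ l}, MeasurableSpace.comap (Z i) Real.measurableSpace

/-- `β` bounds the absolute regularity coefficients of `Z`: for every `k` and every pair of
finite measurable partitions of `Ω` into past, resp. future measurable sets,
`(1/2) Σ_{i,j} |P(A_i ∩ B_j) - P(A_i) P(B_j)| ≤ β k`. -/
def IsBetaBound (P : Measure Ω) (Z : ℤ → Ω → ℝ) (β : ℕ → ℝ) : Prop :=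
  ∀ (k m m' : ℕ) (A : Fin m → Set Ω) (B : Fin m' → Set Ω),
    (∀ i, MeasurableSet[pastSigma Z] (A i)) →
    (∀ j, MeasurableSet[futureSigma Z k] (B j)) →
    Pairwise (Function.onFun Disjoint A) → Pairwise (Function.onFun Disjoint B) →
    (⋃ i, A i) = univ → (⋃ j, B j) = univ →
    (1 / 2 : ℝ) * ∑ i, ∑ j,
        |(P (A i ∩ B j)).toReal - (P (A i)).toReal * (P (B j)).toReal| ≤ β k

/-- Assumption 1: `((X_i, Z_i))` is strictly stationary, `X` is PNED on `Z` with
`a_l φ(l^{-6}) = O(l^{-6})`, and `Z` is absolutely regular with `Σ k β_k < ∞`. -/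
structure Assumption1 (P : Measure Ω) (X Z : ℤ → Ω → ℝ) : Prop where
  stationary : IsPairStationary P X Z
  pned : ∃ (a : ℕ → ℝ) (φ : ℝ → ℝ),
    Tendsto a atTop (𝓝 0) ∧ AntitoneOn φ (Ioi 0) ∧ (∀ x > (0 : ℝ), 0 < φ x) ∧
      PNED P X Z a φ ∧
      (fun l : ℕ => a l * φ ((l : ℝ) ^ (-6 : ℤ))) =O[atTop] fun l : ℕ => (l : ℝ) ^ (-6 : ℤ)
  mixing : ∃ β : ℕ → ℝ, (∀ k, 0 ≤ β k) ∧ IsBetaBound P Z β ∧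
      Summable fun k : ℕ => (k : ℝ) * β k

/-- A U-quantile kernel function: nonnegative, bounded, measurable, symmetric in the first
two arguments and non-decreasing in the third. -/
structure IsUQKernel (h : ℝ → ℝ → ℝ → ℝ) : Prop where
  nonneg : ∀ x y t, 0 ≤ h x y t
  bounded : ∃ M, ∀ x y t, h x y t ≤ M
  measurable : Measurable fun q : ℝ × ℝ × ℝ => h q.1 q.2.1 q.2.2
  symm : ∀ x y t, h x y t = h y x t
  mono : ∀ x y, Monotone (h x y)

/-- The empirical U-distribution function `U_n(t)`. -/
def Ustat (X : ℤ → Ω → ℝ) (h : ℝ → ℝ → ℝ → ℝ) (n : ℕ) (t : ℝ) (ω : Ω) : ℝ :=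
  (2 / ((n : ℝ) * ((n : ℝ) - 1))) *
    ∑ i ∈ Finset.Icc (1 : ℤ) (n : ℤ), ∑ j ∈ Finset.Ioc i (n : ℤ), h (X i ω) (X j ω) t

/-- The population U-distribution function `U(t) = E h(X, Y, t)` for `X, Y` independent
with law `μ`. -/
def Udist (μ : Measure ℝ) (h : ℝ → ℝ → ℝ → ℝ) (t : ℝ) : ℝ := ∫ x, ∫ y, h x y t ∂μ ∂μ

/-- The linear part of the Hoeffding decomposition, `h₁(x, t) = E h(x, X₀, t) - U(t)`. -/
def h1 (μ : Measure ℝ) (h : ℝ → ℝ → ℝ → ℝ) (x t : ℝ) : ℝ := (∫ y, h x y t ∂μ) - Udist μ h t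

/-- The degenerate part of the Hoeffding decomposition. -/
def h2 (μ : Measure ℝ) (h : ℝ → ℝ → ℝ → ℝ) (x y t : ℝ) : ℝ :=
  h x y t - h1 μ h x t - h1 μ h y t - Udist μ h t

/-- The population `p`-U-quantile `U⁻¹(p)`. -/
def Uinv (μ : Measure ℝ) (h : ℝ → ℝ → ℝ → ℝ) (p : ℝ) : ℝ := sInf {t | p ≤ Udist μ h t}

/-- The empirical `p`-U-quantile `U_n⁻¹(p)`. -/
def UinvEmp (X : ℤ → Ω → ℝ) (h : ℝ → ℝ → ℝ → ℝ) (n : ℕ) (p : ℝ) (ω : Ω) : ℝ :=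
  sInf {t | p ≤ Ustat X h n t ω}

/-- The variation condition for `h(·,·,t)` with constant `L`, with respect to the law `μ`. -/
def VariationAt (μ : Measure ℝ) (h : ℝ → ℝ → ℝ → ℝ) (L t : ℝ) : Prop :=
  ∀ ε > (0 : ℝ),
    ∫⁻ q : ℝ × ℝ, ENNReal.ofReal
        ((⨆ r ∈ Metric.closedBall q ε, |h r.1 r.2 t - h q.1 q.2 t|) ^ 2) ∂(μ.prod μ)
      ≤ ENNReal.ofReal (L * ε)

/-- Assumption 2: the variation condition holds for all `t` in a neighborhood of `U⁻¹(p)`. -/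
def Assumption2 (μ : Measure ℝ) (h : ℝ → ℝ → ℝ → ℝ) (p : ℝ) : Prop :=
  ∃ L δ : ℝ, 0 < δ ∧ ∀ t, |t - Uinv μ h p| < δ → VariationAt μ h L t

/-- Assumption 3: `U` is differentiable near `U⁻¹(p)` with derivative `u`,
`u(U⁻¹(p)) > 0`, and a `3/2`-order Taylor-type expansion holds at `U⁻¹(p)`. -/
def Assumption3 (μ : Measure ℝ) (h : ℝ → ℝ → ℝ → ℝ) (p : ℝ) (u : ℝ → ℝ) : Prop :=
  (∀ᶠ t in 𝓝 (Uinv μ h p), HasDerivAt (Udist μ h) (u t) t) ∧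
    0 < u (Uinv μ h p) ∧
    (fun t => Udist μ h t - p - u (Uinv μ h p) * (t - Uinv μ h p)) =o[𝓝 (Uinv μ h p)]
      fun t => |t - Uinv μ h p| ^ ((3 : ℝ) / 2)

/-- The lag-`r` autocovariance `Cov(f(X_0), f(X_r))`. -/
def covShift (P : Measure Ω) (X : ℤ → Ω → ℝ) (f : ℝ → ℝ) (r : ℤ) : ℝ :=
  (∫ ω, f (X 0 ω) * f (X r ω) ∂P) - (∫ ω, f (X 0 ω) ∂P) * ∫ ω, f (X r ω) ∂P

/-- The long-run variance `σ_p²` of the `p`-U-quantile. -/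
def lrv (P : Measure Ω) (X : ℤ → Ω → ℝ) (h : ℝ → ℝ → ℝ → ℝ) (p : ℝ) (u : ℝ → ℝ) : ℝ :=
  (4 / u (Uinv (P.map (X 0)) h p) ^ 2) *
    ∑' r : ℤ, covShift P X (fun x => h1 (P.map (X 0)) h x (Uinv (P.map (X 0)) h p)) r

end UQuantile

namespace UQuantile

/-- Dyadic chaining. -/
lemma dyadic_chain (f : ℕ → ℝ) (m : ℕ) (lam : ℕ → ℝ)
    (H : ∀ v ≤ m, ∀ c < 2 ^ v, |f ((c + 1) * 2 ^ (m - v)) - f (c * 2 ^ (m - v))| ≤ lam v) :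
    ∀ i ≤ 2 ^ m, |f i - f 0| ≤ ∑ v ∈ Finset.range (m + 1), lam v := by
  have hl : ∀ v ≤ m, 0 ≤ lam v := fun v hv => (abs_nonneg _).trans (H v hv 0 (by positivity))
  have key : ∀ v ≤ m, ∀ c ≤ 2 ^ v, |f (c * 2 ^ (m - v)) - f 0|
      ≤ ∑ w ∈ Finset.range (v + 1), lam w := by
    intro v
    induction v with
    | zero =>
      intro _ c hc
      have hc' : c = 0 ∨ c = 1 := by simp at hc; omega
      rcases hc' with rfl | rfl
      · simpa using hl 0 (Nat.zero_le _)
      · simpa using H 0 (Nat.zero_le _) 0 (by norm_num)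
    | succ v ih =>
      intro hv c hc
      rw [Finset.sum_range_succ]
      have hpow : 2 ^ (m - v) = 2 * 2 ^ (m - (v + 1)) := by
        rw [← pow_succ']; congr 1; omega
      rcases Nat.even_or_odd' c with ⟨d, rfl | rfl⟩
      · have hd : d ≤ 2 ^ v := by rw [pow_succ] at hc; omega
        have := ih (by omega) d hd
        rw [hpow] at this
        have e : 2 * d * 2 ^ (m - (v + 1)) = d * (2 * 2 ^ (m - (v + 1))) := by ring
        rw [e]
        linarith [hl (v + 1) hv]
      · have hd : d < 2 ^ v := by rw [pow_succ] at hc; omega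
        have h1 := ih (by omega) d hd.le
        rw [hpow] at h1
        have h2 := H (v + 1) hv (2 * d) (by rw [pow_succ]; omega)
        have e : 2 * d * 2 ^ (m - (v + 1)) = d * (2 * 2 ^ (m - (v + 1))) := by ring
        rw [e] at h2
        have h3 := abs_sub_le (f ((2 * d + 1) * 2 ^ (m - (v + 1)))) (f (d * (2 * 2 ^ (m - (v + 1))))) (f 0)
        linarith
  intro i hi
  simpa using key m le_rfl i hi

/-- The truncated sum is bounded. -/
lemma trunc_sq (γ : ℕ → ℝ) (hγ : ∀ r, 0 ≤ γ r) (δ : ℝ) (hδ : 0 ≤ δ) (R : ℕ) :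
    (∑ r ∈ Finset.range R, min δ (γ r)) ^ 2
      ≤ 2 * δ * ∑ r ∈ Finset.range R, ((r : ℝ) + 1) * γ r ∧
    (∑ r ∈ Finset.range R, min δ (γ r)) ≤ R * δ := by
  induction R with
  | zero => simp
  | succ R ih =>
    rw [Finset.sum_range_succ, Finset.sum_range_succ]
    obtain ⟨h1, h2⟩ := ih
    set G := ∑ r ∈ Finset.range R, min δ (γ r) with hG
    have hG0 : 0 ≤ G := Finset.sum_nonneg fun r _ => le_min hδ (hγ r)
    have hm0 : 0 ≤ min δ (γ R) := le_min hδ (hγ R)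
    have hm1 : min δ (γ R) ≤ δ := min_le_left _ _
    have hm2 : min δ (γ R) ≤ γ R := min_le_right _ _
    set mm := min δ (γ R)
    push_cast
    refine ⟨?_, by linarith⟩
    have : (G + mm) * mm ≤ ((R + 1) * δ) * γ R := by
      apply mul_le_mul _ hm2 hm0
      · positivity
      · linarith
    nlinarith

lemma trunc_cube (γ : ℕ → ℝ) (hγ : ∀ r, 0 ≤ γ r) (S : ℝ)
    (hS : ∀ R, ∑ r ∈ Finset.range R, ((r : ℝ) + 1) * γ r ≤ S) (Q : ℝ) (hQ : 0 < Q) (R : ℕ) :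
    (Q * ∑ r ∈ Finset.range R, min (1 / Q ^ 2) (γ r)) ^ 3
      ≤ (3 + 6 * S) * ∑ r ∈ Finset.range R, γ r * min (((r : ℝ) + 1) ^ 2 / Q) Q := by
  have hS0 : 0 ≤ S := by simpa using hS 0
  induction R with
  | zero => simp
  | succ R ih =>
    have hA := trunc_sq γ hγ (1 / Q ^ 2) (by positivity) (R + 1)
    have hB := hS (R + 1)
    rw [Finset.sum_range_succ (fun r => γ r * min (((r : ℝ) + 1) ^ 2 / Q) Q)]
    rw [Finset.sum_range_succ (fun r => min (1 / Q ^ 2) (γ r))] at hA ⊢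
    set G := ∑ r ∈ Finset.range R, min (1 / Q ^ 2) (γ r) with hG
    have hG0 : 0 ≤ G := Finset.sum_nonneg fun r _ => le_min (by positivity) (hγ r)
    have hm0 : 0 ≤ min (1 / Q ^ 2) (γ R) := le_min (by positivity) (hγ R)
    have hm2 : min (1 / Q ^ 2) (γ R) ≤ γ R := min_le_right _ _
    set mm := min (1 / Q ^ 2) (γ R)
    set S' := ∑ r ∈ Finset.range (R + 1), ((r : ℝ) + 1) * γ r
    obtain ⟨hA1, hA2⟩ := hA
    push_cast at hA2
    have hx0 : 0 ≤ G + mm := by positivity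
    have hsq : (Q ^ 3 * (G + mm) ^ 2) ≤ (1 + 2 * S) * min (((R : ℝ) + 1) ^ 2 / Q) Q := by
      rw [mul_min_of_nonneg _ _ (by positivity)]
      apply le_min
      · calc Q ^ 3 * (G + mm) ^ 2 ≤ Q ^ 3 * ((R + 1) * (1 / Q ^ 2)) ^ 2 := by gcongr
          _ = ((R : ℝ) + 1) ^ 2 / Q := by field_simp
          _ ≤ (1 + 2 * S) * (((R : ℝ) + 1) ^ 2 / Q) := by
            have : 0 ≤ ((R : ℝ) + 1) ^ 2 / Q := by positivity
            nlinarith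
      · calc Q ^ 3 * (G + mm) ^ 2 ≤ Q ^ 3 * (2 * (1 / Q ^ 2) * S) := by
              gcongr; refine hA1.trans ?_; gcongr
          _ = 2 * S * Q := by field_simp
          _ ≤ (1 + 2 * S) * Q := by nlinarith
    have hinc : (Q * (G + mm)) ^ 3 - (Q * G) ^ 3 ≤ 3 * (Q ^ 3 * (G + mm) ^ 2) * mm := by
      have : (G + mm) ^ 3 - G ^ 3 ≤ 3 * (G + mm) ^ 2 * mm := by
        nlinarith [mul_nonneg hG0 hm0, pow_nonneg hm0 3, mul_nonneg hG0 (mul_nonneg hm0 hm0)]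
      have := mul_le_mul_of_nonneg_left this (pow_pos hQ 3).le
      nlinarith
    have : 3 * (Q ^ 3 * (G + mm) ^ 2) * mm
        ≤ 3 * ((1 + 2 * S) * min (((R : ℝ) + 1) ^ 2 / Q) Q) * γ R := by
      have h0 : 0 ≤ Q ^ 3 * (G + mm) ^ 2 := by positivity
      apply mul_le_mul _ hm2 hm0 (by linarith)
      linarith
    nlinarith

lemma geom_min (a : ℝ) (ha : 0 < a) (B : ℝ) (hB : 2 ≤ B) (J : ℕ) :
    ∑ j ∈ Finset.range J, min (a ^ 2 / B ^ j) (B ^ j) ≤ 6 * a := by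
  have key : ∀ x : ℝ, 0 < x → min (a ^ 2 / x) x ≤ 6 * a * (B * x / (B * x + a) - x / (x + a)) := by
    intro x hx
    have hBx : 0 < B * x + a := by positivity
    have hxa : 0 < x + a := by positivity
    have e : 6 * a * (B * x / (B * x + a) - x / (x + a))
        = 6 * a ^ 2 * (B - 1) * x / ((B * x + a) * (x + a)) := by
      field_simp; ring
    rw [e]
    rcases le_total x a with hxa' | hxa'
    · refine (min_le_right _ _).trans ?_
      rw [le_div_iff₀ (by positivity)]
      have h1 : (B * x + a) * (x + a) ≤ ((B + 1) * a) * (2 * a) := by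
        apply mul_le_mul <;> nlinarith
      have h2 : ((B + 1) * a) * (2 * a) ≤ 6 * a ^ 2 * (B - 1) := by nlinarith [sq_nonneg a]
      nlinarith
    · refine (min_le_left _ _).trans ?_
      rw [div_le_div_iff₀ hx (by positivity)]
      have h1 : (B * x + a) * (x + a) ≤ ((B + 1) * x) * (2 * x) := by
        apply mul_le_mul <;> nlinarith
      have h2 : ((B + 1) * x) * (2 * x) ≤ 6 * (B - 1) * x * x := by nlinarith [sq_nonneg x]
      have h3 : 0 ≤ a ^ 2 := by positivity
      nlinarith [mul_le_mul_of_nonneg_left (h1.trans h2) h3]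
  have h0 : ∀ J : ℕ, ∑ j ∈ Finset.range J, min (a ^ 2 / B ^ j) (B ^ j)
      ≤ 6 * a * (B ^ J / (B ^ J + a)) := by
    intro J
    induction J with
    | zero => simp; positivity
    | succ J ih =>
      rw [Finset.sum_range_succ]
      have := key (B ^ J) (by positivity)
      rw [pow_succ' B J]
      linarith
  refine (h0 J).trans ?_
  have : B ^ J / (B ^ J + a) ≤ 1 := by
    have : 0 < B ^ J := by positivity
    rw [div_le_one (by positivity)]; linarith
  nlinarith

/-- The choice of the window size. -/
lemma rho_lemma (γ : ℕ → ℝ) (hγ : ∀ r, 0 ≤ γ r) (hs : Summable fun r : ℕ => ((r : ℝ) + 1) * γ r) :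
    ∃ (ρ : ℕ → ℕ) (C : ℝ), 0 < C ∧ (∀ j, ρ j ≤ j) ∧ (Summable fun j => ((1 / 2 : ℝ)) ^ (8 * ρ j)) ∧
      ∀ j v R, (((2 : ℝ) ^ j) ^ 12 * ∑ r ∈ Finset.range R,
        min ((2 : ℝ) ^ (ρ j) / 2 ^ v / ((2 : ℝ) ^ j) ^ 24) (γ r)) ^ 4 ≤ C / 2 ^ (ρ j + v) := by
  set S := ∑' r : ℕ, ((r : ℝ) + 1) * γ r with hSdef
  have hterm : ∀ r : ℕ, 0 ≤ ((r : ℝ) + 1) * γ r := fun r => mul_nonneg (by positivity) (hγ r)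
  have hS : ∀ R, ∑ r ∈ Finset.range R, ((r : ℝ) + 1) * γ r ≤ S := fun R =>
    hs.sum_le_tsum _ (fun r _ => hterm r)
  have hS0 : 0 ≤ S := by simpa using hS 0
  set Q : ℕ → ℝ := fun j => ((2 : ℝ) ^ j) ^ 12 with hQdef
  have hQ : ∀ j, 0 < Q j := fun j => by positivity
  have hγs : Summable γ := by
    refine Summable.of_nonneg_of_le hγ (fun r => ?_) hs
    have := hγ r
    nlinarith [mul_nonneg (Nat.cast_nonneg (α := ℝ) r) this]
  have hms : ∀ δ : ℝ, 0 ≤ δ → Summable fun r => min δ (γ r) := fun δ hδ =>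
    Summable.of_nonneg_of_le (fun r => le_min hδ (hγ r)) (fun r => min_le_right _ _) hγs
  set V : ℕ → ℝ := fun j => Q j * ∑' r, min (1 / Q j ^ 2) (γ r) with hVdef
  have hVpart : ∀ j R, Q j * ∑ r ∈ Finset.range R, min (1 / Q j ^ 2) (γ r) ≤ V j := by
    intro j R
    apply mul_le_mul_of_nonneg_left _ (hQ j).le
    exact (hms _ (by positivity)).sum_le_tsum _ (fun r _ => le_min (by positivity) (hγ r))
  have hV0 : ∀ j, 0 ≤ V j := fun j => by simpa using hVpart j 0
  have hVtend : ∀ j, Tendsto (fun R => Q j * ∑ r ∈ Finset.range R, min (1 / Q j ^ 2) (γ r))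
      atTop (𝓝 (V j)) := fun j =>
    ((hms _ (by positivity)).hasSum.tendsto_sum_nat).const_mul _
  have hV2 : ∀ j, V j ^ 2 ≤ 2 * S := by
    intro j
    refine le_of_tendsto ((hVtend j).pow 2) (Eventually.of_forall fun R => ?_)
    rw [mul_pow]
    have h1 := (trunc_sq γ hγ (1 / Q j ^ 2) (by positivity) R).1
    calc Q j ^ 2 * (∑ r ∈ Finset.range R, min (1 / Q j ^ 2) (γ r)) ^ 2
        ≤ Q j ^ 2 * (2 * (1 / Q j ^ 2) * S) := by
          gcongr; refine h1.trans ?_; gcongr; exact hS R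
      _ = 2 * S := by have := hQ j; field_simp
  have hV1 : ∀ j, V j ≤ 2 * S + 1 := fun j => by nlinarith [hV2 j, sq_nonneg (V j - 1)]
  have hV3s : Summable fun j => V j ^ 3 := by
    refine summable_of_sum_range_le (c := (3 + 6 * S) * (6 * S)) (fun j => pow_nonneg (hV0 j) 3) ?_
    intro J
    have hT : Tendsto (fun R => ∑ j ∈ Finset.range J,
        (Q j * ∑ r ∈ Finset.range R, min (1 / Q j ^ 2) (γ r)) ^ 3) atTop
        (𝓝 (∑ j ∈ Finset.range J, V j ^ 3)) :=
      tendsto_finsetSum _ fun j _ => (hVtend j).pow 3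
    refine le_of_tendsto hT (Eventually.of_forall fun R => ?_)
    calc ∑ j ∈ Finset.range J, (Q j * ∑ r ∈ Finset.range R, min (1 / Q j ^ 2) (γ r)) ^ 3
        ≤ ∑ j ∈ Finset.range J, (3 + 6 * S) * ∑ r ∈ Finset.range R,
            γ r * min (((r : ℝ) + 1) ^ 2 / Q j) (Q j) :=
          Finset.sum_le_sum fun j _ => trunc_cube γ hγ S hS (Q j) (hQ j) R
      _ = (3 + 6 * S) * ∑ r ∈ Finset.range R, γ r * ∑ j ∈ Finset.range J,
            min (((r : ℝ) + 1) ^ 2 / Q j) (Q j) := by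
          rw [← Finset.mul_sum, Finset.sum_comm]
          simp_rw [Finset.mul_sum]
      _ ≤ (3 + 6 * S) * ∑ r ∈ Finset.range R, γ r * (6 * ((r : ℝ) + 1)) := by
          gcongr with r _
          · exact hγ r
          · have := geom_min ((r : ℝ) + 1) (by positivity) (2 ^ 12) (by norm_num) J
            simp only [hQdef, ← pow_mul] at this ⊢
            simpa [mul_comm] using this
      _ = (3 + 6 * S) * (6 * ∑ r ∈ Finset.range R, ((r : ℝ) + 1) * γ r) := by
          rw [Finset.mul_sum (a := (6 : ℝ))]; congr 1
          exact Finset.sum_congr rfl fun r _ => by ring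
      _ ≤ (3 + 6 * S) * (6 * S) := by gcongr; exact hS R
  set C0 := 2 * S + 1 with hC0
  let ρ : ℕ → ℕ := fun j => Nat.findGreatest (fun ρ => (4 : ℝ) ^ ρ * V j ≤ C0) j
  have hρle : ∀ j, ρ j ≤ j := fun j => Nat.findGreatest_le _
  have hρ1 : ∀ j, (4 : ℝ) ^ (ρ j) * V j ≤ C0 := fun j =>
    Nat.findGreatest_spec (P := fun ρ => (4 : ℝ) ^ ρ * V j ≤ C0) (Nat.zero_le j)
      (by simpa using hV1 j)
  have hρ2 : ∀ j, ρ j < j → 1 ≤ (4 : ℝ) ^ (ρ j + 1) * V j := by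
    intro j hj
    have := Nat.findGreatest_is_greatest (P := fun ρ => (4 : ℝ) ^ ρ * V j ≤ C0)
      (n := j) (k := ρ j + 1) (Nat.lt_succ_self _) hj
    simp only [not_le] at this
    linarith
  refine ⟨ρ, C0 ^ 2 * (2 * S) + 1, by positivity, hρle, ?_, ?_⟩
  · refine Summable.of_nonneg_of_le (fun j => by positivity) (fun j => ?_)
      ((hV3s.mul_left (256 * C0)).add
        (summable_geometric_of_lt_one (r := (1 / 256 : ℝ)) (by norm_num) (by norm_num)))
    rcases (hρle j).lt_or_eq with hj | hj
    · have h1 := hρ2 j hj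
      have h2 : ((1 / 2 : ℝ)) ^ (8 * ρ j) = (1 / (4 : ℝ) ^ ρ j) ^ 4 := by
        rw [one_div_pow, one_div_pow, ← pow_mul, show (4 : ℝ) = 2 ^ 2 by norm_num, ← pow_mul]
        congr 2; ring
      have h3 : 1 / (4 : ℝ) ^ ρ j ≤ 4 * V j := by
        rw [div_le_iff₀ (by positivity)]; rw [pow_succ] at h1; linarith
      rw [h2]
      have h4 : (1 / (4 : ℝ) ^ ρ j) ^ 4 ≤ (4 * V j) ^ 4 := by gcongr
      have h5 : V j ^ 3 * V j ≤ V j ^ 3 * C0 :=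
        mul_le_mul_of_nonneg_left (hV1 j) (pow_nonneg (hV0 j) 3)
      have h6 : (0 : ℝ) ≤ (1 / 256) ^ j := by positivity
      nlinarith
    · have h7 : 0 ≤ 256 * C0 * V j ^ 3 := by have := hV0 j; positivity
      have h8 : ((1 / 2 : ℝ)) ^ (8 * ρ j) = (1 / 256) ^ j := by
        rw [hj, pow_mul]; norm_num
      linarith
  · intro j v R
    have hq24 : ((2 : ℝ) ^ j) ^ 24 = Q j ^ 2 := by simp only [hQdef]; ring
    rw [hq24]
    change (Q j * _) ^ 4 ≤ _
    set G := ∑ r ∈ Finset.range R, min ((2 : ℝ) ^ (ρ j) / 2 ^ v / Q j ^ 2) (γ r) with hG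
    have hQj := hQ j
    have hG0 : 0 ≤ G := Finset.sum_nonneg fun r _ => le_min (by positivity) (hγ r)
    have h1 : Q j * G ≤ C0 / 2 ^ ρ j := by
      have : G ≤ 2 ^ ρ j * ∑ r ∈ Finset.range R, min (1 / Q j ^ 2) (γ r) := by
        rw [Finset.mul_sum]
        refine Finset.sum_le_sum fun r _ => ?_
        rw [mul_min_of_nonneg _ _ (by positivity)]
        apply min_le_min
        · rw [div_div, mul_one_div]
          apply div_le_div_of_nonneg_left (by positivity) (by positivity)
          have : (1 : ℝ) ≤ 2 ^ v := one_le_pow₀ (by norm_num)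
          nlinarith [sq_nonneg (Q j)]
        · have : (1 : ℝ) ≤ 2 ^ ρ j := one_le_pow₀ (by norm_num)
          nlinarith [hγ r]
      rw [le_div_iff₀ (by positivity)]
      calc Q j * G * 2 ^ ρ j
          ≤ Q j * (2 ^ ρ j * ∑ r ∈ Finset.range R, min (1 / Q j ^ 2) (γ r)) * 2 ^ ρ j := by gcongr
        _ = 4 ^ ρ j * (Q j * ∑ r ∈ Finset.range R, min (1 / Q j ^ 2) (γ r)) := by
          rw [show (4 : ℝ) = 2 * 2 by norm_num, mul_pow]; ring
        _ ≤ 4 ^ ρ j * V j := by gcongr; exact hVpart j R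
        _ ≤ C0 := hρ1 j
    have h2 : (Q j * G) ^ 2 ≤ 2 * S * (2 ^ ρ j / 2 ^ v) := by
      have h3 := (trunc_sq γ hγ ((2 : ℝ) ^ (ρ j) / 2 ^ v / Q j ^ 2) (by positivity) R).1
      calc (Q j * G) ^ 2 = Q j ^ 2 * G ^ 2 := by ring
        _ ≤ Q j ^ 2 * (2 * ((2 : ℝ) ^ (ρ j) / 2 ^ v / Q j ^ 2) * S) := by
          gcongr; refine h3.trans ?_; gcongr; exact hS R
        _ = 2 * S * (2 ^ ρ j / 2 ^ v) := by field_simp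
    calc (Q j * G) ^ 4 = (Q j * G) ^ 2 * (Q j * G) ^ 2 := by ring
      _ ≤ (C0 / 2 ^ ρ j) ^ 2 * (2 * S * (2 ^ ρ j / 2 ^ v)) := by gcongr
      _ = (C0 ^ 2 * (2 * S)) / 2 ^ (ρ j + v) := by rw [pow_add]; field_simp
      _ ≤ _ := by gcongr; linarith

end UQuantile

namespace UQuantile

/-- Two random elements are close to independent in total variation. -/
def Close {Ω α α' : Type*} [MeasurableSpace Ω] [MeasurableSpace α] [MeasurableSpace α']
    (P : Measure Ω) (A : Ω → α) (B : Ω → α') (ε : ℝ) : Prop :=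
  ∀ C : Set (α × α'), MeasurableSet C →
    |(P.map (fun ω => (A ω, B ω))).real C - ((P.map A).prod (P.map B)).real C| ≤ ε

lemma close_of_partitions {Ω α α' : Type*} [MeasurableSpace Ω] [MeasurableSpace α]
    [MeasurableSpace α'] (P : Measure Ω) [IsProbabilityMeasure P] (A : Ω → α) (B : Ω → α')
    (hA : Measurable A) (hB : Measurable B) (ε : ℝ)
    (H : ∀ (m m' : ℕ) (φ : α → Fin m) (ψ : α' → Fin m'), Measurable φ → Measurable ψ →
      ∑ i, ∑ j, |P.real ((φ ∘ A) ⁻¹' {i} ∩ (ψ ∘ B) ⁻¹' {j})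
        - P.real ((φ ∘ A) ⁻¹' {i}) * P.real ((ψ ∘ B) ⁻¹' {j})| ≤ ε) :
    Close P A B ε := by
  intro C hC
  have : IsProbabilityMeasure (P.map A) := Measure.isProbabilityMeasure_map hA.aemeasurable
  have : IsProbabilityMeasure (P.map B) := Measure.isProbabilityMeasure_map hB.aemeasurable
  have : IsProbabilityMeasure (P.map (fun ω => (A ω, B ω))) :=
    Measure.isProbabilityMeasure_map (hA.prodMk hB).aemeasurable
  set ν1 := P.map (fun ω => (A ω, B ω)) with hν1
  set ν2 := (P.map A).prod (P.map B) with hν2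
  let R : Set (Set (α × α')) := {D | ∃ (m m' : ℕ) (φ : α → Fin m) (ψ : α' → Fin m')
    (S : Set (Fin m × Fin m')), Measurable φ ∧ Measurable ψ ∧ D = {x | (φ x.1, ψ x.2) ∈ S}}
  have hRm : ∀ D ∈ R, MeasurableSet D := by
    rintro D ⟨m, m', φ, ψ, S, hφ, hψ, rfl⟩
    exact ((hφ.comp measurable_fst).prodMk (hψ.comp measurable_snd)) (S.toFinite.measurableSet)
  have hcomb : ∀ D ∈ R, ∀ D' ∈ R, ∃ (m m' : ℕ) (φ : α → Fin m) (ψ : α' → Fin m')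
    (S S' : Set (Fin m × Fin m')), Measurable φ ∧ Measurable ψ ∧ D = {x | (φ x.1, ψ x.2) ∈ S}
      ∧ D' = {x | (φ x.1, ψ x.2) ∈ S'} := by
    rintro D ⟨m, m', φ, ψ, S, hφ, hψ, rfl⟩ D' ⟨n, n', φ', ψ', S', hφ', hψ', rfl⟩
    refine ⟨m * n, m' * n', fun a => finProdFinEquiv (φ a, φ' a),
      fun a => finProdFinEquiv (ψ a, ψ' a),
      {z | ((finProdFinEquiv.symm z.1).1, (finProdFinEquiv.symm z.2).1) ∈ S},
      {z | ((finProdFinEquiv.symm z.1).2, (finProdFinEquiv.symm z.2).2) ∈ S'},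
      (measurable_of_countable _).comp (hφ.prodMk hφ'),
      (measurable_of_countable _).comp (hψ.prodMk hψ'), ?_, ?_⟩
    · ext x
      simp only [mem_ofPred_eq, Equiv.symm_apply_apply]
    · ext x
      simp only [mem_ofPred_eq, Equiv.symm_apply_apply]
  have hRing : IsSetRing R := by
    refine ⟨⟨1, 1, fun _ => 0, fun _ => 0, ∅, measurable_const, measurable_const, by simp⟩, ?_, ?_⟩
    · intro D D' hD hD'
      obtain ⟨m, m', φ, ψ, S, S', hφ, hψ, rfl, rfl⟩ := hcomb D hD D' hD'
      exact ⟨m, m', φ, ψ, S ∪ S', hφ, hψ, by ext; simp⟩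
    · intro D D' hD hD'
      obtain ⟨m, m', φ, ψ, S, S', hφ, hψ, rfl, rfl⟩ := hcomb D hD D' hD'
      exact ⟨m, m', φ, ψ, S \ S', hφ, hψ, by ext; simp⟩
  have huniv : univ ∈ R :=
    ⟨1, 1, fun _ => 0, fun _ => 0, univ, measurable_const, measurable_const, by simp⟩
  have hgen : (Prod.instMeasurableSpace : MeasurableSpace (α × α'))
      = MeasurableSpace.generateFrom R := by
    apply le_antisymm
    · rw [← generateFrom_prod]
      apply MeasurableSpace.generateFrom_mono
      rintro _ ⟨s, hs, t, ht, rfl⟩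
      classical
      refine ⟨2, 2, fun a => if a ∈ s then 1 else 0, fun a => if a ∈ t then 1 else 0, {(1, 1)},
        Measurable.ite hs measurable_const measurable_const,
        Measurable.ite ht measurable_const measurable_const, ?_⟩
      ext x
      simp only [mem_prod, mem_ofPred_eq, mem_singleton_iff, Prod.mk.injEq]
      by_cases h1 : x.1 ∈ s <;> by_cases h2 : x.2 ∈ t <;> simp [h1, h2]
    · exact MeasurableSpace.generateFrom_le hRm
  have hRbound : ∀ D ∈ R, |ν1.real D - ν2.real D| ≤ ε := by
    rintro D ⟨m, m', φ, ψ, S, hφ, hψ, rfl⟩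
    refine le_trans ?_ (H m m' φ ψ hφ hψ)
    classical
    have hdec : ∀ ν : Measure (α × α'), IsProbabilityMeasure ν →
        ν.real {x : α × α' | (φ x.1, ψ x.2) ∈ S} = ∑ i, ∑ j,
          if (i, j) ∈ S then ν.real ((φ ⁻¹' {i}) ×ˢ (ψ ⁻¹' {j})) else 0 := by
      intro ν _
      have hset : {x : α × α' | (φ x.1, ψ x.2) ∈ S}
          = ⋃ z ∈ (Finset.univ.filter (· ∈ S)), (φ ⁻¹' {(z : Fin m × Fin m').1}) ×ˢ (ψ ⁻¹' {z.2}) := by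
        ext x
        simp only [mem_ofPred_eq, Finset.mem_filter, Finset.mem_univ, true_and, mem_iUnion,
          mem_prod, mem_preimage, mem_singleton_iff, exists_prop, Prod.exists]
        constructor
        · intro hx; exact ⟨_, _, hx, rfl, rfl⟩
        · rintro ⟨a, b, hab, h1, h2⟩; rw [h1, h2]; exact hab
      rw [hset, measureReal_biUnion_finset]
      · rw [Finset.sum_filter, ← Finset.sum_product']
        rfl
      · intro z _ z' _ hzz
        apply Set.disjoint_left.2
        rintro x ⟨h1, h2⟩ ⟨h3, h4⟩
        apply hzz
        simp only [mem_preimage, mem_singleton_iff] at h1 h2 h3 h4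
        exact Prod.ext (h1.symm.trans h3) (h2.symm.trans h4)
      · intro z _
        exact (hφ (measurableSet_singleton _)).prod (hψ (measurableSet_singleton _))
    rw [hdec ν1 inferInstance, hdec ν2 inferInstance, ← Finset.sum_sub_distrib]
    refine (Finset.abs_sum_le_sum_abs _ _).trans (Finset.sum_le_sum fun i _ => ?_)
    rw [← Finset.sum_sub_distrib]
    refine (Finset.abs_sum_le_sum_abs _ _).trans (Finset.sum_le_sum fun j _ => ?_)
    have hi := hφ (measurableSet_singleton i)
    have hj := hψ (measurableSet_singleton j)
    split_ifs
    · have e1 : ν1.real ((φ ⁻¹' {i}) ×ˢ (ψ ⁻¹' {j}))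
          = P.real ((φ ∘ A) ⁻¹' {i} ∩ (ψ ∘ B) ⁻¹' {j}) := by
        rw [hν1, map_measureReal_apply (hA.prodMk hB) (hi.prod hj)]
        rfl
      have e2 : ν2.real ((φ ⁻¹' {i}) ×ˢ (ψ ⁻¹' {j}))
          = P.real ((φ ∘ A) ⁻¹' {i}) * P.real ((ψ ∘ B) ⁻¹' {j}) := by
        rw [hν2, measureReal_prod_prod, map_measureReal_apply hA hi, map_measureReal_apply hB hj]
        rfl
      rw [e1, e2]
    · simp
  refine le_of_forall_pos_le_add fun η hη => ?_
  obtain ⟨D, hD, hDC⟩ := exists_measure_symmDiff_lt_of_generateFrom_isSetRing (μ := ν1 + ν2) hRing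
    ⟨{univ}, by simp, by simpa using huniv, by simp⟩ hgen hC
    (ε := ENNReal.ofReal (η / 2)) (by simpa using hη)
  have hDm := hRm D hD
  have k1 : ν1.real (symmDiff D C) ≤ η / 2 := by
    apply ENNReal.toReal_le_of_le_ofReal (by positivity)
    refine le_trans ?_ hDC.le
    simp
  have k2 : ν2.real (symmDiff D C) ≤ η / 2 := by
    apply ENNReal.toReal_le_of_le_ofReal (by positivity)
    refine le_trans ?_ hDC.le
    simp
  have a1 := abs_measureReal_sub_le_measureReal_symmDiff (μ := ν1) hDm.nullMeasurableSet
    hC.nullMeasurableSet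
  have a2 := abs_measureReal_sub_le_measureReal_symmDiff (μ := ν2) hDm.nullMeasurableSet
    hC.nullMeasurableSet
  have a3 := hRbound D hD
  rw [abs_le] at *
  constructor <;> linarith

lemma int_close {β : Type*} [MeasurableSpace β] (ν1 ν2 : Measure β) [IsProbabilityMeasure ν1]
    [IsProbabilityMeasure ν2] (ε : ℝ)
    (H : ∀ C, MeasurableSet C → |ν1.real C - ν2.real C| ≤ ε)
    (F : β → ℝ) (hF : Measurable F) (M : ℝ) (hM : ∀ x, |F x| ≤ M) :
    |∫ x, F x ∂ν1 - ∫ x, F x ∂ν2| ≤ 2 * M * ε := by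
  have hne : Nonempty β := by
    by_contra hcon
    rw [not_nonempty_iff] at hcon
    have := measure_univ (μ := ν1)
    rw [Set.eq_empty_of_isEmpty (univ : Set β)] at this
    simp at this
  have hM0 : 0 ≤ M := (abs_nonneg _).trans (hM hne.some)
  have hIntg : ∀ ν : Measure β, IsProbabilityMeasure ν → Integrable F ν := fun ν _ =>
    Integrable.of_bound hF.aestronglyMeasurable M (Eventually.of_forall fun x => by
      simpa using hM x)
  have hrep : ∀ ν : Measure β, IsProbabilityMeasure ν →
      ∫ x, F x ∂ν = (∫ t in Ioc 0 (2 * M), ν.real {a | t ≤ F a + M}) - M := by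
    intro ν _
    have := Integrable.integral_eq_integral_Ioc_meas_le (μ := ν) (f := fun x => F x + M)
      (M := 2 * M) ((hIntg ν inferInstance).add (integrable_const M))
      (Eventually.of_forall fun x => by have := (abs_le.1 (hM x)).1; simp; linarith)
      (Eventually.of_forall fun x => by have := (abs_le.1 (hM x)).2; simp; linarith)
    rw [integral_add (hIntg ν inferInstance) (integrable_const M)] at this
    simp at this
    linarith
  have hanti : ∀ ν : Measure β, IsProbabilityMeasure ν →
      IntegrableOn (fun t => ν.real {a | t ≤ F a + M}) (Ioc 0 (2 * M)) := by
    intro ν _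
    have ha : Antitone (fun t => ν.real {a | t ≤ F a + M}) := by
      intro s t hst
      exact measureReal_mono (fun a ha => hst.trans ha)
    exact (ha.antitoneOn _).integrableOn_isCompact isCompact_Icc |>.mono_set Ioc_subset_Icc_self
  rw [hrep ν1 inferInstance, hrep ν2 inferInstance, sub_sub_sub_cancel_right,
    ← integral_sub (hanti ν1 inferInstance) (hanti ν2 inferInstance)]
  have := norm_setIntegral_le_of_norm_le_const (μ := (volume : Measure ℝ)) (s := Ioc 0 (2 * M))
    (f := fun t => ν1.real {a | t ≤ F a + M} - ν2.real {a | t ≤ F a + M}) (C := ε)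
    (by rw [Real.volume_Ioc]; exact ENNReal.ofReal_lt_top) (fun t _ => by
      rw [Real.norm_eq_abs]
      exact H _ (measurableSet_le measurable_const (hF.add_const M)))
  rw [Real.norm_eq_abs] at this
  refine this.trans (le_of_eq ?_)
  rw [measureReal_def, Real.volume_Ioc, ENNReal.toReal_ofReal (by linarith)]
  ring

lemma Close.integral {Ω α α' : Type*} [MeasurableSpace Ω] [MeasurableSpace α]
    [MeasurableSpace α'] {P : Measure Ω} [IsProbabilityMeasure P] {A : Ω → α} {B : Ω → α'}
    {ε : ℝ} (H : Close P A B ε) (hA : Measurable A) (hB : Measurable B)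
    (F : α → α' → ℝ) (hF : Measurable fun x : α × α' => F x.1 x.2) (M : ℝ)
    (hM : ∀ x y, |F x y| ≤ M) :
    |∫ ω, F (A ω) (B ω) ∂P - ∫ ω, ∫ ω', F (A ω) (B ω') ∂P ∂P| ≤ 2 * M * ε := by
  have i1 : IsProbabilityMeasure (P.map A) := Measure.isProbabilityMeasure_map hA.aemeasurable
  have i2 : IsProbabilityMeasure (P.map B) := Measure.isProbabilityMeasure_map hB.aemeasurable
  have i3 : IsProbabilityMeasure (P.map (fun ω => (A ω, B ω))) :=
    Measure.isProbabilityMeasure_map (hA.prodMk hB).aemeasurable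
  have := int_close _ _ ε H (fun x => F x.1 x.2) hF M (fun x => hM _ _)
  rw [integral_map (hA.prodMk hB).aemeasurable hF.aestronglyMeasurable, integral_prod] at this
  · rw [integral_map hA.aemeasurable] at this
    · convert this using 4
      ext ω
      rw [integral_map hB.aemeasurable]
      exact (hF.comp measurable_prodMk_left).aestronglyMeasurable
    · exact (hF.stronglyMeasurable.integral_prod_right).aestronglyMeasurable
  · exact Integrable.of_bound hF.aestronglyMeasurable M (Eventually.of_forall fun x => hM _ _)

lemma mgf_bound {Ω : Type*} [MeasurableSpace Ω] (P : Measure Ω) [IsProbabilityMeasure P]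
    (Y : Ω → ℝ) (hY : Measurable Y) (s σ2 : ℝ) (hs : ∀ ω, |s * Y ω| ≤ 1) (h0 : ∫ ω, Y ω ∂P = 0)
    (hb : ∃ M, ∀ ω, |Y ω| ≤ M)
    (h2 : ∫ ω, Y ω ^ 2 ∂P ≤ σ2) : ∫ ω, Real.exp (s * Y ω) ∂P ≤ Real.exp (s ^ 2 * σ2) := by
  obtain ⟨M, hM⟩ := hb
  have iY : Integrable Y P := Integrable.of_bound hY.aestronglyMeasurable M
    (Eventually.of_forall fun x => hM _)
  have iY2 : Integrable (fun ω => Y ω ^ 2) P :=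
    Integrable.of_bound (hY.pow_const 2).aestronglyMeasurable (M ^ 2)
    (Eventually.of_forall fun x => by
      rw [norm_pow]; exact pow_le_pow_left₀ (norm_nonneg _) (hM x) 2)
  have iE : Integrable (fun ω => Real.exp (s * Y ω)) P :=
    Integrable.of_bound (Real.measurable_exp.comp (hY.const_mul s)).aestronglyMeasurable
      (Real.exp 1)
    (Eventually.of_forall fun x => by
      rw [Real.norm_eq_abs, Real.abs_exp]; exact Real.exp_le_exp.2 ((le_abs_self _).trans (hs x)))
  have hpt : ∀ ω, Real.exp (s * Y ω) ≤ 1 + s * Y ω + s ^ 2 * Y ω ^ 2 := by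
    intro ω
    have := (abs_le.1 (Real.abs_exp_sub_one_sub_id_le (hs ω))).2
    rw [mul_pow] at this
    linarith
  calc ∫ ω, Real.exp (s * Y ω) ∂P ≤ ∫ ω, (1 + s * Y ω + s ^ 2 * Y ω ^ 2) ∂P :=
        integral_mono iE (((integrable_const 1).add (iY.const_mul s)).add (iY2.const_mul _)) hpt
    _ = 1 + s ^ 2 * ∫ ω, Y ω ^ 2 ∂P := by
        have i2 : Integrable (fun ω => 1 + s * Y ω) P := (integrable_const 1).add (iY.const_mul s)
        rw [integral_add i2 (iY2.const_mul _),
          integral_add (integrable_const 1) (iY.const_mul s), integral_const_mul,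
          integral_const_mul, h0]
        simp
    _ ≤ 1 + s ^ 2 * σ2 := by gcongr
    _ ≤ _ := by linarith [Real.add_one_le_exp (s ^ 2 * σ2)]

/-- Backward running maximum of partial sums. -/
def mx {Ω E : Type*} (Y : ℕ → Ω → E → ℝ) : ℕ → ℕ → Ω → E → ℝ
  | 0, _ => fun _ _ => 0
  | B + 1, b => fun ω e => max 0 (Y b ω e + mx Y B (b + 1) ω e)

lemma sum_le_mx {Ω E : Type*} (Y : ℕ → Ω → E → ℝ) (ω : Ω) (e : E) (B : ℕ) :
    ∀ b, 0 ≤ mx Y B b ω e ∧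
      ∀ k ≤ B, ∑ i ∈ Finset.range k, Y (b + i) ω e ≤ mx Y B b ω e := by
  induction B with
  | zero =>
    intro b
    refine ⟨le_rfl, fun k hk => ?_⟩
    obtain rfl : k = 0 := by omega
    simp [mx]
  | succ B ih =>
    intro b
    refine ⟨le_max_left _ _, fun k hk => ?_⟩
    rcases k with _ | k
    · simp [mx]
    · rw [Finset.sum_range_succ']
      refine le_trans ?_ (le_max_right _ _)
      have := (ih (b + 1)).2 k (by omega)
      have e1 : ∑ i ∈ Finset.range k, Y (b + (i + 1)) ω e
          = ∑ i ∈ Finset.range k, Y (b + 1 + i) ω e :=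
        Finset.sum_congr rfl fun i _ => by rw [show b + (i + 1) = b + 1 + i by ring]
      rw [e1, add_zero]
      linarith

lemma mx_measurable {Ω E : Type*} {mΩ : MeasurableSpace Ω} (Y : ℕ → Ω → E → ℝ) (B : ℕ) :
    ∀ b, (∀ b' ≥ b, Measurable[mΩ] (Y b')) → Measurable[mΩ] (mx Y B b) := by
  induction B with
  | zero => intro b _; exact measurable_const
  | succ B ih =>
    intro b hY
    have h1 := ih (b + 1) (fun b' hb' => hY b' (by omega))
    have h2 := hY b le_rfl
    rw [measurable_pi_iff] at *
    intro e
    exact measurable_const.max ((h2 e).add (h1 e))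

lemma maximal_chernoff {Ω E : Type*} [Fintype E] [MeasurableSpace Ω] (P : Measure Ω)
    [IsProbabilityMeasure P] (Y : ℕ → Ω → E → ℝ) (hY : ∀ b, Measurable (Y b)) (ε : ℝ)
    (hε : 0 ≤ ε) (hcl : ∀ B b, Close P (Y b) (mx Y B (b + 1)) ε)
    (s A : E → ℝ) (hs : ∀ e, 0 ≤ s e) (hA : ∀ e, 1 ≤ A e)
    (hb : ∀ b e, ∃ M, ∀ ω, |Y b ω e| ≤ M)
    (hm : ∀ b e, ∫ ω, Real.exp (s e * Y b ω e) ∂P ≤ A e) (B : ℕ) :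
    ∀ b (x : E → ℝ), P.real {ω | ∃ e, x e ≤ mx Y B b ω e}
      ≤ ∑ e, Real.exp (- (s e * x e)) * A e ^ B + B * ε := by
  have hneg : ∀ (B : ℕ) b (x : E → ℝ), (∃ e, x e ≤ 0) → P.real {ω | ∃ e, x e ≤ mx Y B b ω e}
      ≤ ∑ e, Real.exp (- (s e * x e)) * A e ^ B + B * ε := by
    rintro B b x ⟨e, he⟩
    refine measureReal_le_one.trans ?_
    have h1 : 1 ≤ Real.exp (- (s e * x e)) * A e ^ B := by
      apply one_le_mul_of_one_le_of_one_le
      · rw [Real.one_le_exp_iff]; nlinarith [hs e]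
      · exact one_le_pow₀ (hA e)
    have h2 : Real.exp (- (s e * x e)) * A e ^ B ≤ ∑ e, Real.exp (- (s e * x e)) * A e ^ B :=
      Finset.single_le_sum (f := fun e => Real.exp (- (s e * x e)) * A e ^ B) (fun e _ => by
        have := hA e; positivity) (Finset.mem_univ e)
    have h3 : 0 ≤ (B : ℝ) * ε := by positivity
    linarith
  induction B with
  | zero =>
    intro b x
    by_cases hx : ∃ e, x e ≤ 0
    · exact hneg 0 b x hx
    · have : {ω | ∃ e, x e ≤ mx Y 0 b ω e} = ∅ := by
        ext ω; simp only [mx, mem_ofPred_eq, mem_empty_iff_false, iff_false]; exact hx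
      rw [this]
      simp only [measureReal_empty, pow_zero, mul_one, Nat.cast_zero, zero_mul, add_zero]
      exact Finset.sum_nonneg fun e _ => (Real.exp_pos _).le
  | succ B ih =>
    intro b x
    by_cases hx : ∃ e, x e ≤ 0
    · exact hneg (B + 1) b x hx
    push Not at hx
    have hmx := mx_measurable Y B (b + 1) (fun b' _ => hY b')
    set T := mx Y B (b + 1) with hT
    let C : Set ((E → ℝ) × (E → ℝ)) := {z | ∃ e, x e ≤ z.1 e + z.2 e}
    have hC : MeasurableSet C := by
      have : C = ⋃ e, {z | x e ≤ z.1 e + z.2 e} := by ext; simp [C]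
      rw [this]
      refine MeasurableSet.iUnion fun e => measurableSet_le measurable_const ?_
      exact ((measurable_pi_apply e).comp measurable_fst).add
        ((measurable_pi_apply e).comp measurable_snd)
    have hset : {ω | ∃ e, x e ≤ mx Y (B + 1) b ω e} = (fun ω => (Y b ω, T ω)) ⁻¹' C := by
      ext ω
      simp only [mx, mem_ofPred_eq, mem_preimage, C, le_max_iff]
      constructor
      · rintro ⟨e, h | h⟩
        · exact absurd h (not_le.2 (hx e))
        · exact ⟨e, h⟩
      · rintro ⟨e, h⟩; exact ⟨e, Or.inr h⟩
    rw [hset, ← map_measureReal_apply ((hY b).prodMk hmx) hC]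
    have hc := (abs_le.1 (hcl B b C hC)).2
    have i1 : IsProbabilityMeasure (P.map (Y b)) :=
      Measure.isProbabilityMeasure_map (hY b).aemeasurable
    have i2 : IsProbabilityMeasure (P.map T) :=
      Measure.isProbabilityMeasure_map hmx.aemeasurable
    have hprod : ((P.map (Y b)).prod (P.map T)).real C
        = ∫ ω, (P.map T).real (Prod.mk (Y b ω) ⁻¹' C) ∂P := by
      rw [measureReal_def, Measure.prod_apply hC, ← integral_toReal, integral_map (hY b).aemeasurable]
      · rfl
      · exact (measurable_measure_prodMk_left hC).ennreal_toReal.aestronglyMeasurable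
      · exact (measurable_measure_prodMk_left hC).aemeasurable
      · exact Eventually.of_forall fun y => measure_lt_top _ _
    have iE : ∀ e, Integrable (fun ω => Real.exp (s e * Y b ω e)) P := by
      intro e
      obtain ⟨M, hM⟩ := hb b e
      refine Integrable.of_bound (Real.measurable_exp.comp
        (((measurable_pi_iff.1 (hY b)) e).const_mul (s e))).aestronglyMeasurable
        (Real.exp (s e * M)) (Eventually.of_forall fun ω => ?_)
      rw [Real.norm_eq_abs, Real.abs_exp, Real.exp_le_exp]
      exact mul_le_mul_of_nonneg_left ((le_abs_self _).trans (hM ω)) (hs e)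
    have hbound : ((P.map (Y b)).prod (P.map T)).real C
        ≤ ∫ ω, (∑ e, (Real.exp (-(s e * x e)) * A e ^ B) * Real.exp (s e * Y b ω e) + B * ε) ∂P := by
      rw [hprod]
      apply integral_mono
      · have hmeas : Measurable (fun ω => (P.map T).real (Prod.mk (Y b ω) ⁻¹' C)) :=
          (measurable_measure_prodMk_left (ν := P.map T) hC).ennreal_toReal.comp (hY b)
        exact Integrable.of_bound hmeas.aestronglyMeasurable 1
          (Eventually.of_forall fun ω => by
            rw [Real.norm_eq_abs, abs_of_nonneg measureReal_nonneg]; exact measureReal_le_one)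
      · exact (integrable_finsetSum _ fun e _ => (iE e).const_mul _).add (integrable_const _)
      · intro ω
        have hms : MeasurableSet (Prod.mk (Y b ω) ⁻¹' C) := measurable_prodMk_left hC
        have := ih (b + 1) (fun e => x e - Y b ω e)
        dsimp only
        rw [map_measureReal_apply hmx hms]
        have e1 : T ⁻¹' (Prod.mk (Y b ω) ⁻¹' C) = {ω' | ∃ e, x e - Y b ω e ≤ T ω' e} := by
          ext ω'; simp only [C, mem_preimage, mem_ofPred_eq, sub_le_iff_le_add']
        rw [e1]
        refine this.trans (le_of_eq ?_)
        congr 1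
        refine Finset.sum_congr rfl fun e _ => ?_
        rw [mul_right_comm, ← Real.exp_add]
        congr 2; ring
    rw [integral_add (integrable_finsetSum _ fun e _ => (iE e).const_mul _) (integrable_const _),
      integral_finsetSum _ (fun e _ => (iE e).const_mul _)] at hbound
    simp only [integral_const_mul, integral_const, probReal_univ, smul_eq_mul, one_mul] at hbound
    have hle : ∑ e, Real.exp (-(s e * x e)) * A e ^ B * ∫ ω, Real.exp (s e * Y b ω e) ∂P
        ≤ ∑ e, Real.exp (- (s e * x e)) * A e ^ (B + 1) := by
      refine Finset.sum_le_sum fun e _ => ?_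
      rw [pow_succ, ← mul_assoc]
      apply mul_le_mul_of_nonneg_left (hm b e)
      have := hA e
      positivity
    push_cast
    linarith

end UQuantile

namespace UQuantile

lemma meas_pi {Ω ι : Type*} (m : MeasurableSpace Ω) (g : ι → Ω → ℝ)
    (hg : ∀ i, Measurable[m] (g i)) : Measurable[m] (fun ω i => g i ω) :=
  measurable_pi_iff.2 hg

/-- The summary of the dependence structure used in the proof. -/
structure Mix {Ω : Type*} [MeasurableSpace Ω] (P : Measure Ω) (X : ℤ → Ω → ℝ) where
  ξ : ℕ → ℤ → Ω → ℝ
  bt : ℕ → ℝ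
  Cp : ℝ
  past : ℤ → MeasurableSpace Ω
  fut : ℤ → MeasurableSpace Ω
  hX : ∀ i, Measurable (X i)
  hξ : ∀ l i, Measurable (ξ l i)
  law : ∀ i, P.map (fun ω => (X i ω, fun l => ξ l i ω)) = P.map (fun ω => (X 0 ω, fun l => ξ l 0 ω))
  Cp_nonneg : 0 ≤ Cp
  approx : ∀ l : ℕ, 1 ≤ l → P.real {ω | 1 / (l : ℝ) ^ 6 < |X 0 ω - ξ l 0 ω|} ≤ Cp / (l : ℝ) ^ 6
  past_mono : ∀ s t : ℤ, s ≤ t → past s ≤ past t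
  fut_anti : ∀ s t : ℤ, s ≤ t → fut t ≤ fut s
  past_le : ∀ s, past s ≤ ‹MeasurableSpace Ω›
  fut_le : ∀ s, fut s ≤ ‹MeasurableSpace Ω›
  ξ_past : ∀ (l : ℕ) (i s : ℤ), i + l ≤ s → Measurable[past s] (ξ l i)
  ξ_fut : ∀ (l : ℕ) (i s : ℤ), s ≤ i - l → Measurable[fut s] (ξ l i)
  bt_nonneg : ∀ k, 0 ≤ bt k
  bt_anti : Antitone bt
  bt_sum : Summable fun k : ℕ => ((k : ℝ) + 1) * bt k
  close : ∀ (s : ℤ) (k : ℕ) (α α' : Type) [MeasurableSpace α] [MeasurableSpace α']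
    (A : Ω → α) (B : Ω → α'), Measurable[past s] A → Measurable[fut (s + k)] B →
    Close P A B (2 * bt k)

/-- Running minimum of the mixing coefficients. -/
def runMin (β : ℕ → ℝ) : ℕ → ℝ
  | 0 => β 0
  | k + 1 => min (runMin β k) (β (k + 1))

lemma process_law {Ω : Type*} [MeasurableSpace Ω] (P : Measure Ω) [IsProbabilityMeasure P]
    (X Z : ℤ → Ω → ℝ) (hX : ∀ i, Measurable (X i)) (hZ : ∀ i, Measurable (Z i))
    (hst : IsPairStationary P X Z) (k : ℤ) :
    P.map (fun ω (i : ℤ) => (X i ω, Z i ω)) = P.map (fun ω (i : ℤ) => (X (i + k) ω, Z (i + k) ω)) := by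
  have := (ProbabilityTheory.map_eq_iff_forall_finset_map_restrict_eq (P := P) (T := ℤ)
    (X := fun i ω => (X i ω, Z i ω)) (Y := fun i ω => (X (i + k) ω, Z (i + k) ω))
    (measurable_pi_iff.2 fun i => (hX i).prodMk (hZ i)).aemeasurable
    (measurable_pi_iff.2 fun i => (hX _).prodMk (hZ _)).aemeasurable).2
  apply this
  intro I
  have h1 := hst k I.card (fun i => (I.equivFin.symm i : ℤ))
  let T : (Fin I.card → ℝ × ℝ) → (I → ℝ × ℝ) := fun v i => v (I.equivFin i)
  have hT : Measurable T := measurable_pi_iff.2 fun i => measurable_pi_apply _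
  have h2 := congrArg (Measure.map T) h1
  rw [Measure.map_map hT (measurable_pi_iff.2 fun i => (hX _).prodMk (hZ _)),
    Measure.map_map hT (measurable_pi_iff.2 fun i => (hX _).prodMk (hZ _))] at h2
  convert h2 using 2
  · ext ω i <;> simp [T]
  · ext ω i <;> simp [T]

lemma exists_mix {Ω : Type*} [MeasurableSpace Ω] (P : Measure Ω) [IsProbabilityMeasure P]
    (X Z : ℤ → Ω → ℝ) (hX : ∀ i, Measurable (X i)) (hZ : ∀ i, Measurable (Z i))
    (hA1 : Assumption1 P X Z) : Nonempty (Mix P X) := by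
  obtain ⟨hst, ⟨a, φ, -, -, -, ⟨f, hf, hfa⟩, hO⟩, ⟨β, hβ0, hβ, hβs⟩⟩ := hA1
  have hlaw := process_law P X Z hX hZ hst
  have hpath : ∀ k : ℤ, Measurable (fun ω (i : ℤ) => (X (i + k) ω, Z (i + k) ω)) := fun k =>
    measurable_pi_iff.2 fun i => (hX _).prodMk (hZ _)
  have hpath0 : Measurable (fun ω (i : ℤ) => (X i ω, Z i ω)) :=
    measurable_pi_iff.2 fun i => (hX _).prodMk (hZ _)
  let ξ : ℕ → ℤ → Ω → ℝ := fun l i ω => f l (fun j => Z (i + ((j : ℕ) : ℤ) - l) ω)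
  have hξ : ∀ l i, Measurable (ξ l i) := fun l i =>
    (hf l).comp (measurable_pi_iff.2 fun j => hZ _)
  let past : ℤ → MeasurableSpace Ω := fun s =>
    MeasurableSpace.comap (fun ω (i : {i : ℤ // i ≤ 0}) => Z (i + s) ω) MeasurableSpace.pi
  let fut : ℤ → MeasurableSpace Ω := fun s =>
    MeasurableSpace.comap (fun ω (i : ℕ) => Z (s + i) ω) MeasurableSpace.pi
  have hZpast : ∀ (s i : ℤ), i ≤ s → Measurable[past s] (Z i) := by
    intro s i hi
    have h1 : Measurable[past s] (fun ω (i : {i : ℤ // i ≤ 0}) => Z (i + s) ω) :=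
      comap_measurable _
    have h2 := (measurable_pi_apply (⟨i - s, by omega⟩ : {i : ℤ // i ≤ 0})).comp h1
    convert h2 using 1
    ext ω
    simp
  have hZfut : ∀ (s i : ℤ), s ≤ i → Measurable[fut s] (Z i) := by
    intro s i hi
    have h1 : Measurable[fut s] (fun ω (i : ℕ) => Z (s + i) ω) := comap_measurable _
    have h2 := (measurable_pi_apply ((i - s).toNat : ℕ)).comp h1
    convert h2 using 1
    ext ω
    simp only [Function.comp]
    congr 1; omega
  have hpast_of : ∀ (s : ℤ) (m : MeasurableSpace Ω), (∀ i ≤ s, Measurable[m] (Z i)) → past s ≤ m := by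
    intro s m hm
    apply Measurable.comap_le
    exact measurable_pi_iff.2 fun i => hm _ (by have := i.2; omega)
  have hfut_of : ∀ (s : ℤ) (m : MeasurableSpace Ω), (∀ i ≥ s, Measurable[m] (Z i)) → fut s ≤ m := by
    intro s m hm
    apply Measurable.comap_le
    exact measurable_pi_iff.2 fun i => hm _ (by omega)
  have hpast0 : past 0 ≤ pastSigma Z := hpast_of 0 _ fun i hi =>
    Measurable.of_comap_le (le_iSup (fun i : {i : ℤ // i ≤ 0} =>
      MeasurableSpace.comap (Z i) Real.measurableSpace) ⟨i, hi⟩)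
  have hfut0 : ∀ k : ℕ, fut k ≤ futureSigma Z k := fun k => hfut_of k _ fun i hi =>
    Measurable.of_comap_le (le_iSup (fun i : {i : ℤ // (k : ℤ) ≤ i} =>
      MeasurableSpace.comap (Z i) Real.measurableSpace) ⟨i, hi⟩)
  have hpl : ∀ s, past s ≤ ‹MeasurableSpace Ω› := fun s => hpast_of s _ fun i _ => hZ i
  have hfl : ∀ s, fut s ≤ ‹MeasurableSpace Ω› := fun s => hfut_of s _ fun i _ => hZ i
  have hfa' : ∀ s t : ℤ, s ≤ t → fut t ≤ fut s := fun s t hst' =>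
    hfut_of t _ fun i hi => hZfut s i (hst'.trans hi)
  have hne : Nonempty Ω := P.nonempty_of_neZero
  have hclose0 : ∀ (s : ℤ) (k : ℕ) (α α' : Type) [MeasurableSpace α] [MeasurableSpace α']
    (A : Ω → α) (B : Ω → α'), Measurable[past s] A → Measurable[fut (s + k)] B →
    Close P A B (2 * β k) := by
    intro s k α α' _ _ A B hA hB
    apply close_of_partitions P A B (hA.mono (hpl _) le_rfl) (hB.mono (hfl _) le_rfl)
    intro m m' φ' ψ hφ hψ
    have n1 : Nonempty (Fin m) := ⟨φ' (A hne.some)⟩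
    have n2 : Nonempty (Fin m') := ⟨ψ (B hne.some)⟩
    obtain ⟨g, hg, hgA⟩ := Measurable.exists_eq_measurable_comp (g := φ' ∘ A)
      (f := fun ω (i : {i : ℤ // i ≤ 0}) => Z (i + s) ω) (hφ.comp hA)
    obtain ⟨g', hg', hgB⟩ := Measurable.exists_eq_measurable_comp (g := ψ ∘ B)
      (f := fun ω (i : ℕ) => Z (s + k + i) ω) (hψ.comp hB)
    let T : (ℤ → ℝ × ℝ) → Fin m × Fin m' := fun w =>
      (g (fun i => (w i).2), g' (fun i => (w ((k : ℤ) + i)).2))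
    have hT : Measurable T := by
      refine (hg.comp (measurable_pi_iff.2 fun i => ?_)).prodMk
        (hg'.comp (measurable_pi_iff.2 fun i => ?_))
      · exact measurable_snd.comp (measurable_pi_apply _)
      · exact measurable_snd.comp (measurable_pi_apply _)
    have hTs : ∀ S : Set (Fin m × Fin m'),
        P.real {ω | (φ' (A ω), ψ (B ω)) ∈ S}
        = P.real {ω | (g (fun i => Z i ω), g' (fun i => Z ((k : ℤ) + i) ω)) ∈ S} := by
      intro S
      have hS : MeasurableSet S := S.toFinite.measurableSet
      have e := congrArg (fun ν => ν.real (T ⁻¹' S)) (hlaw s)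
      beta_reduce at e
      rw [map_measureReal_apply hpath0 (hT hS), map_measureReal_apply (hpath s) (hT hS)] at e
      refine Eq.trans ?_ e.symm
      congr 1
      ext ω
      have e1 : φ' (A ω) = g (fun i => Z (i + s) ω) := congrFun hgA ω
      have e2 : ψ (B ω) = g' (fun i => Z (s + k + i) ω) := congrFun hgB ω
      simp only [mem_ofPred_eq, mem_preimage, T, e1, e2]
      have e3 : ∀ i : ℕ, s + (k : ℤ) + i = k + i + s := fun i => by ring
      simp only [e3]
    have key := hβ k m m' (fun i => {ω | g (fun i => Z i ω) = i})
      (fun j => {ω | g' (fun i => Z ((k : ℤ) + i) ω) = j}) ?_ ?_ ?_ ?_ ?_ ?_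
    · have : ∑ i, ∑ j, |P.real ((φ' ∘ A) ⁻¹' {i} ∩ (ψ ∘ B) ⁻¹' {j})
        - P.real ((φ' ∘ A) ⁻¹' {i}) * P.real ((ψ ∘ B) ⁻¹' {j})|
        = ∑ i, ∑ j, |(P ({ω | g (fun i => Z i ω) = i} ∩ {ω | g' (fun i => Z ((k : ℤ) + i) ω) = j})).toReal
          - (P {ω | g (fun i => Z i ω) = i}).toReal
            * (P {ω | g' (fun i => Z ((k : ℤ) + i) ω) = j}).toReal| := by
        refine Finset.sum_congr rfl fun i _ => Finset.sum_congr rfl fun j _ => ?_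
        have r1 := hTs {(i, j)}
        have r2 := hTs {z | z.1 = i}
        have r3 := hTs {z | z.2 = j}
        simp only [mem_singleton_iff, Prod.mk.injEq, mem_ofPred_eq] at r1 r2 r3
        congr 2
        congr 1
      rw [this]
      linarith
    · intro i
      apply hpast0
      have : Measurable[past 0] (fun ω (i : {i : ℤ // i ≤ 0}) => Z i ω) :=
        meas_pi _ (fun (i : {i : ℤ // i ≤ 0}) ω => Z i ω) fun i => hZpast 0 _ i.2
      exact (hg.comp this) (measurableSet_singleton i)
    · intro j
      apply hfut0
      have : Measurable[fut k] (fun ω (i : ℕ) => Z ((k : ℤ) + i) ω) :=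
        meas_pi _ (fun (i : ℕ) ω => Z ((k : ℤ) + i) ω) fun i => hZfut k _ (by omega)
      exact (hg'.comp this) (measurableSet_singleton j)
    · intro i i' hii
      apply Set.disjoint_left.2
      intro ω h1 h2
      exact hii (h1.symm.trans h2)
    · intro i i' hii
      apply Set.disjoint_left.2
      intro ω h1 h2
      exact hii (h1.symm.trans h2)
    · ext ω; simp
    · ext ω; simp
  have hrm : ∀ k, 0 ≤ runMin β k ∧ runMin β k ≤ β k := by
    intro k
    induction k with
    | zero => exact ⟨hβ0 0, le_rfl⟩
    | succ k ih => exact ⟨le_min ih.1 (hβ0 _), min_le_right _ _⟩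
  have happ : ∃ C : ℝ, 0 ≤ C ∧ ∀ l : ℕ, 1 ≤ l →
      P.real {ω | 1 / (l : ℝ) ^ 6 < |X 0 ω - ξ l 0 ω|} ≤ C / (l : ℝ) ^ 6 := by
    obtain ⟨C, hC⟩ := hO.bound
    obtain ⟨l0, hl0⟩ := eventually_atTop.1 hC
    refine ⟨max C 0 + (l0 : ℝ) ^ 6, by positivity, fun l hl => ?_⟩
    have hlpos : (0 : ℝ) < l := by exact_mod_cast hl
    by_cases hll : l0 ≤ l
    · have h1 := hl0 l hll
      have h2 := hfa l (1 / (l : ℝ) ^ 6) (by positivity)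
      have e1 : (l : ℝ) ^ (-6 : ℤ) = 1 / (l : ℝ) ^ 6 := by
        rw [zpow_neg, one_div]; norm_cast
      rw [e1] at h1
      have h3 : P.real {ω | 1 / (l : ℝ) ^ 6 < |X 0 ω - ξ l 0 ω|} ≤ a l * φ (1 / (l : ℝ) ^ 6) := by
        simpa [ξ, measureReal_def] using h2
      have h4 : a l * φ (1 / (l : ℝ) ^ 6) ≤ C * (1 / (l : ℝ) ^ 6) := by
        have h5 : ‖(1 / (l : ℝ) ^ 6)‖ = 1 / (l : ℝ) ^ 6 := by
          rw [Real.norm_eq_abs, abs_of_nonneg (by positivity)]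
        rw [h5] at h1
        exact (le_abs_self _).trans h1
      refine (h3.trans h4).trans ?_
      rw [mul_one_div]
      gcongr
      have : C ≤ max C 0 := le_max_left _ _
      have : (0 : ℝ) ≤ (l0 : ℝ) ^ 6 := by positivity
      linarith
    · refine measureReal_le_one.trans ?_
      rw [le_div_iff₀ (by positivity), one_mul]
      have h6 : (l : ℝ) ^ 6 ≤ (l0 : ℝ) ^ 6 := by
        gcongr; omega
      have : 0 ≤ max C 0 := le_max_right _ _
      linarith
  obtain ⟨C, hC0, hC⟩ := happ
  refine ⟨{
    ξ := ξ
    bt := runMin β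
    Cp := C
    past := past
    fut := fut
    hX := hX
    hξ := hξ
    law := ?_
    Cp_nonneg := hC0
    approx := hC
    past_mono := fun s t hst' => hpast_of s _ fun i hi => hZpast t i (hi.trans hst')
    fut_anti := hfa'
    past_le := hpl
    fut_le := hfl
    ξ_past := ?_
    ξ_fut := ?_
    bt_nonneg := fun k => (hrm k).1
    bt_anti := antitone_nat_of_succ_le fun k => min_le_left _ _
    bt_sum := ?_
    close := ?_ }⟩
  · intro i
    let T : (ℤ → ℝ × ℝ) → ℝ × (ℕ → ℝ) := fun w =>
      ((w 0).1, fun l => f l (fun j => (w (0 + ((j : ℕ) : ℤ) - l)).2))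
    have hT : Measurable T := by
      refine (measurable_fst.comp (measurable_pi_apply _)).prodMk (measurable_pi_iff.2 fun l => ?_)
      exact (hf l).comp (measurable_pi_iff.2 fun j => measurable_snd.comp (measurable_pi_apply _))
    have e := congrArg (Measure.map T) (hlaw i)
    rw [Measure.map_map hT hpath0, Measure.map_map hT (hpath i)] at e
    refine Eq.trans ?_ e.symm
    congr 1
    ext ω
    · simp [T]
    · simp only [T, ξ, Function.comp]
      congr 1
      ext j
      congr 1
      ring
  · intro l i s his
    exact (hf l).comp (meas_pi _ (fun (j : Fin (2 * l + 1)) ω => Z (i + ((j : ℕ) : ℤ) - l) ω)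
      fun j => hZpast s _ (by have := j.2; omega))
  · intro l i s his
    exact (hf l).comp (meas_pi _ (fun (j : Fin (2 * l + 1)) ω => Z (i + ((j : ℕ) : ℤ) - l) ω)
      fun j => hZfut s _ (by have := j.2; omega))
  · rw [← summable_nat_add_iff 1]
    refine Summable.of_nonneg_of_le (fun k => mul_nonneg (by positivity) (hrm _).1) (fun k => ?_)
      (((summable_nat_add_iff 1).2 hβs).mul_left 2)
    have h1 := hrm (k + 1)
    push_cast
    have h2 : (0 : ℝ) ≤ k := Nat.cast_nonneg k
    nlinarith [hβ0 (k + 1)]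
  · intro s k α α' _ _ A B hA
    have hgen : ∀ (k : ℕ) (k' : ℕ), k ≤ k' → Measurable[fut (s + k')] B →
        Close P A B (2 * runMin β k) := by
      intro k
      induction k with
      | zero =>
        intro k' _ hB
        exact hclose0 s 0 α α' A B hA (hB.mono (hfa' _ _ (by simp)) le_rfl)
      | succ k ih =>
        intro k' hk' hB
        have h1 := ih k' (by omega) hB
        have h2 := hclose0 s (k + 1) α α' A B hA
          (hB.mono (hfa' _ _ (by push_cast; omega)) le_rfl)
        intro D hD
        change _ ≤ 2 * min (runMin β k) (β (k + 1))
        rw [mul_min_of_nonneg _ _ (by norm_num)]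
        exact le_min (h1 D hD) (h2 D hD)
    exact hgen k k le_rfl

section MixBasic

variable {Ω : Type*} [MeasurableSpace Ω] {P : Measure Ω} {X : ℤ → Ω → ℝ}

lemma Mix.bt_sq (m : Mix P X) : ∃ C : ℝ, 0 ≤ C ∧ ∀ k : ℕ, m.bt k ≤ C / ((k : ℝ) + 1) ^ 2 := by
  refine ⟨2 * ∑' k : ℕ, ((k : ℝ) + 1) * m.bt k, ?_, fun k => ?_⟩
  · have : 0 ≤ ∑' k : ℕ, ((k : ℝ) + 1) * m.bt k :=
      tsum_nonneg fun k => mul_nonneg (by positivity) (m.bt_nonneg k)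
    linarith
  · have h1 : ∑ i ∈ Finset.range (k + 1), ((i : ℝ) + 1) * m.bt i
        ≤ ∑' k : ℕ, ((k : ℝ) + 1) * m.bt k :=
      m.bt_sum.sum_le_tsum _ fun i _ => mul_nonneg (by positivity) (m.bt_nonneg i)
    have h2 : ∑ i ∈ Finset.range (k + 1), ((i : ℝ) + 1) * m.bt k
        ≤ ∑ i ∈ Finset.range (k + 1), ((i : ℝ) + 1) * m.bt i :=
      Finset.sum_le_sum fun i hi => mul_le_mul_of_nonneg_left
        (m.bt_anti (by have := Finset.mem_range.1 hi; omega)) (by positivity)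
    rw [← Finset.sum_mul] at h2
    have h3 : ∀ n : ℕ, ((n : ℝ)) ^ 2 ≤ 2 * ∑ i ∈ Finset.range n, ((i : ℝ) + 1) := by
      intro n
      induction n with
      | zero => simp
      | succ n ih =>
        rw [Finset.sum_range_succ]; push_cast
        have : (0 : ℝ) ≤ n := Nat.cast_nonneg n
        nlinarith
    rw [le_div_iff₀ (by positivity)]
    have h4 := h3 (k + 1)
    push_cast at h4
    have h5 := mul_le_mul_of_nonneg_right h4 (m.bt_nonneg k)
    nlinarith

end MixBasic

end UQuantile

namespace UQuantile

/-- A fixed kernel with the variation condition. -/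
structure Ker (μ : Measure ℝ) (k : ℝ → ℝ → ℝ) (M L : ℝ) : Prop where
  meas : Measurable fun q : ℝ × ℝ => k q.1 q.2
  nonneg : ∀ x y, 0 ≤ k x y
  le : ∀ x y, k x y ≤ M
  Mpos : 1 ≤ M
  Lpos : 0 < L
  symm : ∀ x y, k x y = k y x
  var : ∀ ε > (0 : ℝ),
    ∫⁻ q : ℝ × ℝ, ENNReal.ofReal
        ((⨆ r ∈ Metric.closedBall q ε, |k r.1 r.2 - k q.1 q.2|) ^ 2) ∂(μ.prod μ)
      ≤ ENNReal.ofReal (L * ε)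

/-- Local oscillation. -/
def osc (k : ℝ → ℝ → ℝ) (ε : ℝ) (q : ℝ × ℝ) : ℝ :=
  ⨆ r ∈ Metric.closedBall q ε, |k r.1 r.2 - k q.1 q.2|

section KerSec

variable {μ : Measure ℝ} {k : ℝ → ℝ → ℝ} {M L : ℝ}

lemma Ker.abs_sub_le (hk : Ker μ k M L) (x y x' y' : ℝ) : |k x y - k x' y'| ≤ M := by
  rw [abs_le]
  constructor <;> linarith [hk.nonneg x y, hk.le x y, hk.nonneg x' y', hk.le x' y']

lemma Ker.le_osc (hk : Ker μ k M L) (ε : ℝ) (q r : ℝ × ℝ) (hr : dist r q ≤ ε) :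
    |k r.1 r.2 - k q.1 q.2| ≤ osc k ε q := by
  have hM0 : 0 ≤ M := by linarith [hk.Mpos]
  refine le_ciSup_of_le (f := fun r => ⨆ (_ : r ∈ Metric.closedBall q ε), |k r.1 r.2 - k q.1 q.2|)
    ⟨M, ?_⟩ r ?_
  · rintro _ ⟨r, rfl⟩
    exact Real.iSup_le (fun _ => hk.abs_sub_le _ _ _ _) hM0
  · rw [ciSup_pos (Metric.mem_closedBall.2 hr)]

lemma osc_nonneg (k : ℝ → ℝ → ℝ) (ε : ℝ) (q : ℝ × ℝ) : 0 ≤ osc k ε q :=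
  Real.iSup_nonneg fun _ => Real.iSup_nonneg fun _ => abs_nonneg _

lemma disint {Ω' : Type*} [MeasurableSpace Ω'] (Q : Measure Ω') [IsProbabilityMeasure Q]
    (q r : Ω' → ℝ × ℝ) (hq : Measurable q) (hr : Measurable r) (D : ℝ × ℝ → ℝ × ℝ → ℝ)
    (hD : Measurable fun z : (ℝ × ℝ) × (ℝ × ℝ) => D z.1 z.2) (B : ℝ) (hD0 : ∀ a b, 0 ≤ D a b)
    (hDB : ∀ a b, D a b ≤ B) :
    ∃ F : ℝ × ℝ → ℝ, Measurable F ∧ (∀ a, 0 ≤ F a) ∧ (∀ a s, (∀ b, D a b ≤ s) → F a ≤ s) ∧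
      ∫ ω, D (q ω) (r ω) ∂Q = ∫ ω, F (q ω) ∂Q := by
  have i1 : IsProbabilityMeasure (Q.map (fun ω => (q ω, r ω))) :=
    Measure.isProbabilityMeasure_map (hq.prodMk hr).aemeasurable
  set π := Q.map (fun ω => (q ω, r ω)) with hπ
  have hIntg : ∀ a, Integrable (fun b => D a b) (π.condKernel a) := fun a =>
    Integrable.of_bound (hD.comp measurable_prodMk_left).aestronglyMeasurable B
      (Eventually.of_forall fun b => by
        rw [Real.norm_eq_abs, abs_of_nonneg (hD0 a b)]; exact hDB a b)
  have hsm : StronglyMeasurable (fun a => ∫ b, D a b ∂(π.condKernel a)) :=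
    hD.stronglyMeasurable.integral_kernel_prod_right'
  refine ⟨fun a => ∫ b, D a b ∂(π.condKernel a), ?_, ?_, ?_, ?_⟩
  · exact hsm.measurable
  · intro a; exact integral_nonneg fun b => hD0 a b
  · intro a s hs
    calc ∫ b, D a b ∂(π.condKernel a) ≤ ∫ b, s ∂(π.condKernel a) :=
          integral_mono (hIntg a) (integrable_const s) hs
      _ = s := by simp
  · have e1 : ∫ ω, D (q ω) (r ω) ∂Q = ∫ z, D z.1 z.2 ∂π := by
      rw [hπ, integral_map (hq.prodMk hr).aemeasurable hD.aestronglyMeasurable]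
    have e2 : π.fst = Q.map q := by
      rw [hπ]; exact Measure.fst_map_prodMk hr
    have hDi : Integrable (fun z : (ℝ × ℝ) × (ℝ × ℝ) => D z.1 z.2) (Measure.compProd π.fst π.condKernel) :=
      Integrable.of_bound hD.aestronglyMeasurable B
      (Eventually.of_forall fun b => by
        rw [Real.norm_eq_abs, abs_of_nonneg (hD0 _ _)]; exact hDB _ _)
    rw [e1]
    conv_lhs => rw [← π.disintegrate π.condKernel]
    rw [Measure.integral_compProd hDi, e2, integral_map hq.aemeasurable hsm.aestronglyMeasurable]

lemma Ker.sup_bound (hk : Ker μ k M L) {Ω' : Type*} [MeasurableSpace Ω'] (Q : Measure Ω')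
    [IsProbabilityMeasure Q]
    (q r : Ω' → ℝ × ℝ) (hq : Measurable q) (hr : Measurable r) (hlaw : Q.map q = μ.prod μ)
    (D : ℝ × ℝ → ℝ × ℝ → ℝ)
    (hD : Measurable fun z : (ℝ × ℝ) × (ℝ × ℝ) => D z.1 z.2) (B : ℝ) (hD0 : ∀ a b, 0 ≤ D a b)
    (hDB : ∀ a b, D a b ≤ B) (c ε : ℝ) (hc : 0 < c) (hε : 0 < ε)
    (hS : ∀ a b, D a b ≤ c * osc k ε a) :
    ∫ ω, D (q ω) (r ω) ∂Q ≤ c * √(L * ε) := by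
  obtain ⟨F, hF, hF0, hFs, hFe⟩ := disint Q q r hq hr D hD B hD0 hDB
  rw [hFe]
  have hFB : ∀ a, F a ≤ B := fun a => hFs a B (hDB a)
  have hFS : ∀ a, F a ≤ c * osc k ε a := fun a => hFs a _ (hS a)
  have hpr : IsProbabilityMeasure (μ.prod μ) := by
    rw [← hlaw]; exact Measure.isProbabilityMeasure_map hq.aemeasurable
  have e0 : ∫ ω, F (q ω) ∂Q = ∫ a, F a ∂(μ.prod μ) := by
    rw [← hlaw, integral_map hq.aemeasurable hF.aestronglyMeasurable]
  rw [e0]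
  have iF : Integrable F (μ.prod μ) := Integrable.of_bound hF.aestronglyMeasurable B
    (Eventually.of_forall fun b => by
      rw [Real.norm_eq_abs, abs_of_nonneg (hF0 _)]; exact hFB _)
  have iF2 : Integrable (fun a => F a ^ 2) (μ.prod μ) :=
    Integrable.of_bound (hF.pow_const 2).aestronglyMeasurable (B ^ 2)
    (Eventually.of_forall fun b => by
      rw [norm_pow, Real.norm_eq_abs, abs_of_nonneg (hF0 _)]
      exact pow_le_pow_left₀ (hF0 _) (hFB _) 2)
  have hLε : 0 < L * ε := mul_pos hk.Lpos hε
  have h2 : ∫ a, F a ^ 2 ∂(μ.prod μ) ≤ c ^ 2 * (L * ε) := by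
    rw [integral_eq_lintegral_of_nonneg_ae (Eventually.of_forall fun a => sq_nonneg _)
      iF2.aestronglyMeasurable]
    apply ENNReal.toReal_le_of_le_ofReal (by positivity)
    calc ∫⁻ a, ENNReal.ofReal (F a ^ 2) ∂(μ.prod μ)
        ≤ ∫⁻ a, ENNReal.ofReal (c ^ 2) * ENNReal.ofReal (osc k ε a ^ 2) ∂(μ.prod μ) := by
          apply lintegral_mono
          intro a
          dsimp only
          rw [← ENNReal.ofReal_mul (by positivity), ← mul_pow]
          exact ENNReal.ofReal_le_ofReal (pow_le_pow_left₀ (hF0 a) (hFS a) 2)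
      _ = ENNReal.ofReal (c ^ 2) * ∫⁻ a, ENNReal.ofReal (osc k ε a ^ 2) ∂(μ.prod μ) :=
          lintegral_const_mul' _ _ ENNReal.ofReal_ne_top
      _ ≤ ENNReal.ofReal (c ^ 2) * ENNReal.ofReal (L * ε) := by
          gcongr
          exact hk.var ε hε
      _ = _ := by rw [← ENNReal.ofReal_mul (by positivity)]
  set a := c * √(L * ε) with ha
  have hapos : 0 < a := by positivity
  have ha2 : a ^ 2 = c ^ 2 * (L * ε) := by rw [ha, mul_pow, Real.sq_sqrt hLε.le]
  have hpt : ∀ x, F x ≤ (2 * a)⁻¹ * F x ^ 2 + a / 2 := by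
    intro x
    have : (2 * a)⁻¹ * F x ^ 2 + a / 2 - F x = (F x - a) ^ 2 / (2 * a) := by
      field_simp; ring
    have h3 : 0 ≤ (F x - a) ^ 2 / (2 * a) := by positivity
    linarith
  calc ∫ x, F x ∂(μ.prod μ) ≤ ∫ x, ((2 * a)⁻¹ * F x ^ 2 + a / 2) ∂(μ.prod μ) :=
        integral_mono iF ((iF2.const_mul _).add (integrable_const _)) hpt
    _ = (2 * a)⁻¹ * ∫ x, F x ^ 2 ∂(μ.prod μ) + a / 2 := by
        rw [integral_add (iF2.const_mul _) (integrable_const _), integral_const_mul]; simp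
    _ ≤ (2 * a)⁻¹ * a ^ 2 + a / 2 := by rw [ha2]; gcongr
    _ = a := by field_simp; norm_num

lemma measurable_near (k : ℝ → ℝ → ℝ) (hk : Measurable fun q : ℝ × ℝ => k q.1 q.2) (ε : ℝ) :
    Measurable fun z : (ℝ × ℝ) × (ℝ × ℝ) =>
      if dist z.2 z.1 ≤ ε then |k z.2.1 z.2.2 - k z.1.1 z.1.2| else 0 := by
  refine Measurable.ite (measurableSet_le (measurable_snd.dist measurable_fst) measurable_const)
    ?_ measurable_const
  exact (((hk.comp measurable_snd).sub (hk.comp measurable_fst)).abs : Measurable _)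

/-- Splitting off the event of a large deviation. -/
lemma split_event {Ω' : Type*} [MeasurableSpace Ω'] (Q : Measure Ω') [IsProbabilityMeasure Q]
    (f g : Ω' → ℝ) (hf : Measurable f) (hg : Measurable g) (M : ℝ) (hM : 0 ≤ M)
    (hfM : ∀ ω, |f ω| ≤ M) (hgM : ∀ ω, |g ω| ≤ M) (hg0 : ∀ ω, 0 ≤ g ω) (S S' : Set Ω')
    (hS : MeasurableSet S) (hS' : MeasurableSet S')
    (H : ∀ ω, ω ∉ S → ω ∉ S' → f ω ≤ g ω) :
    ∫ ω, f ω ∂Q ≤ ∫ ω, g ω ∂Q + M * (Q.real S + Q.real S') := by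
  have ig : Integrable g Q := Integrable.of_bound hg.aestronglyMeasurable M (Eventually.of_forall hgM)
  have if' : Integrable f Q := Integrable.of_bound hf.aestronglyMeasurable M (Eventually.of_forall hfM)
  have i1 : Integrable (S.indicator fun _ => M) Q := (integrable_const M).indicator hS
  have i2 : Integrable (S'.indicator fun _ => M) Q := (integrable_const M).indicator hS'
  have i12 : Integrable (fun ω => S.indicator (fun _ => M) ω + S'.indicator (fun _ => M) ω) Q :=
    i1.add i2
  have i123 : Integrable
      (fun ω => g ω + (S.indicator (fun _ => M) ω + S'.indicator (fun _ => M) ω)) Q := ig.add i12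
  calc ∫ ω, f ω ∂Q ≤ ∫ ω, (g ω + (S.indicator (fun _ => M) ω + S'.indicator (fun _ => M) ω)) ∂Q := by
        apply integral_mono if' i123
        intro ω
        dsimp only
        have a1 : 0 ≤ S.indicator (fun _ => M) ω := indicator_nonneg (fun _ _ => hM) _
        have a2 : 0 ≤ S'.indicator (fun _ => M) ω := indicator_nonneg (fun _ _ => hM) _
        have h0 := hg0 ω
        have h3 := (le_abs_self _).trans (hfM ω)
        by_cases h1 : ω ∈ S
        · simp only [indicator_of_mem h1] at *; linarith
        · by_cases h2 : ω ∈ S'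
          · simp only [indicator_of_mem h2] at *; linarith
          · have := H ω h1 h2; linarith
    _ = _ := by
        rw [integral_add ig i12, integral_add i1 i2, integral_indicator_const _ hS,
          integral_indicator_const _ hS']
        simp only [smul_eq_mul]; ring

lemma Ker.var_gen (hk : Ker μ k M L) {Ω' : Type*} [MeasurableSpace Ω'] (Q : Measure Ω')
    [IsProbabilityMeasure Q] (x y x' y' : Ω' → ℝ) (hx : Measurable x) (hy : Measurable y)
    (hx' : Measurable x') (hy' : Measurable y') (hlaw : Q.map (fun ω => (x ω, y ω)) = μ.prod μ)
    (ε : ℝ) (hε : 0 < ε) :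
    ∫ ω, |k (x' ω) (y' ω) - k (x ω) (y ω)| ∂Q
      ≤ √(L * ε) + M * (Q.real {ω | ε < |x ω - x' ω|} + Q.real {ω | ε < |y ω - y' ω|}) := by
  have hM0 : 0 ≤ M := by linarith [hk.Mpos]
  have hq : Measurable fun ω => (x ω, y ω) := hx.prodMk hy
  have hr : Measurable fun ω => (x' ω, y' ω) := hx'.prodMk hy'
  set D : ℝ × ℝ → ℝ × ℝ → ℝ := fun a b => if dist b a ≤ ε then |k b.1 b.2 - k a.1 a.2| else 0 with hDd
  have hD := measurable_near k hk.meas ε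
  have hD0 : ∀ a b, 0 ≤ D a b := fun a b => by
    simp only [hDd]; split_ifs <;> positivity
  have hDB : ∀ a b, D a b ≤ M := fun a b => by
    simp only [hDd]; split_ifs
    · exact hk.abs_sub_le _ _ _ _
    · exact hM0
  have hDS : ∀ a b, D a b ≤ 1 * osc k ε a := fun a b => by
    simp only [hDd, one_mul]; split_ifs with hd
    · exact hk.le_osc ε a b hd
    · exact osc_nonneg _ _ _
  have h1 := hk.sup_bound Q _ _ hq hr hlaw D hD M hD0 hDB 1 ε one_pos hε hDS
  rw [one_mul] at h1
  have h2 := split_event Q (fun ω => |k (x' ω) (y' ω) - k (x ω) (y ω)|)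
    (fun ω => D (x ω, y ω) (x' ω, y' ω))
    ((hk.meas.comp hr).sub (hk.meas.comp hq)).abs (hD.comp (hq.prodMk hr)) M hM0
    (fun ω => by rw [abs_abs]; exact hk.abs_sub_le _ _ _ _)
    (fun ω => by rw [abs_of_nonneg (hD0 _ _)]; exact hDB _ _) (fun ω => hD0 _ _)
    {ω | ε < |x ω - x' ω|} {ω | ε < |y ω - y' ω|}
    (measurableSet_lt measurable_const (hx.sub hx').abs)
    (measurableSet_lt measurable_const (hy.sub hy').abs) (by
      intro ω ha hb
      simp only [mem_ofPred_eq, not_lt] at ha hb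
      have hd : dist (x' ω, y' ω) (x ω, y ω) ≤ ε := by
        rw [Prod.dist_eq, max_le_iff, dist_comm, dist_comm (y' ω, y' ω).2]
        exact ⟨by rw [Real.dist_eq]; exact ha, by rw [dist_comm, dist_comm (y' ω), Real.dist_eq]; exact hb⟩
      simp only [hDd, if_pos hd]; exact le_rfl)
  linarith

end KerSec

section MixKer

variable {Ω : Type*} [MeasurableSpace Ω] {P : Measure Ω} [IsProbabilityMeasure P] {X : ℤ → Ω → ℝ}

lemma Mix.law_pair (m : Mix P X) (l : ℕ) (i : ℤ) :
    P.map (fun ω => (X i ω, m.ξ l i ω)) = P.map (fun ω => (X 0 ω, m.ξ l 0 ω)) := by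
  have hm : ∀ i, Measurable (fun ω => (X i ω, fun l => m.ξ l i ω)) := fun i =>
    (m.hX i).prodMk (measurable_pi_iff.2 fun l => m.hξ l i)
  have hT : Measurable (fun z : ℝ × (ℕ → ℝ) => (z.1, z.2 l)) :=
    measurable_fst.prodMk ((measurable_pi_apply l).comp measurable_snd)
  have e := congrArg (Measure.map (fun z : ℝ × (ℕ → ℝ) => (z.1, z.2 l))) (m.law i)
  rw [Measure.map_map hT (hm i), Measure.map_map hT (hm 0)] at e
  exact e

lemma Mix.law_pair2 (m : Mix P X) (k l : ℕ) (i : ℤ) :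
    P.map (fun ω => (m.ξ k i ω, m.ξ l i ω)) = P.map (fun ω => (m.ξ k 0 ω, m.ξ l 0 ω)) := by
  have hm : ∀ i, Measurable (fun ω => (X i ω, fun l => m.ξ l i ω)) := fun i =>
    (m.hX i).prodMk (measurable_pi_iff.2 fun l => m.hξ l i)
  have hT : Measurable (fun z : ℝ × (ℕ → ℝ) => (z.2 k, z.2 l)) :=
    ((measurable_pi_apply k).comp measurable_snd).prodMk
      ((measurable_pi_apply l).comp measurable_snd)
  have e := congrArg (Measure.map (fun z : ℝ × (ℕ → ℝ) => (z.2 k, z.2 l))) (m.law i)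
  rw [Measure.map_map hT (hm i), Measure.map_map hT (hm 0)] at e
  exact e

lemma Mix.law_ξ (m : Mix P X) (l : ℕ) (i : ℤ) : P.map (m.ξ l i) = P.map (m.ξ l 0) := by
  have e := congrArg (Measure.map Prod.snd) (m.law_pair l i)
  rwa [Measure.map_map measurable_snd ((m.hX i).prodMk (m.hξ l i)),
    Measure.map_map measurable_snd ((m.hX 0).prodMk (m.hξ l 0))] at e

lemma Mix.int_ξ (m : Mix P X) (l : ℕ) (i : ℤ) (f : ℝ → ℝ) (hf : Measurable f) :
    ∫ ω, f (m.ξ l i ω) ∂P = ∫ ω, f (m.ξ l 0 ω) ∂P := by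
  rw [← integral_map (m.hξ l i).aemeasurable hf.aestronglyMeasurable, m.law_ξ,
    integral_map (m.hξ l 0).aemeasurable hf.aestronglyMeasurable]

lemma Mix.approx' (m : Mix P X) (k l : ℕ) (hk : 1 ≤ k) (hkl : k ≤ l) (i : ℤ) :
    P.real {ω | 1 / (k : ℝ) ^ 6 < |X i ω - m.ξ l i ω|} ≤ m.Cp / (k : ℝ) ^ 6 := by
  have hkpos : (0 : ℝ) < k := by exact_mod_cast hk
  have hlpos : (0 : ℝ) < l := by exact_mod_cast (hk.trans hkl)
  have hkl' : (k : ℝ) ≤ l := by exact_mod_cast hkl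
  have hS : MeasurableSet {z : ℝ × ℝ | 1 / (k : ℝ) ^ 6 < |z.1 - z.2|} :=
    measurableSet_lt measurable_const (measurable_fst.sub measurable_snd).abs
  have e := congrArg (fun ν => ν.real {z : ℝ × ℝ | 1 / (k : ℝ) ^ 6 < |z.1 - z.2|}) (m.law_pair l i)
  beta_reduce at e
  rw [map_measureReal_apply ((m.hX i).prodMk (m.hξ l i)) hS,
    map_measureReal_apply ((m.hX 0).prodMk (m.hξ l 0)) hS] at e
  have e' : P.real {ω | 1 / (k : ℝ) ^ 6 < |X i ω - m.ξ l i ω|}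
      = P.real {ω | 1 / (k : ℝ) ^ 6 < |X 0 ω - m.ξ l 0 ω|} := e
  rw [e']
  have h6 : 1 / (l : ℝ) ^ 6 ≤ 1 / (k : ℝ) ^ 6 := by gcongr
  calc P.real {ω | 1 / (k : ℝ) ^ 6 < |X 0 ω - m.ξ l 0 ω|}
      ≤ P.real {ω | 1 / (l : ℝ) ^ 6 < |X 0 ω - m.ξ l 0 ω|} :=
        measureReal_mono fun ω hω => lt_of_le_of_lt h6 hω
    _ ≤ m.Cp / (l : ℝ) ^ 6 := m.approx l (hk.trans hkl)
    _ ≤ m.Cp / (k : ℝ) ^ 6 := by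
        have := m.Cp_nonneg
        gcongr

lemma sqrt_pow6 (L : ℝ) (hL : 0 < L) (l : ℝ) (hl : 0 < l) :
    √(L * (1 / l ^ 6)) = √L / l ^ 3 := by
  rw [Real.sqrt_mul hL.le, Real.sqrt_div zero_le_one, Real.sqrt_one,
    show l ^ 6 = (l ^ 3) ^ 2 by ring, Real.sqrt_sq (by positivity)]
  ring

/-- The constant in the approximation bounds. -/
def Mix.C1 (m : Mix P X) (M L : ℝ) : ℝ := 4 * M * (1 + m.Cp) + 4 * √L + 1

lemma Mix.C1_pos (m : Mix P X) (M L : ℝ) (hM : 1 ≤ M) : 1 ≤ m.C1 M L := by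
  have := m.Cp_nonneg
  have := Real.sqrt_nonneg L
  unfold Mix.C1
  have : 0 ≤ M * (1 + m.Cp) := by positivity
  linarith

lemma map_fst_snd {Ω : Type*} [MeasurableSpace Ω] (P : Measure Ω) [IsProbabilityMeasure P]
    (Y Y' : Ω → ℝ) (hY : Measurable Y) (hY' : Measurable Y') :
    (P.prod P).map (fun ω => (Y ω.1, Y' ω.2)) = (P.map Y).prod (P.map Y') := by
  have h := Measure.map_prod_map P P hY hY'
  rw [h]
  rfl

lemma prod_real_fst {Ω : Type*} [MeasurableSpace Ω] (P : Measure Ω) [IsProbabilityMeasure P]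
    (S : Set Ω) : (P.prod P).real {ω | ω.1 ∈ S} = P.real S := by
  have : {ω : Ω × Ω | ω.1 ∈ S} = S ×ˢ univ := by ext; simp
  rw [this, measureReal_prod_prod]; simp

lemma prod_real_snd {Ω : Type*} [MeasurableSpace Ω] (P : Measure Ω) [IsProbabilityMeasure P]
    (S : Set Ω) : (P.prod P).real {ω | ω.2 ∈ S} = P.real S := by
  have : {ω : Ω × Ω | ω.2 ∈ S} = univ ×ˢ S := by ext; simp
  rw [this, measureReal_prod_prod]; simp

lemma Mix.var (m : Mix P X) {k : ℝ → ℝ → ℝ} {M L : ℝ} (hk : Ker (P.map (X 0)) k M L)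
    (n l l' : ℕ) (hn : 1 ≤ n) (hl : n ≤ l) (hl' : n ≤ l') :
    ∫ ω : Ω × Ω, |k (m.ξ l 0 ω.1) (m.ξ l' 0 ω.2) - k (X 0 ω.1) (X 0 ω.2)| ∂(P.prod P)
      ≤ m.C1 M L / (n : ℝ) ^ 3 := by
  have hnpos : (0 : ℝ) < n := by exact_mod_cast hn
  have hn1 : (1 : ℝ) ≤ n := by exact_mod_cast hn
  have h := hk.var_gen (P.prod P) (fun ω => X 0 ω.1) (fun ω => X 0 ω.2)
    (fun ω => m.ξ l 0 ω.1) (fun ω => m.ξ l' 0 ω.2) ((m.hX 0).comp measurable_fst)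
    ((m.hX 0).comp measurable_snd) ((m.hξ l 0).comp measurable_fst)
    ((m.hξ l' 0).comp measurable_snd) (map_fst_snd P _ _ (m.hX 0) (m.hX 0))
    (1 / (n : ℝ) ^ 6) (by positivity)
  refine h.trans ?_
  have e1 := prod_real_fst P {ω | 1 / (n : ℝ) ^ 6 < |X 0 ω - m.ξ l 0 ω|}
  have e2 := prod_real_snd P {ω | 1 / (n : ℝ) ^ 6 < |X 0 ω - m.ξ l' 0 ω|}
  simp only [mem_ofPred_eq] at e1 e2
  rw [e1, e2, sqrt_pow6 L hk.Lpos n hnpos]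
  have a1 := m.approx' n l hn hl 0
  have a2 := m.approx' n l' hn hl' 0
  have hM0 : 0 ≤ M := by linarith [hk.Mpos]
  have hC := m.Cp_nonneg
  have h3 : m.Cp / (n : ℝ) ^ 6 ≤ m.Cp / (n : ℝ) ^ 3 := by
    gcongr
    norm_num
  have h4 : M * (P.real {ω | 1 / (n : ℝ) ^ 6 < |X 0 ω - m.ξ l 0 ω|}
      + P.real {ω | 1 / (n : ℝ) ^ 6 < |X 0 ω - m.ξ l' 0 ω|})
      ≤ M * (m.Cp / (n : ℝ) ^ 3 + m.Cp / (n : ℝ) ^ 3) := by gcongr <;> linarith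
  refine (add_le_add_right h4 _).trans ?_
  rw [← add_div, ← mul_div_assoc, ← add_div]
  gcongr
  unfold Mix.C1
  have := Real.sqrt_nonneg L
  nlinarith [mul_nonneg hM0 hC]

lemma Mix.far (m : Mix P X) {k : ℝ → ℝ → ℝ} {M L : ℝ} (hk : Ker (P.map (X 0)) k M L)
    (l : ℕ) (hl : 1 ≤ l) (i j : ℤ) (g : ℕ) (hg : i + 2 * l + g ≤ j) :
    ∫ ω, |k (X i ω) (X j ω) - k (m.ξ l i ω) (m.ξ l j ω)| ∂P
      ≤ m.C1 M L * (m.bt g + 1 / (l : ℝ) ^ 3) := by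
  have hlpos : (0 : ℝ) < l := by exact_mod_cast hl
  have hl1 : (1 : ℝ) ≤ l := by exact_mod_cast hl
  have hM0 : 0 ≤ M := by linarith [hk.Mpos]
  set ε : ℝ := 1 / (l : ℝ) ^ 6 with hε
  have hεpos : 0 < ε := by positivity
  have hq : Measurable fun ω => (m.ξ l i ω, m.ξ l j ω) := (m.hξ l i).prodMk (m.hξ l j)
  have hr : Measurable fun ω => (X i ω, X j ω) := (m.hX i).prodMk (m.hX j)
  set D : ℝ × ℝ → ℝ × ℝ → ℝ := fun a b => if dist b a ≤ ε then |k b.1 b.2 - k a.1 a.2| else 0 with hDd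
  have hD := measurable_near k hk.meas ε
  have hD0 : ∀ a b, 0 ≤ D a b := fun a b => by
    simp only [hDd]; split_ifs <;> positivity
  have hDB : ∀ a b, D a b ≤ M := fun a b => by
    simp only [hDd]; split_ifs
    · exact hk.abs_sub_le _ _ _ _
    · exact hM0
  have h2 := split_event P (fun ω => |k (X i ω) (X j ω) - k (m.ξ l i ω) (m.ξ l j ω)|)
    (fun ω => D (m.ξ l i ω, m.ξ l j ω) (X i ω, X j ω))
    ((hk.meas.comp hr).sub (hk.meas.comp hq)).abs (hD.comp (hq.prodMk hr)) M hM0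
    (fun ω => by rw [abs_abs]; exact hk.abs_sub_le _ _ _ _)
    (fun ω => by rw [abs_of_nonneg (hD0 _ _)]; exact hDB _ _) (fun ω => hD0 _ _)
    {ω | ε < |X i ω - m.ξ l i ω|} {ω | ε < |X j ω - m.ξ l j ω|}
    (measurableSet_lt measurable_const ((m.hX i).sub (m.hξ l i)).abs)
    (measurableSet_lt measurable_const ((m.hX j).sub (m.hξ l j)).abs) (by
      intro ω ha hb
      simp only [mem_ofPred_eq, not_lt] at ha hb
      have hd : dist (X i ω, X j ω) (m.ξ l i ω, m.ξ l j ω) ≤ ε := by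
        rw [Prod.dist_eq, max_le_iff]
        exact ⟨ha, hb⟩
      simp only [hDd, if_pos hd]; exact le_rfl)
  obtain ⟨F, hF, hF0, hFs, hFe⟩ := disint P _ _ hq hr D hD M hD0 hDB
  rw [hFe] at h2
  have hFB : ∀ a, F a ≤ M := fun a => hFs a M (hDB a)
  have hcl := m.close (i + l) g ℝ ℝ (m.ξ l i) (m.ξ l j) (m.ξ_past l i _ le_rfl)
    (m.ξ_fut l j _ (by omega))
  have h3 := (abs_le.1 (hcl.integral (m.hξ l i) (m.hξ l j) (fun x y => F (x, y)) hF M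
    (fun x y => by rw [abs_of_nonneg (hF0 _)]; exact hFB _))).2
  have e1 : ∫ ω, ∫ ω', F (m.ξ l i ω, m.ξ l j ω') ∂P ∂P
      = ∫ ω : Ω × Ω, F (m.ξ l 0 ω.1, m.ξ l 0 ω.2) ∂(P.prod P) := by
    have hmp := map_fst_snd P _ _ (m.hξ l 0) (m.hξ l 0)
    have hmp' := map_fst_snd P _ _ (m.hξ l i) (m.hξ l j)
    rw [m.law_ξ l i, m.law_ξ l j, ← hmp] at hmp'
    have hi : Integrable (fun ω : Ω × Ω => F (m.ξ l i ω.1, m.ξ l j ω.2)) (P.prod P) :=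
      Integrable.of_bound (hF.comp (((m.hξ l i).comp measurable_fst).prodMk
        ((m.hξ l j).comp measurable_snd))).aestronglyMeasurable M
        (Eventually.of_forall fun ω => by
          rw [Real.norm_eq_abs, abs_of_nonneg (hF0 _)]; exact hFB _)
    rw [← integral_prod (fun ω : Ω × Ω => F (m.ξ l i ω.1, m.ξ l j ω.2)) hi,
      ← integral_map (φ := fun ω : Ω × Ω => (m.ξ l i ω.1, m.ξ l j ω.2)) (f := F) _
        hF.aestronglyMeasurable, hmp', integral_map _ hF.aestronglyMeasurable]
    · exact (((m.hξ l 0).comp measurable_fst).prodMk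
        ((m.hξ l 0).comp measurable_snd)).aemeasurable
    · exact (((m.hξ l i).comp measurable_fst).prodMk
        ((m.hξ l j).comp measurable_snd)).aemeasurable
  rw [e1] at h3
  set D' : ℝ × ℝ → ℝ × ℝ → ℝ := fun a b => if dist b a ≤ ε then F b else 0 with hD'd
  have hD'm : Measurable fun z : (ℝ × ℝ) × (ℝ × ℝ) => D' z.1 z.2 :=
    Measurable.ite (measurableSet_le (measurable_snd.dist measurable_fst) measurable_const)
      (hF.comp measurable_snd) measurable_const
  have hD'0 : ∀ a b, 0 ≤ D' a b := fun a b => by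
    simp only [hD'd]; split_ifs
    · exact hF0 _
    · exact le_rfl
  have hD'B : ∀ a b, D' a b ≤ M := fun a b => by
    simp only [hD'd]; split_ifs
    · exact hFB _
    · exact hM0
  have hD'S : ∀ a b, D' a b ≤ 2 * osc k (2 * ε) a := fun a b => by
    have hon := osc_nonneg k (2 * ε) a
    simp only [hD'd]; split_ifs with hd
    · apply hFs
      intro r
      simp only [hDd]
      split_ifs with hd2
      · have t1 := hk.le_osc (2 * ε) a r (by linarith [dist_triangle r b a])
        have t2 := hk.le_osc (2 * ε) a b (by linarith)
        have t3 := abs_sub_le (k r.1 r.2) (k a.1 a.2) (k b.1 b.2)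
        rw [abs_sub_comm (k a.1 a.2)] at t3
        linarith
      · linarith
    · linarith
  have hqq : Measurable fun ω : Ω × Ω => (X 0 ω.1, X 0 ω.2) :=
    ((m.hX 0).comp measurable_fst).prodMk ((m.hX 0).comp measurable_snd)
  have hrr : Measurable fun ω : Ω × Ω => (m.ξ l 0 ω.1, m.ξ l 0 ω.2) :=
    ((m.hξ l 0).comp measurable_fst).prodMk ((m.hξ l 0).comp measurable_snd)
  have h4 := hk.sup_bound (P.prod P) _ _ hqq hrr (map_fst_snd P _ _ (m.hX 0) (m.hX 0)) D' hD'm M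
    hD'0 hD'B 2 (2 * ε) two_pos (by positivity) hD'S
  have h5 := split_event (P.prod P) (fun ω => F (m.ξ l 0 ω.1, m.ξ l 0 ω.2))
    (fun ω => D' (X 0 ω.1, X 0 ω.2) (m.ξ l 0 ω.1, m.ξ l 0 ω.2))
    (hF.comp hrr) (hD'm.comp (hqq.prodMk hrr)) M hM0
    (fun ω => by rw [abs_of_nonneg (hF0 _)]; exact hFB _)
    (fun ω => by rw [abs_of_nonneg (hD'0 _ _)]; exact hD'B _ _) (fun ω => hD'0 _ _)
    {ω | ω.1 ∈ {ω | ε < |X 0 ω - m.ξ l 0 ω|}} {ω | ω.2 ∈ {ω | ε < |X 0 ω - m.ξ l 0 ω|}}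
    (measurable_fst (measurableSet_lt measurable_const ((m.hX 0).sub (m.hξ l 0)).abs))
    (measurable_snd (measurableSet_lt measurable_const ((m.hX 0).sub (m.hξ l 0)).abs)) (by
      intro ω ha hb
      simp only [mem_ofPred_eq, not_lt] at ha hb
      have hd : dist (m.ξ l 0 ω.1, m.ξ l 0 ω.2) (X 0 ω.1, X 0 ω.2) ≤ ε := by
        rw [dist_comm, Prod.dist_eq, max_le_iff]
        exact ⟨ha, hb⟩
      simp only [hD'd, if_pos hd]; exact le_rfl)
  rw [prod_real_fst, prod_real_snd] at h5
  have a1 := m.approx' l l hl le_rfl i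
  have a2 := m.approx' l l hl le_rfl j
  have a3 := m.approx' l l hl le_rfl 0
  have hC := m.Cp_nonneg
  have hc6 : m.Cp / (l : ℝ) ^ 6 ≤ m.Cp / (l : ℝ) ^ 3 := by
    gcongr
    norm_num
  have hsq : √(L * (2 * ε)) ≤ 2 * (√L / (l : ℝ) ^ 3) := by
    rw [← sqrt_pow6 L hk.Lpos l hlpos, ← hε]
    have hLε : 0 < L * ε := mul_pos hk.Lpos hεpos
    rw [Real.sqrt_le_left (by positivity), mul_pow, Real.sq_sqrt hLε.le]
    nlinarith
  have b1 : M * (P.real {ω | ε < |X i ω - m.ξ l i ω|} + P.real {ω | ε < |X j ω - m.ξ l j ω|})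
      ≤ M * (m.Cp / (l : ℝ) ^ 3 + m.Cp / (l : ℝ) ^ 3) := by gcongr <;> linarith
  have b2 : M * (P.real {ω | ε < |X 0 ω - m.ξ l 0 ω|} + P.real {ω | ε < |X 0 ω - m.ξ l 0 ω|})
      ≤ M * (m.Cp / (l : ℝ) ^ 3 + m.Cp / (l : ℝ) ^ 3) := by gcongr <;> linarith
  have hbt := m.bt_nonneg g
  have hfin : 4 * M * m.bt g + 4 * (√L / (l : ℝ) ^ 3)
      + 2 * (M * (m.Cp / (l : ℝ) ^ 3 + m.Cp / (l : ℝ) ^ 3))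
      ≤ m.C1 M L * (m.bt g + 1 / (l : ℝ) ^ 3) := by
    unfold Mix.C1
    have hs := Real.sqrt_nonneg L
    have hl3 : 0 ≤ 1 / (l : ℝ) ^ 3 := by positivity
    rw [div_eq_mul_one_div (√L), div_eq_mul_one_div m.Cp]
    set y := 1 / (l : ℝ) ^ 3
    have p1 := mul_nonneg hs hbt
    have p2 := mul_nonneg hM0 hl3
    have p3 := mul_nonneg (mul_nonneg hM0 hC) hbt
    nlinarith
  linarith

end MixKer

end UQuantile

namespace UQuantile

section Hoeff

variable {ν : Measure ℝ} [IsProbabilityMeasure ν] {k : ℝ → ℝ → ℝ} {M : ℝ}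

/-- Bounded measurable symmetric nonnegative kernel. -/
structure BK (k : ℝ → ℝ → ℝ) (M : ℝ) : Prop where
  meas : Measurable fun q : ℝ × ℝ => k q.1 q.2
  nonneg : ∀ x y, 0 ≤ k x y
  le : ∀ x y, k x y ≤ M
  Mpos : 1 ≤ M
  symm : ∀ x y, k x y = k y x

lemma Ker.bk {μ : Measure ℝ} {L : ℝ} (hk : Ker μ k M L) : BK k M :=
  ⟨hk.meas, hk.nonneg, hk.le, hk.Mpos, hk.symm⟩

def u1 (ν : Measure ℝ) (k : ℝ → ℝ → ℝ) (x : ℝ) : ℝ := ∫ y, k x y ∂ν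
def uu (ν : Measure ℝ) (k : ℝ → ℝ → ℝ) : ℝ := ∫ x, u1 ν k x ∂ν
def cen (ν : Measure ℝ) (k : ℝ → ℝ → ℝ) (x : ℝ) : ℝ := u1 ν k x - uu ν k
def deg (ν : Measure ℝ) (k : ℝ → ℝ → ℝ) (x y : ℝ) : ℝ := k x y - u1 ν k x - u1 ν k y + uu ν k

lemma integrable_bdd {α : Type*} [MeasurableSpace α] (Q : Measure α) [IsFiniteMeasure Q]
    (f : α → ℝ) (hf : Measurable f) (B : ℝ) (hB : ∀ x, |f x| ≤ B) : Integrable f Q :=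
  Integrable.of_bound hf.aestronglyMeasurable B (Eventually.of_forall hB)

lemma BK.abs_le (hk : BK k M) (x y : ℝ) : |k x y| ≤ M := by
  rw [abs_of_nonneg (hk.nonneg x y)]; exact hk.le x y

lemma BK.int (hk : BK k M) (x : ℝ) : Integrable (fun y => k x y) ν :=
  integrable_bdd ν _ (hk.meas.comp measurable_prodMk_left) M (hk.abs_le x)

lemma BK.u1_meas (hk : BK k M) : Measurable (u1 ν k) :=
  (hk.meas.stronglyMeasurable.integral_prod_right' (ν := ν)).measurable

lemma BK.u1_nonneg (hk : BK k M) (x : ℝ) : 0 ≤ u1 ν k x := integral_nonneg fun y => hk.nonneg x y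

lemma BK.u1_le (hk : BK k M) (x : ℝ) : u1 ν k x ≤ M := by
  calc u1 ν k x ≤ ∫ _, M ∂ν := integral_mono (hk.int x) (integrable_const _) (hk.le x)
    _ = M := by simp

lemma BK.u1_int (hk : BK k M) : Integrable (u1 ν k) ν :=
  integrable_bdd ν _ hk.u1_meas M fun x => by
    rw [abs_of_nonneg (hk.u1_nonneg x)]; exact hk.u1_le x

lemma BK.uu_nonneg (hk : BK k M) : 0 ≤ uu ν k := integral_nonneg fun y => hk.u1_nonneg y

lemma BK.uu_le (hk : BK k M) : uu ν k ≤ M := by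
  calc uu ν k ≤ ∫ _, M ∂ν := integral_mono hk.u1_int (integrable_const _) hk.u1_le
    _ = M := by simp

lemma BK.cen_meas (hk : BK k M) : Measurable (cen ν k) := hk.u1_meas.sub_const _

lemma BK.cen_abs (hk : BK k M) (x : ℝ) : |cen ν k x| ≤ M := by
  have h1 := hk.u1_nonneg (ν := ν) x
  have h2 := hk.u1_le (ν := ν) x
  have h3 := hk.uu_nonneg (ν := ν)
  have h4 := hk.uu_le (ν := ν)
  unfold cen
  rw [_root_.abs_le]; constructor <;> linarith

lemma BK.cen_zero (hk : BK k M) : ∫ x, cen ν k x ∂ν = 0 := by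
  unfold cen
  rw [integral_sub hk.u1_int (integrable_const _)]
  simp [uu]

lemma BK.deg_meas (hk : BK k M) : Measurable fun q : ℝ × ℝ => deg ν k q.1 q.2 :=
  ((hk.meas.sub (hk.u1_meas.comp measurable_fst)).sub
    (hk.u1_meas.comp measurable_snd)).add_const _

lemma BK.deg_abs (hk : BK k M) (x y : ℝ) : |deg ν k x y| ≤ 2 * M := by
  have h1 := hk.u1_nonneg (ν := ν) x
  have h2 := hk.u1_le (ν := ν) x
  have h1' := hk.u1_nonneg (ν := ν) y
  have h2' := hk.u1_le (ν := ν) y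
  have h3 := hk.uu_nonneg (ν := ν)
  have h4 := hk.uu_le (ν := ν)
  have h5 := hk.nonneg x y
  have h6 := hk.le x y
  unfold deg
  rw [_root_.abs_le]; constructor <;> linarith

lemma BK.deg_symm (hk : BK k M) (x y : ℝ) : deg ν k x y = deg ν k y x := by
  unfold deg; rw [hk.symm]; ring

lemma BK.deg_zero (hk : BK k M) (x : ℝ) : ∫ y, deg ν k x y ∂ν = 0 := by
  unfold deg
  have i1 : Integrable (fun y => k x y - u1 ν k x) ν := (hk.int x).sub (integrable_const _)
  have i2 : Integrable (fun y => k x y - u1 ν k x - u1 ν k y) ν := i1.sub hk.u1_int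
  rw [integral_add i2 (integrable_const _), integral_sub i1 hk.u1_int,
    integral_sub (hk.int x) (integrable_const _)]
  simp [u1, uu]

end Hoeff

section CovSec

variable {Ω : Type*} [MeasurableSpace Ω] {P : Measure Ω} [IsProbabilityMeasure P] {X : ℤ → Ω → ℝ}

/-- Law of the approximating variable. -/
def Mix.nu (m : Mix P X) (l : ℕ) : Measure ℝ := P.map (m.ξ l 0)

instance (m : Mix P X) (l : ℕ) : IsProbabilityMeasure (m.nu l) :=
  Measure.isProbabilityMeasure_map (m.hξ l 0).aemeasurable

lemma Mix.prob (m : Mix P X) : IsProbabilityMeasure (P.map (X 0)) :=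
  Measure.isProbabilityMeasure_map (m.hX 0).aemeasurable

lemma Mix.int_nu (m : Mix P X) (l : ℕ) (i : ℤ) (f : ℝ → ℝ) (hf : Measurable f) :
    ∫ ω, f (m.ξ l i ω) ∂P = ∫ x, f x ∂(m.nu l) := by
  rw [m.int_ξ l i f hf, Mix.nu, integral_map (m.hξ l 0).aemeasurable hf.aestronglyMeasurable]

lemma uu_eq_prod (Y : Ω → ℝ) (hY : Measurable Y) {k : ℝ → ℝ → ℝ} {M : ℝ} (hk : BK k M) :
    uu (P.map Y) k = ∫ ω : Ω × Ω, k (Y ω.1) (Y ω.2) ∂(P.prod P) := by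
  have hp : IsProbabilityMeasure (P.map Y) := Measure.isProbabilityMeasure_map hY.aemeasurable
  have h1 : Integrable (fun z : ℝ × ℝ => k z.1 z.2) ((P.map Y).prod (P.map Y)) :=
    integrable_bdd _ _ hk.meas M fun z => hk.abs_le _ _
  unfold uu u1
  rw [← integral_prod _ h1, ← map_fst_snd P Y Y hY hY, integral_map _ hk.meas.aestronglyMeasurable]
  exact ((hY.comp measurable_fst).prodMk (hY.comp measurable_snd)).aemeasurable

lemma Mix.uu_close (m : Mix P X) {k : ℝ → ℝ → ℝ} {M L : ℝ} (hk : Ker (P.map (X 0)) k M L)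
    (l : ℕ) (hl : 1 ≤ l) : |uu (m.nu l) k - uu (P.map (X 0)) k| ≤ m.C1 M L / (l : ℝ) ^ 3 := by
  have hm : ∀ Y Y' : Ω → ℝ, Measurable Y → Measurable Y' →
      Integrable (fun ω : Ω × Ω => k (Y ω.1) (Y' ω.2)) (P.prod P) := fun Y Y' hY hY' =>
    integrable_bdd _ _ (hk.meas.comp ((hY.comp measurable_fst).prodMk (hY'.comp measurable_snd))) M
      fun z => hk.bk.abs_le _ _
  rw [Mix.nu, uu_eq_prod _ (m.hξ l 0) hk.bk, uu_eq_prod _ (m.hX 0) hk.bk,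
    ← integral_sub (hm _ _ (m.hξ l 0) (m.hξ l 0)) (hm _ _ (m.hX 0) (m.hX 0))]
  exact (abs_integral_le_integral_abs).trans (m.var hk l l l hl le_rfl le_rfl)

lemma Mix.u1_close (m : Mix P X) {k : ℝ → ℝ → ℝ} {M L : ℝ} (hk : Ker (P.map (X 0)) k M L)
    (n l : ℕ) (hn : 1 ≤ n) (hl : n ≤ l) :
    ∫ ω, |u1 (m.nu l) k (m.ξ n 0 ω) - u1 (m.nu l) k (m.ξ l 0 ω)| ∂P
      ≤ 2 * m.C1 M L / (n : ℝ) ^ 3 := by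
  have hm : ∀ Y Y' : Ω → ℝ, Measurable Y → Measurable Y' →
      Measurable (fun ω : Ω × Ω => k (Y ω.1) (Y' ω.2)) := fun Y Y' hY hY' =>
    (hk.meas.comp ((hY.comp measurable_fst).prodMk (hY'.comp measurable_snd)))
  have hmi : ∀ Y Y' Z Z' : Ω → ℝ, Measurable Y → Measurable Y' → Measurable Z → Measurable Z' →
      Integrable (fun ω : Ω × Ω => |k (Y ω.1) (Y' ω.2) - k (Z ω.1) (Z' ω.2)|) (P.prod P) :=
    fun Y Y' Z Z' hY hY' hZ hZ' =>
    integrable_bdd _ _ ((hm _ _ hY hY').sub (hm _ _ hZ hZ')).abs M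
      fun z => by rw [abs_abs]; exact hk.abs_sub_le _ _ _ _
  have e : ∀ x, u1 (m.nu l) k x = ∫ ω', k x (m.ξ l 0 ω') ∂P := fun x => by
    unfold u1 Mix.nu
    have hkx : Measurable fun y => k x y := hk.meas.comp measurable_prodMk_left
    rw [integral_map (m.hξ l 0).aemeasurable hkx.aestronglyMeasurable]
  have hi1 : ∀ x, Integrable (fun ω' => k x (m.ξ l 0 ω')) P := fun x =>
    integrable_bdd _ _ (hk.meas.comp (measurable_const.prodMk (m.hξ l 0))) M
      fun z => hk.bk.abs_le _ _
  have hA := hmi _ _ _ _ (m.hξ n 0) (m.hξ l 0) (m.hξ l 0) (m.hξ l 0)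
  have hB := hmi _ _ _ _ (m.hξ n 0) (m.hξ l 0) (m.hX 0) (m.hX 0)
  have hC := hmi _ _ _ _ (m.hξ l 0) (m.hξ l 0) (m.hX 0) (m.hX 0)
  calc ∫ ω, |u1 (m.nu l) k (m.ξ n 0 ω) - u1 (m.nu l) k (m.ξ l 0 ω)| ∂P
      ≤ ∫ ω, ∫ ω', |k (m.ξ n 0 ω) (m.ξ l 0 ω') - k (m.ξ l 0 ω) (m.ξ l 0 ω')| ∂P ∂P := by
        apply integral_mono_of_nonneg (Eventually.of_forall fun ω => abs_nonneg _)
          hA.integral_prod_left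
        refine Eventually.of_forall fun ω => ?_
        dsimp only
        rw [e, e, ← integral_sub (hi1 _) (hi1 _)]
        exact abs_integral_le_integral_abs
    _ = ∫ ω : Ω × Ω, |k (m.ξ n 0 ω.1) (m.ξ l 0 ω.2) - k (m.ξ l 0 ω.1) (m.ξ l 0 ω.2)| ∂(P.prod P) :=
        (integral_prod _ hA).symm
    _ ≤ ∫ ω : Ω × Ω, (|k (m.ξ n 0 ω.1) (m.ξ l 0 ω.2) - k (X 0 ω.1) (X 0 ω.2)|
          + |k (m.ξ l 0 ω.1) (m.ξ l 0 ω.2) - k (X 0 ω.1) (X 0 ω.2)|) ∂(P.prod P) := by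
        apply integral_mono hA (hB.add hC)
        intro ω
        have := abs_sub_le (k (m.ξ n 0 ω.1) (m.ξ l 0 ω.2)) (k (X 0 ω.1) (X 0 ω.2))
          (k (m.ξ l 0 ω.1) (m.ξ l 0 ω.2))
        rw [abs_sub_comm (k (X 0 ω.1) (X 0 ω.2))] at this
        exact this
    _ = _ := integral_add hB hC
    _ ≤ _ := by
        have h1 := m.var hk n n l hn le_rfl hl
        have h2 := m.var hk n l l hn hl hl
        have : 2 * m.C1 M L / (n : ℝ) ^ 3 = m.C1 M L / (n : ℝ) ^ 3 + m.C1 M L / (n : ℝ) ^ 3 := by ring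
        rw [this]; linarith

/-- Centred function with approximation bounds. -/
structure Cen (m : Mix P X) (l : ℕ) (f : ℝ → ℝ) (M c δ : ℝ) : Prop where
  meas : Measurable f
  bd : ∀ x, |f x| ≤ M
  M_nonneg : 0 ≤ M
  c_nonneg : 0 ≤ c
  zero : ∫ ω, f (m.ξ l 0 ω) ∂P = 0
  apx : ∀ n : ℕ, 1 ≤ n → n ≤ l → ∫ ω, |f (m.ξ n 0 ω) - f (m.ξ l 0 ω)| ∂P ≤ c / (n : ℝ) ^ 3
  l1 : ∫ ω, |f (m.ξ l 0 ω)| ∂P ≤ δ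

def Mix.gam (m : Mix P X) (r : ℕ) : ℝ := m.bt (r / 3) + 1 / ((r : ℝ) + 1) ^ 3

lemma Mix.gam_nonneg (m : Mix P X) (r : ℕ) : 0 ≤ m.gam r := by
  have := m.bt_nonneg (r / 3)
  unfold Mix.gam; positivity

def covC (M c : ℝ) : ℝ := 1000 * (M * c + M ^ 2 + M)

variable {m : Mix P X} {l : ℕ} {f : ℝ → ℝ} {M c δ : ℝ}

lemma Cen.mono_δ {δ' : ℝ} (hf : Cen m l f M c δ) (h : δ ≤ δ') : Cen m l f M c δ' :=
  ⟨hf.meas, hf.bd, hf.M_nonneg, hf.c_nonneg, hf.zero, hf.apx, hf.l1.trans h⟩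

lemma Cen.neg (hf : Cen m l f M c δ) : Cen m l (fun x => - f x) M c δ := by
  refine ⟨hf.meas.neg, fun x => by rw [abs_neg]; exact hf.bd x, hf.M_nonneg, hf.c_nonneg, ?_, ?_, ?_⟩
  · rw [integral_neg, hf.zero, neg_zero]
  · intro n h1 h2
    have := hf.apx n h1 h2
    refine le_trans (le_of_eq ?_) this
    congr 1; ext ω; rw [← abs_neg]; congr 1; ring
  · simp only [abs_neg]; exact hf.l1

lemma Cen.cov_delta (hf : Cen m l f M c δ) (a b : ℤ) :
    |∫ ω, f (m.ξ l a ω) * f (m.ξ l b ω) ∂P| ≤ M * δ := by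
  have hi : Integrable (fun ω => |f (m.ξ l a ω)|) P :=
    integrable_bdd _ _ (hf.meas.comp (m.hξ l a)).abs M fun ω => by rw [abs_abs]; exact hf.bd _
  calc |∫ ω, f (m.ξ l a ω) * f (m.ξ l b ω) ∂P| ≤ ∫ ω, |f (m.ξ l a ω) * f (m.ξ l b ω)| ∂P :=
        abs_integral_le_integral_abs
    _ ≤ ∫ ω, M * |f (m.ξ l a ω)| ∂P := by
        apply integral_mono_of_nonneg (Eventually.of_forall fun ω => abs_nonneg _) (hi.const_mul M)
        refine Eventually.of_forall fun ω => ?_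
        dsimp only
        rw [abs_mul, mul_comm]
        exact mul_le_mul_of_nonneg_right (hf.bd _) (abs_nonneg _)
    _ = M * ∫ ω, |f (m.ξ l a ω)| ∂P := integral_const_mul _ _
    _ ≤ M * δ := by
        rw [m.int_ξ l a (fun x => |f x|) hf.meas.abs]
        exact mul_le_mul_of_nonneg_left hf.l1 hf.M_nonneg

lemma Cen.apx_at (hf : Cen m l f M c δ) (n : ℕ) (hn : 1 ≤ n) (hnl : n ≤ l) (a : ℤ) :
    ∫ ω, |f (m.ξ n a ω) - f (m.ξ l a ω)| ∂P ≤ c / (n : ℝ) ^ 3 := by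
  have hF : Measurable fun z : ℝ × ℝ => |f z.1 - f z.2| :=
    ((hf.meas.comp measurable_fst).sub (hf.meas.comp measurable_snd)).abs
  have e : ∀ a, ∫ ω, |f (m.ξ n a ω) - f (m.ξ l a ω)| ∂P
      = ∫ z, |f z.1 - f z.2| ∂(P.map fun ω => (m.ξ n a ω, m.ξ l a ω)) := fun a => by
    rw [integral_map ((m.hξ n a).prodMk (m.hξ l a)).aemeasurable hF.aestronglyMeasurable]
  rw [e, m.law_pair2, ← e]
  exact hf.apx n hn hnl

/-- Covariance bound for sufficiently separated indices. -/
lemma Cen.cov_close (hf : Cen m l f M c δ) (n : ℕ) (a b : ℤ) (g : ℕ) (hab : a + 2 * n + g ≤ b) :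
    |∫ ω, f (m.ξ n a ω) * f (m.ξ n b ω) ∂P|
      ≤ |∫ ω, f (m.ξ n 0 ω) ∂P| * |∫ ω, f (m.ξ n 0 ω) ∂P| + 4 * M ^ 2 * m.bt g := by
  have hcl := m.close (a + n) g ℝ ℝ (m.ξ n a) (m.ξ n b) (m.ξ_past n a _ le_rfl)
    (m.ξ_fut n b _ (by omega))
  have h := hcl.integral (m.hξ n a) (m.hξ n b) (fun x y => f x * f y)
    ((hf.meas.comp measurable_fst).mul (hf.meas.comp measurable_snd)) (M ^ 2) (fun x y => by
      rw [abs_mul, sq]; exact mul_le_mul (hf.bd x) (hf.bd y) (abs_nonneg _) hf.M_nonneg)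
  have e : ∫ ω, ∫ ω', f (m.ξ n a ω) * f (m.ξ n b ω') ∂P ∂P
      = (∫ ω, f (m.ξ n 0 ω) ∂P) * (∫ ω, f (m.ξ n 0 ω) ∂P) := by
    simp only [integral_const_mul]
    rw [integral_mul_const, m.int_ξ n a f hf.meas, m.int_ξ n b f hf.meas]
  rw [e] at h
  have h2 := abs_sub_abs_le_abs_sub (∫ ω, f (m.ξ n a ω) * f (m.ξ n b ω) ∂P)
    ((∫ ω, f (m.ξ n 0 ω) ∂P) * (∫ ω, f (m.ξ n 0 ω) ∂P))
  rw [abs_mul] at h2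
  linarith

lemma Cen.cov_repl (hf : Cen m l f M c δ) (n : ℕ) (hn : 1 ≤ n) (hnl : n ≤ l) (a b : ℤ) :
    |∫ ω, f (m.ξ l a ω) * f (m.ξ l b ω) ∂P|
      ≤ |∫ ω, f (m.ξ n a ω) * f (m.ξ n b ω) ∂P| + 2 * M * (c / (n : ℝ) ^ 3) := by
  have hmm : ∀ n a, Measurable fun ω => f (m.ξ n a ω) := fun n a => hf.meas.comp (m.hξ n a)
  have hip : ∀ n, Integrable (fun ω => f (m.ξ n a ω) * f (m.ξ n b ω)) P := fun n =>
    integrable_bdd _ _ ((hmm n a).mul (hmm n b)) (M * M) fun ω => by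
      rw [abs_mul]; exact mul_le_mul (hf.bd _) (hf.bd _) (abs_nonneg _) hf.M_nonneg
  have hid : ∀ a, Integrable (fun ω => |f (m.ξ n a ω) - f (m.ξ l a ω)|) P := fun a =>
    integrable_bdd _ _ ((hmm n a).sub (hmm l a)).abs (M + M) fun ω => by
      rw [abs_abs]; exact (abs_sub _ _).trans (add_le_add (hf.bd _) (hf.bd _))
  have h := abs_sub_abs_le_abs_sub (∫ ω, f (m.ξ l a ω) * f (m.ξ l b ω) ∂P)
    (∫ ω, f (m.ξ n a ω) * f (m.ξ n b ω) ∂P)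
  have hi2 : Integrable (fun ω => M * |f (m.ξ n a ω) - f (m.ξ l a ω)|
            + M * |f (m.ξ n b ω) - f (m.ξ l b ω)|) P :=
    ((hid a).const_mul M).add ((hid b).const_mul M)
  have h2 : |∫ ω, f (m.ξ l a ω) * f (m.ξ l b ω) ∂P - ∫ ω, f (m.ξ n a ω) * f (m.ξ n b ω) ∂P|
      ≤ 2 * M * (c / (n : ℝ) ^ 3) := by
    rw [← integral_sub (hip l) (hip n)]
    calc _ ≤ ∫ ω, |f (m.ξ l a ω) * f (m.ξ l b ω) - f (m.ξ n a ω) * f (m.ξ n b ω)| ∂P :=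
          abs_integral_le_integral_abs
      _ ≤ ∫ ω, (M * |f (m.ξ n a ω) - f (m.ξ l a ω)|
            + M * |f (m.ξ n b ω) - f (m.ξ l b ω)|) ∂P := by
          apply integral_mono_of_nonneg (Eventually.of_forall fun ω => abs_nonneg _) hi2
          refine Eventually.of_forall fun ω => ?_
          dsimp only
          set A := f (m.ξ l a ω)
          set B := f (m.ξ l b ω)
          set A' := f (m.ξ n a ω)
          set B' := f (m.ξ n b ω)
          have e : A * B - A' * B' = -((A' - A) * B) - A' * (B' - B) := by ring
          rw [e]
          refine (abs_sub _ _).trans ?_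
          rw [abs_neg, abs_mul, abs_mul]
          have hB : |B| ≤ M := hf.bd _
          have hA' : |A'| ≤ M := hf.bd _
          nlinarith [abs_nonneg (A' - A), abs_nonneg (B' - B)]
      _ = M * ∫ ω, |f (m.ξ n a ω) - f (m.ξ l a ω)| ∂P
            + M * ∫ ω, |f (m.ξ n b ω) - f (m.ξ l b ω)| ∂P := by
          rw [integral_add ((hid a).const_mul M) ((hid b).const_mul M), integral_const_mul,
            integral_const_mul]
      _ ≤ M * (c / (n : ℝ) ^ 3) + M * (c / (n : ℝ) ^ 3) :=
          add_le_add (mul_le_mul_of_nonneg_left (hf.apx_at n hn hnl a) hf.M_nonneg)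
            (mul_le_mul_of_nonneg_left (hf.apx_at n hn hnl b) hf.M_nonneg)
      _ = _ := by ring
  linarith

lemma Cen.cov_gam (hf : Cen m l f M c δ) (a : ℤ) (r : ℕ) :
    |∫ ω, f (m.ξ l a ω) * f (m.ξ l (a + r) ω) ∂P| ≤ covC M c * m.gam r := by
  have hM := hf.M_nonneg
  have hc := hf.c_nonneg
  have hMc := mul_nonneg hM hc
  have hbt := m.bt_nonneg (r / 3)
  have hmm : ∀ n a, Measurable fun ω => f (m.ξ n a ω) := fun n a => hf.meas.comp (m.hξ n a)
  have hif : ∀ n, Integrable (fun ω => f (m.ξ n 0 ω)) P := fun n =>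
    integrable_bdd _ _ (hmm n 0) M fun ω => hf.bd _
  unfold covC Mix.gam
  have hr3 : 0 ≤ 1 / ((r : ℝ) + 1) ^ 3 := by positivity
  by_cases h3 : r < 3
  · have h1 : |∫ ω, f (m.ξ l a ω) * f (m.ξ l (a + r) ω) ∂P| ≤ M * M := by
        have h' : Cen m l f M c M := ⟨hf.meas, hf.bd, hM, hc, hf.zero, hf.apx, by
          calc ∫ ω, |f (m.ξ l 0 ω)| ∂P ≤ ∫ _, M ∂P :=
                integral_mono_of_nonneg (Eventually.of_forall fun ω => abs_nonneg _)
                  (integrable_const _) (Eventually.of_forall fun ω => hf.bd _)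
            _ = M := by simp⟩
        exact h'.cov_delta a (a + r)
    have h2 : 1 / 27 ≤ 1 / ((r : ℝ) + 1) ^ 3 := by
      apply one_div_le_one_div_of_le (by positivity)
      have : (r : ℝ) ≤ 2 := by exact_mod_cast (by omega : r ≤ 2)
      calc ((r : ℝ) + 1) ^ 3 ≤ (2 + 1) ^ 3 := by gcongr
        _ = 27 := by norm_num
    nlinarith [mul_nonneg hMc hbt, mul_nonneg hMc hr3, mul_nonneg hM hbt, mul_nonneg hM hr3,
      mul_nonneg (sq_nonneg M) hbt, mul_le_mul_of_nonneg_left h2 (sq_nonneg M)]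
  · set n := r / 3 with hn
    have hn1 : 1 ≤ n := by omega
    have hnp : (0 : ℝ) < n := by exact_mod_cast hn1
    have hn3 : 1 / (n : ℝ) ^ 3 ≤ 216 * (1 / ((r : ℝ) + 1) ^ 3) := by
      rw [mul_one_div, div_le_div_iff₀ (by positivity) (by positivity)]
      have : (r : ℝ) + 1 ≤ 6 * n := by exact_mod_cast (by omega : r + 1 ≤ 6 * n)
      calc 1 * ((r : ℝ) + 1) ^ 3 ≤ 1 * (6 * n) ^ 3 := by gcongr
        _ = 216 * (n : ℝ) ^ 3 := by ring
    by_cases hnl : l ≤ n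
    · have h := hf.cov_close l a (a + r) n (by omega)
      rw [hf.zero] at h
      simp only [abs_zero, mul_zero, zero_add] at h
      nlinarith [mul_nonneg hMc hbt, mul_nonneg hMc hr3, mul_nonneg hM hbt, mul_nonneg hM hr3,
        mul_nonneg (sq_nonneg M) hbt, mul_nonneg (sq_nonneg M) hr3]
    · have h := hf.cov_repl n hn1 (by omega) a (a + r)
      have h' := hf.cov_close n a (a + r) n (by omega)
      have h1 : |∫ ω, f (m.ξ n 0 ω) ∂P| ≤ c / (n : ℝ) ^ 3 := by
        have e : ∫ ω, f (m.ξ n 0 ω) ∂P = ∫ ω, (f (m.ξ n 0 ω) - f (m.ξ l 0 ω)) ∂P := by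
          rw [integral_sub (hif n) (hif l), hf.zero, sub_zero]
        rw [e]
        exact abs_integral_le_integral_abs.trans (hf.apx n hn1 (by omega))
      have h2 : |∫ ω, f (m.ξ n 0 ω) ∂P| ≤ M := by
        calc _ ≤ ∫ ω, |f (m.ξ n 0 ω)| ∂P := abs_integral_le_integral_abs
          _ ≤ ∫ _, M ∂P :=
                integral_mono_of_nonneg (Eventually.of_forall fun ω => abs_nonneg _)
                  (integrable_const _) (Eventually.of_forall fun ω => hf.bd _)
          _ = M := by simp
      have h4 : |∫ ω, f (m.ξ n 0 ω) ∂P| * |∫ ω, f (m.ξ n 0 ω) ∂P| ≤ M * (c / (n : ℝ) ^ 3) :=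
        mul_le_mul h2 h1 (abs_nonneg _) hM
      have h5 : M * (c / (n : ℝ) ^ 3) ≤ M * c * (216 * (1 / ((r : ℝ) + 1) ^ 3)) := by
        rw [div_eq_mul_one_div, ← mul_assoc]
        exact mul_le_mul_of_nonneg_left hn3 hMc
      nlinarith [mul_nonneg hMc hbt, mul_nonneg hMc hr3, mul_nonneg hM hbt, mul_nonneg hM hr3,
        mul_nonneg (sq_nonneg M) hbt, mul_nonneg (sq_nonneg M) hr3]

lemma Cen.cov_min (hf : Cen m l f M c δ) (hδ : 0 ≤ δ) (a b : ℤ) :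
    |∫ ω, f (m.ξ l a ω) * f (m.ξ l b ω) ∂P| ≤ covC M c * min δ (m.gam (a - b).natAbs) := by
  have hM := hf.M_nonneg
  have hc := hf.c_nonneg
  have hMc := mul_nonneg hM hc
  have hC : 0 ≤ covC M c := by unfold covC; positivity
  rw [mul_min_of_nonneg _ _ hC, le_min_iff]
  constructor
  · refine (hf.cov_delta a b).trans ?_
    apply mul_le_mul_of_nonneg_right _ hδ
    unfold covC; nlinarith [sq_nonneg M]
  · rcases le_total a b with h | h
    · have := hf.cov_gam a (a - b).natAbs
      rwa [show a + ((a - b).natAbs : ℤ) = b by omega] at this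
    · have := hf.cov_gam b (a - b).natAbs
      rw [show b + ((a - b).natAbs : ℤ) = a by omega] at this
      simpa only [mul_comm] using this

lemma lag_row (G : ℕ → ℝ) (hG : ∀ r, 0 ≤ G r) (K : ℕ) (o : ℤ) :
    ∀ i ∈ Finset.range K,
      ∑ j ∈ Finset.range K, G ((o + (i : ℤ)) - (o + (j : ℤ))).natAbs
        ≤ 2 * ∑ r ∈ Finset.range K, G r := by
    intro i hi
    rw [Finset.mem_range] at hi
    have hsplit : ∀ j ∈ Finset.range K, G ((o + (i : ℤ)) - (o + (j : ℤ))).natAbs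
        ≤ (if j ≤ i then G (i - j) else 0) + (if i ≤ j then G (j - i) else 0) := by
      intro j _
      rcases le_total j i with h | h
      · rw [if_pos h, show ((o + (i : ℤ)) - (o + (j : ℤ))).natAbs = i - j by omega]
        have : 0 ≤ (if i ≤ j then G (j - i) else 0) := by split_ifs; exacts [hG _, le_rfl]
        linarith
      · rw [if_pos h, show ((o + (i : ℤ)) - (o + (j : ℤ))).natAbs = j - i by omega]
        have : 0 ≤ (if j ≤ i then G (i - j) else 0) := by split_ifs; exacts [hG _, le_rfl]
        linarith
    refine (Finset.sum_le_sum hsplit).trans ?_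
    rw [Finset.sum_add_distrib, ← Finset.sum_filter, ← Finset.sum_filter, two_mul]
    apply add_le_add
    · rw [← Finset.sum_image (f := G) (g := fun j => i - j)]
      · apply Finset.sum_le_sum_of_subset_of_nonneg
        · intro x hx
          simp only [Finset.mem_image, Finset.mem_filter, Finset.mem_range] at hx ⊢
          obtain ⟨j, hj, rfl⟩ := hx; omega
        · intros; exact hG _
      · intro x hx y hy hxy
        simp only [Finset.coe_filter, Finset.mem_range, mem_ofPred_eq] at hx hy hxy
        omega
    · rw [← Finset.sum_image (f := G) (g := fun j => j - i)]
      · apply Finset.sum_le_sum_of_subset_of_nonneg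
        · intro x hx
          simp only [Finset.mem_image, Finset.mem_filter, Finset.mem_range] at hx ⊢
          obtain ⟨j, hj, rfl⟩ := hx; omega
        · intros; exact hG _
      · intro x hx y hy hxy
        simp only [Finset.coe_filter, Finset.mem_range, mem_ofPred_eq] at hx hy hxy
        omega

/-- Double sums of functions of the lag. -/
lemma lag_sum (G : ℕ → ℝ) (hG : ∀ r, 0 ≤ G r) (K : ℕ) (o : ℤ) :
    ∑ i ∈ Finset.range K, ∑ j ∈ Finset.range K, G ((o + (i : ℤ)) - (o + (j : ℤ))).natAbs
      ≤ 2 * K * ∑ r ∈ Finset.range K, G r := by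
  have h1 := lag_row G hG K o
  calc _ ≤ ∑ i ∈ Finset.range K, 2 * ∑ r ∈ Finset.range K, G r := Finset.sum_le_sum h1
    _ = _ := by rw [Finset.sum_const, Finset.card_range, nsmul_eq_mul]; ring

/-- Block variance. -/
lemma Cen.block_var (hf : Cen m l f M c δ) (hδ : 0 ≤ δ) (K : ℕ) (o : ℤ) :
    ∫ ω, (∑ i ∈ Finset.range K, f (m.ξ l (o + i) ω)) ^ 2 ∂P
      ≤ covC M c * (2 * K * ∑ r ∈ Finset.range K, min δ (m.gam r)) := by
  have hM := hf.M_nonneg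
  have hc := hf.c_nonneg
  have hMc := mul_nonneg hM hc
  have hC : 0 ≤ covC M c := by unfold covC; positivity
  have hmm : ∀ n a, Measurable fun ω => f (m.ξ n a ω) := fun n a => hf.meas.comp (m.hξ n a)
  have hip : ∀ a b, Integrable (fun ω => f (m.ξ l a ω) * f (m.ξ l b ω)) P := fun a b =>
    integrable_bdd _ _ ((hmm l a).mul (hmm l b)) (M * M) fun ω => by
      rw [abs_mul]; exact mul_le_mul (hf.bd _) (hf.bd _) (abs_nonneg _) hf.M_nonneg
  have e : ∀ ω, (∑ i ∈ Finset.range K, f (m.ξ l (o + i) ω)) ^ 2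
      = ∑ i ∈ Finset.range K, ∑ j ∈ Finset.range K, f (m.ξ l (o + i) ω) * f (m.ξ l (o + j) ω) := by
    intro ω; rw [sq, Finset.sum_mul_sum]
  simp only [e]
  rw [integral_finsetSum _ (fun i _ => integrable_finsetSum _ fun j _ => hip _ _)]
  simp only [integral_finsetSum _ (fun j _ => hip _ _)]
  calc _ ≤ ∑ i ∈ Finset.range K, ∑ j ∈ Finset.range K,
        covC M c * min δ (m.gam ((o + (i : ℤ)) - (o + (j : ℤ))).natAbs) :=
        Finset.sum_le_sum fun i _ => Finset.sum_le_sum fun j _ =>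
          (le_abs_self _).trans (hf.cov_min hδ _ _)
    _ = covC M c * ∑ i ∈ Finset.range K, ∑ j ∈ Finset.range K,
          min δ (m.gam ((o + (i : ℤ)) - (o + (j : ℤ))).natAbs) := by
        simp only [Finset.mul_sum]
    _ ≤ _ := mul_le_mul_of_nonneg_left
        (lag_sum (fun r => min δ (m.gam r)) (fun r => le_min hδ (m.gam_nonneg r)) K o) hC

end CovSec

end UQuantile

namespace UQuantile

section DegSec

variable {Ω : Type*} [MeasurableSpace Ω] {P : Measure Ω} [IsProbabilityMeasure P] {X : ℤ → Ω → ℝ}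
variable {k : ℝ → ℝ → ℝ} {M : ℝ}

lemma Mix.deg_int_zero (m : Mix P X) (hk : BK k M) (l : ℕ) (j : ℤ) (x : ℝ) :
    ∫ ω, deg (m.nu l) k x (m.ξ l j ω) ∂P = 0 := by
  have h : Measurable fun y => deg (m.nu l) k x y := hk.deg_meas.comp measurable_prodMk_left
  rw [m.int_nu l j _ h]
  exact hk.deg_zero x

lemma Mix.deg_past (m : Mix P X) (hk : BK k M) (l : ℕ) {α : Type} [MeasurableSpace α] (s : ℤ)
    (A : Ω → α) (hA : Measurable[m.past s] A) (F c : α → ℝ) (hF : Measurable F)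
    (hc : Measurable c) (B : ℝ) (hB : ∀ a, |F a| ≤ B) (j : ℤ) (g : ℕ) (hj : s + l + g ≤ j) :
    |∫ ω, F (A ω) * deg (m.nu l) k (c (A ω)) (m.ξ l j ω) ∂P| ≤ 8 * (B * M) * m.bt g := by
  have hcl := m.close s g α ℝ A (m.ξ l j) hA (m.ξ_fut l j _ (by omega))
  have hF' : Measurable fun x : α × ℝ => F x.1 * deg (m.nu l) k (c x.1) x.2 :=
    (hF.comp measurable_fst).mul
      (hk.deg_meas.comp ((hc.comp measurable_fst).prodMk measurable_snd))
  have h := hcl.integral (hA.mono (m.past_le s) le_rfl) (m.hξ l j)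
    (fun a y => F a * deg (m.nu l) k (c a) y) hF' (B * (2 * M)) (fun a y => by
      rw [abs_mul]
      exact mul_le_mul (hB a) (hk.deg_abs _ _) (abs_nonneg _) ((abs_nonneg _).trans (hB a)))
  have e : ∫ ω, ∫ ω', F (A ω) * deg (m.nu l) k (c (A ω)) (m.ξ l j ω') ∂P ∂P = 0 := by
    simp only [integral_const_mul, m.deg_int_zero hk, mul_zero, integral_zero]
  rw [e, sub_zero] at h
  linarith

lemma Mix.deg_fut (m : Mix P X) (hk : BK k M) (l : ℕ) {α : Type} [MeasurableSpace α] (s : ℤ)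
    (A : Ω → α) (hA : Measurable[m.fut s] A) (F c : α → ℝ) (hF : Measurable F)
    (hc : Measurable c) (B : ℝ) (hB : ∀ a, |F a| ≤ B) (j : ℤ) (g : ℕ) (hj : j + l + g ≤ s) :
    |∫ ω, F (A ω) * deg (m.nu l) k (c (A ω)) (m.ξ l j ω) ∂P| ≤ 8 * (B * M) * m.bt g := by
  have hAm := hA.mono (m.fut_le s) le_rfl
  have hcl := m.close (j + l) g ℝ α (m.ξ l j) A (m.ξ_past l j _ le_rfl)
    (hA.mono (m.fut_anti _ _ hj) le_rfl)
  have hF' : Measurable fun x : ℝ × α => F x.2 * deg (m.nu l) k (c x.2) x.1 :=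
    (hF.comp measurable_snd).mul
      (hk.deg_meas.comp ((hc.comp measurable_snd).prodMk measurable_fst))
  have hbd : ∀ y a, |F a * deg (m.nu l) k (c a) y| ≤ B * (2 * M) := fun y a => by
      rw [abs_mul]
      exact mul_le_mul (hB a) (hk.deg_abs _ _) (abs_nonneg _) ((abs_nonneg _).trans (hB a))
  have h := hcl.integral (m.hξ l j) hAm
    (fun y a => F a * deg (m.nu l) k (c a) y) hF' (B * (2 * M)) hbd
  have e : ∫ ω, ∫ ω', F (A ω') * deg (m.nu l) k (c (A ω')) (m.ξ l j ω) ∂P ∂P = 0 := by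
    rw [integral_integral_swap]
    · simp only [integral_const_mul, m.deg_int_zero hk, mul_zero, integral_zero]
    · refine integrable_bdd _ _ ?_ (B * (2 * M)) fun z => hbd _ _
      exact hF'.comp (((m.hξ l j).comp measurable_fst).prodMk (hAm.comp measurable_snd))
  rw [e, sub_zero] at h
  linarith

/-- Covariance of the degenerate kernel. -/
def Mix.dc (m : Mix P X) (k : ℝ → ℝ → ℝ) (l : ℕ) (i j i' j' : ℤ) : ℝ :=
  |∫ ω, deg (m.nu l) k (m.ξ l i ω) (m.ξ l j ω) * deg (m.nu l) k (m.ξ l i' ω) (m.ξ l j' ω) ∂P|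

lemma Mix.dc_swap (m : Mix P X) (l : ℕ) (i j i' j' : ℤ) :
    m.dc k l i j i' j' = m.dc k l i' j' i j := by
  unfold Mix.dc
  simp only [mul_comm]

lemma Mix.dc_triv (m : Mix P X) (hk : BK k M) (l : ℕ) (i j i' j' : ℤ) :
    m.dc k l i j i' j' ≤ 4 * M ^ 2 := by
  have hM : 0 ≤ M := by linarith [hk.Mpos]
  unfold Mix.dc
  refine abs_integral_le_integral_abs.trans ?_
  calc _ ≤ ∫ _, 4 * M ^ 2 ∂P := by
        apply integral_mono_of_nonneg (Eventually.of_forall fun ω => abs_nonneg _)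
          (integrable_const _) (Eventually.of_forall fun ω => ?_)
        dsimp only
        rw [abs_mul, show 4 * M ^ 2 = (2 * M) * (2 * M) by ring]
        exact mul_le_mul (hk.deg_abs _ _) (hk.deg_abs _ _) (abs_nonneg _) (by positivity)
    _ = _ := by simp

lemma Mix.dc_last (m : Mix P X) (hk : BK k M) (l : ℕ) (i j i' j' s : ℤ) (g : ℕ)
    (h1 : i ≤ s) (h2 : j ≤ s) (h3 : i' ≤ s) (h4 : s + 2 * l + g ≤ j') :
    m.dc k l i j i' j' ≤ 16 * M ^ 2 * m.bt g := by
  have hp : ∀ a ≤ s, Measurable[m.past (s + l)] (m.ξ l a) := fun a ha => m.ξ_past l a _ (by omega)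
  have h := m.deg_past hk l (s + l) (fun ω => ((m.ξ l i ω, m.ξ l j ω), m.ξ l i' ω))
    (((hp i h1).prodMk (hp j h2)).prodMk (hp i' h3))
    (fun a => deg (m.nu l) k a.1.1 a.1.2) (fun a => a.2) (hk.deg_meas.comp measurable_fst)
    measurable_snd (2 * M) (fun a => hk.deg_abs _ _) j' g (by omega)
  unfold Mix.dc
  refine h.trans (le_of_eq ?_)
  ring

lemma Mix.dc_first (m : Mix P X) (hk : BK k M) (l : ℕ) (i j i' j' s : ℤ) (g : ℕ)
    (h1 : s ≤ j) (h2 : s ≤ i') (h3 : s ≤ j') (h4 : i + 2 * l + g ≤ s) :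
    m.dc k l i j i' j' ≤ 16 * M ^ 2 * m.bt g := by
  have hp : ∀ a ≥ s, Measurable[m.fut (s - l)] (m.ξ l a) := fun a ha => m.ξ_fut l a _ (by omega)
  have h := m.deg_fut hk l (s - l) (fun ω => ((m.ξ l i' ω, m.ξ l j' ω), m.ξ l j ω))
    (((hp i' h2).prodMk (hp j' h3)).prodMk (hp j h1))
    (fun a => deg (m.nu l) k a.1.1 a.1.2) (fun a => a.2) (hk.deg_meas.comp measurable_fst)
    measurable_snd (2 * M) (fun a => hk.deg_abs _ _) i g (by omega)
  unfold Mix.dc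
  have e : ∀ ω, deg (m.nu l) k (m.ξ l i ω) (m.ξ l j ω) * deg (m.nu l) k (m.ξ l i' ω) (m.ξ l j' ω)
      = deg (m.nu l) k (m.ξ l i' ω) (m.ξ l j' ω) * deg (m.nu l) k (m.ξ l j ω) (m.ξ l i ω) := by
    intro ω; rw [hk.deg_symm (m.ξ l i ω)]; ring
  simp only [e]
  refine h.trans (le_of_eq ?_)
  ring

def Phi (l g : ℕ) : ℝ := (2 * (l : ℝ) + 1) / ((g : ℝ) + 1)

lemma Phi_nonneg (l g : ℕ) : 0 ≤ Phi l g := by unfold Phi; positivity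

lemma gap_bound (m : Mix P X) (C E : ℝ) (hC : 0 ≤ C)
    (hb : ∀ k : ℕ, m.bt k ≤ C / ((k : ℝ) + 1) ^ 2) (l g : ℕ)
    (h1 : E ≤ 4 * M ^ 2) (h2 : ∀ d : ℕ, 2 * l + d = g → E ≤ 16 * M ^ 2 * m.bt d) :
    E ≤ 16 * M ^ 2 * (C + 1) * (Phi l g) ^ 2 := by
  by_cases hg : 2 * l ≤ g
  · obtain ⟨d, rfl⟩ := Nat.exists_eq_add_of_le hg
    have h3 := h2 d rfl
    have h4 : m.bt d ≤ C * (Phi l (2 * l + d)) ^ 2 := by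
      refine (hb d).trans ?_
      rw [div_eq_mul_one_div]
      apply mul_le_mul_of_nonneg_left _ hC
      unfold Phi
      rw [div_pow, div_le_div_iff₀ (by positivity) (by positivity), one_mul, ← mul_pow]
      apply pow_le_pow_left₀ (by positivity)
      push_cast
      nlinarith [mul_nonneg (Nat.cast_nonneg l : (0:ℝ) ≤ l) (Nat.cast_nonneg d : (0:ℝ) ≤ d)]
    nlinarith [mul_le_mul_of_nonneg_left h4 (sq_nonneg M), mul_nonneg (sq_nonneg M) (sq_nonneg (Phi l (2 * l + d)))]
  · have h5 : 1 ≤ Phi l g := by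
      unfold Phi
      rw [le_div_iff₀ (by positivity)]
      have : (g : ℝ) ≤ 2 * l := by exact_mod_cast (by omega : g ≤ 2 * l)
      linarith
    have h6 : 1 ≤ (Phi l g) ^ 2 := one_le_pow₀ h5
    have h7 : M ^ 2 * 1 ≤ M ^ 2 * (Phi l g) ^ 2 := mul_le_mul_of_nonneg_left h6 (sq_nonneg M)
    nlinarith [mul_nonneg hC (mul_nonneg (sq_nonneg M) (sq_nonneg (Phi l g)))]

lemma le_mul_of_sq {E C a b : ℝ} (hC : 0 ≤ C) (ha : 0 ≤ a) (hb : 0 ≤ b) (h1 : E ≤ C * a ^ 2)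
    (h2 : E ≤ C * b ^ 2) : E ≤ C * (a * b) := by
  rcases le_total a b with h | h
  · exact h1.trans (mul_le_mul_of_nonneg_left (by nlinarith) hC)
  · exact h2.trans (mul_le_mul_of_nonneg_left (by nlinarith) hC)

lemma Mix.dc_bound (m : Mix P X) (hk : BK k M) (C : ℝ) (hC : 0 ≤ C)
    (hb : ∀ k : ℕ, m.bt k ≤ C / ((k : ℝ) + 1) ^ 2) (l : ℕ) (i j i' j' : ℤ)
    (hij : i < j) (hij' : i' < j') :
    m.dc k l i j i' j' ≤ 16 * M ^ 2 * (C + 1) *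
      (Phi l (i - i').natAbs * Phi l (j - j').natAbs + Phi l (i - j).natAbs * Phi l (i' - j').natAbs) := by
  have hCC : 0 ≤ 16 * M ^ 2 * (C + 1) := by positivity
  have key : ∀ i j i' j' : ℤ, i < j → i' < j' → j ≤ j' → m.dc k l i j i' j' ≤ 16 * M ^ 2 * (C + 1) *
      (Phi l (i - i').natAbs * Phi l (j - j').natAbs
        + Phi l (i - j).natAbs * Phi l (i' - j').natAbs) := by
    intro i j i' j' hij hij' hjj
    have p1 := mul_nonneg (Phi_nonneg l (i - i').natAbs) (Phi_nonneg l (j - j').natAbs)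
    have p2 := mul_nonneg (Phi_nonneg l (i - j).natAbs) (Phi_nonneg l (i' - j').natAbs)
    have ht := m.dc_triv hk l i j i' j'
    by_cases h : i' < j
    · have : m.dc k l i j i' j' ≤ 16 * M ^ 2 * (C + 1) *
          (Phi l (i - i').natAbs * Phi l (j - j').natAbs) := by
        apply le_mul_of_sq hCC (Phi_nonneg _ _) (Phi_nonneg _ _)
        · apply gap_bound m C _ hC hb l _ ht
          intro d hd
          rcases le_total i i' with hi | hi
          · exact m.dc_first hk l i j i' j' i' d (by omega) (by omega) (by omega) (by omega)
          · rw [m.dc_swap]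
            exact m.dc_first hk l i' j' i j i d (by omega) (by omega) (by omega) (by omega)
        · apply gap_bound m C _ hC hb l _ ht
          intro d hd
          exact m.dc_last hk l i j i' j' j d (by omega) (by omega) (by omega) (by omega)
      refine this.trans (mul_le_mul_of_nonneg_left (by linarith) hCC)
    · have : m.dc k l i j i' j' ≤ 16 * M ^ 2 * (C + 1) *
          (Phi l (i - j).natAbs * Phi l (i' - j').natAbs) := by
        apply le_mul_of_sq hCC (Phi_nonneg _ _) (Phi_nonneg _ _)
        · apply gap_bound m C _ hC hb l _ ht
          intro d hd
          exact m.dc_first hk l i j i' j' j d (by omega) (by omega) (by omega) (by omega)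
        · apply gap_bound m C _ hC hb l _ ht
          intro d hd
          exact m.dc_last hk l i j i' j' i' d (by omega) (by omega) (by omega) (by omega)
      refine this.trans (mul_le_mul_of_nonneg_left (by linarith) hCC)
  rcases le_total j j' with h | h
  · exact key i j i' j' hij hij' h
  · have := key i' j' i j hij' hij h
    rw [m.dc_swap, show (i - i').natAbs = (i' - i).natAbs by omega,
      show (j - j').natAbs = (j' - j).natAbs by omega]
    linarith

/-- Sum over pairs. -/
def pairSum (q : ℝ → ℝ → ℝ) (x : ℕ → ℝ) (n : ℕ) : ℝ :=
  ∑ j ∈ Finset.range n, ∑ i ∈ Finset.range j, q (x i) (x j)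

lemma pairSum_diff (q : ℝ → ℝ → ℝ) (x : ℕ → ℝ) (n c T : ℕ) (hT : n + c ≤ T) :
    pairSum q x (n + c) - pairSum q x n =
      ∑ p ∈ (Finset.range T ×ˢ Finset.Ico n (n + c)).filter (fun p => p.1 < p.2),
        q (x p.1) (x p.2) := by
  unfold pairSum
  rw [← Finset.sum_Ico_eq_sub _ (by omega), Finset.sum_filter, Finset.sum_product_right]
  apply Finset.sum_congr rfl
  intro j hj
  rw [Finset.mem_Ico] at hj
  rw [← Finset.sum_filter]
  apply Finset.sum_congr _ fun _ _ => rfl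
  ext i
  simp only [Finset.mem_range, Finset.mem_filter]
  omega

/-- The positive-time approximating sequence. -/
def Mix.xi (m : Mix P X) (l : ℕ) (ω : Ω) (i : ℕ) : ℝ := m.ξ l (i + 1) ω

def harm (T : ℕ) : ℝ := ∑ r ∈ Finset.range T, 1 / ((r : ℝ) + 1)

lemma harm_nonneg (T : ℕ) : 0 ≤ harm T := Finset.sum_nonneg fun _ _ => by positivity

lemma harm_pow (a : ℕ) : harm (2 ^ a) ≤ a + 1 := by
  have h := harmonic_le_one_add_log (2 ^ a)
  have e : (harmonic (2 ^ a) : ℝ) = harm (2 ^ a) := by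
    unfold harmonic harm
    push_cast
    simp
  rw [e] at h
  push_cast at h
  rw [Real.log_pow] at h
  have h2 : Real.log 2 ≤ 1 := by
    have := Real.log_two_lt_d9; linarith
  have : (a : ℝ) * Real.log 2 ≤ a * 1 := by gcongr
  linarith

lemma Mix.deg_second (m : Mix P X) (hk : BK k M) (C : ℝ) (hC : 0 ≤ C)
    (hb : ∀ k : ℕ, m.bt k ≤ C / ((k : ℝ) + 1) ^ 2) (l n c T : ℕ) (hT : n + c ≤ T) :
    ∫ ω, (pairSum (deg (m.nu l) k) (m.xi l ω) (n + c) - pairSum (deg (m.nu l) k) (m.xi l ω) n) ^ 2 ∂P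
      ≤ 16 * M ^ 2 * (C + 1) * (8 * (2 * l + 1) ^ 2 * harm T ^ 2 * T * c) := by
  have hM : 0 ≤ M := by linarith [hk.Mpos]
  set S := (Finset.range T ×ˢ Finset.Ico n (n + c)).filter (fun p => p.1 < p.2) with hS
  simp only [fun ω => pairSum_diff (deg (m.nu l) k) (m.xi l ω) n c T hT]
  rw [← hS]
  have hm1 : ∀ p : ℕ × ℕ, Measurable fun ω => deg (m.nu l) k (m.xi l ω p.1) (m.xi l ω p.2) :=
    fun p => hk.deg_meas.comp ((m.hξ l _).prodMk (m.hξ l _))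
  have hip : ∀ p p' : ℕ × ℕ, Integrable (fun ω => deg (m.nu l) k (m.xi l ω p.1) (m.xi l ω p.2)
      * deg (m.nu l) k (m.xi l ω p'.1) (m.xi l ω p'.2)) P := fun p p' =>
    integrable_bdd _ _ ((hm1 p).mul (hm1 p')) ((2 * M) * (2 * M)) fun ω => by
      rw [abs_mul]; exact mul_le_mul (hk.deg_abs _ _) (hk.deg_abs _ _) (abs_nonneg _) (by positivity)
  simp only [sq (∑ p ∈ S, _), Finset.sum_mul_sum]
  rw [integral_finsetSum _ (fun i _ => integrable_finsetSum _ fun j _ => hip _ _)]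
  simp only [integral_finsetSum _ (fun j _ => hip _ _)]
  set Cc := 16 * M ^ 2 * (C + 1) with hCc
  have hCc0 : 0 ≤ Cc := by positivity
  set F : ℕ × ℕ → ℕ × ℕ → ℝ := fun p p' =>
    Phi l ((p.1 : ℤ) - p'.1).natAbs * Phi l ((p.2 : ℤ) - p'.2).natAbs
    + Phi l ((p.1 : ℤ) - p.2).natAbs * Phi l ((p'.1 : ℤ) - p'.2).natAbs with hF
  have hF0 : ∀ p p', 0 ≤ F p p' := fun p p' =>
    add_nonneg (mul_nonneg (Phi_nonneg _ _) (Phi_nonneg _ _))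
      (mul_nonneg (Phi_nonneg _ _) (Phi_nonneg _ _))
  have hstep : ∀ p ∈ S, ∀ p' ∈ S, ∫ ω, deg (m.nu l) k (m.xi l ω p.1) (m.xi l ω p.2)
      * deg (m.nu l) k (m.xi l ω p'.1) (m.xi l ω p'.2) ∂P ≤ Cc * F p p' := by
    intro p hp p' hp'
    simp only [hS, Finset.mem_filter] at hp hp'
    have := m.dc_bound hk C hC hb l (p.1 + 1) (p.2 + 1) (p'.1 + 1) (p'.2 + 1)
      (by omega) (by omega)
    simp only [add_sub_add_right_eq_sub] at this
    exact (le_abs_self _).trans this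
  have hrow : ∀ i ∈ Finset.range T, ∑ j ∈ Finset.range T, Phi l ((i : ℤ) - j).natAbs
      ≤ 2 * ((2 * l + 1) * harm T) := by
    intro i hi
    have h := lag_row (Phi l) (Phi_nonneg l) T 0 i hi
    simp only [zero_add] at h
    refine h.trans (le_of_eq ?_)
    unfold harm Phi
    rw [Finset.mul_sum (a := (2 * (l : ℝ) + 1))]
    congr 1
    apply Finset.sum_congr rfl
    intro r _; ring
  have hsub : Finset.Ico n (n + c) ⊆ Finset.range T := by
    intro x hx; rw [Finset.mem_Ico] at hx; rw [Finset.mem_range]; omega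
  set R := 2 * ((2 * (l : ℝ) + 1) * harm T) with hR
  have hR0 : 0 ≤ R := by have := harm_nonneg T; positivity
  have hA : ∑ i ∈ Finset.range T, ∑ i' ∈ Finset.range T, Phi l ((i : ℤ) - i').natAbs ≤ T * R := by
    refine (Finset.sum_le_sum hrow).trans (le_of_eq ?_)
    rw [Finset.sum_const, Finset.card_range, nsmul_eq_mul]
  have hA0 : 0 ≤ ∑ i ∈ Finset.range T, ∑ i' ∈ Finset.range T, Phi l ((i : ℤ) - i').natAbs :=
    Finset.sum_nonneg fun _ _ => Finset.sum_nonneg fun _ _ => Phi_nonneg _ _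
  have hB : ∑ j ∈ Finset.Ico n (n + c), ∑ j' ∈ Finset.range T, Phi l ((j : ℤ) - j').natAbs
      ≤ c * R := by
    refine (Finset.sum_le_sum fun i hi => hrow i (hsub hi)).trans (le_of_eq ?_)
    rw [Finset.sum_const, Nat.card_Ico, nsmul_eq_mul]; congr 2; simp
  have hB' : ∑ j ∈ Finset.Ico n (n + c), ∑ j' ∈ Finset.Ico n (n + c), Phi l ((j : ℤ) - j').natAbs
      ≤ c * R := by
    refine le_trans (Finset.sum_le_sum fun i _ => ?_) hB
    exact Finset.sum_le_sum_of_subset_of_nonneg hsub fun _ _ _ => Phi_nonneg _ _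
  have hB0 : 0 ≤ ∑ j ∈ Finset.Ico n (n + c), ∑ j' ∈ Finset.range T, Phi l ((j : ℤ) - j').natAbs :=
    Finset.sum_nonneg fun _ _ => Finset.sum_nonneg fun _ _ => Phi_nonneg _ _
  have hB0' : 0 ≤ ∑ j ∈ Finset.Ico n (n + c), ∑ j' ∈ Finset.Ico n (n + c),
      Phi l ((j : ℤ) - j').natAbs :=
    Finset.sum_nonneg fun _ _ => Finset.sum_nonneg fun _ _ => Phi_nonneg _ _
  have hSsub : S ⊆ Finset.range T ×ˢ Finset.Ico n (n + c) := Finset.filter_subset _ _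
  have hcomp : ∑ i ∈ Finset.range T, ∑ j ∈ Finset.Ico n (n + c), Phi l ((i : ℤ) - j).natAbs
      = ∑ j ∈ Finset.Ico n (n + c), ∑ i ∈ Finset.range T, Phi l ((j : ℤ) - i).natAbs := by
    rw [Finset.sum_comm]
    apply Finset.sum_congr rfl; intro j _
    apply Finset.sum_congr rfl; intro i _
    rw [show ((i : ℤ) - j).natAbs = ((j : ℤ) - i).natAbs by omega]
  have hcT : (c : ℝ) ≤ T := by exact_mod_cast (by omega : c ≤ T)
  calc _ ≤ ∑ p ∈ S, ∑ p' ∈ S, Cc * F p p' :=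
        Finset.sum_le_sum fun p hp => Finset.sum_le_sum fun p' hp' => hstep p hp p' hp'
    _ = Cc * ∑ p ∈ S, ∑ p' ∈ S, F p p' := by simp only [Finset.mul_sum]
    _ ≤ Cc * ∑ p ∈ Finset.range T ×ˢ Finset.Ico n (n + c),
          ∑ p' ∈ Finset.range T ×ˢ Finset.Ico n (n + c), F p p' := by
        apply mul_le_mul_of_nonneg_left _ hCc0
        refine (Finset.sum_le_sum fun p _ =>
          Finset.sum_le_sum_of_subset_of_nonneg hSsub fun p' _ _ => hF0 p p').trans ?_
        exact Finset.sum_le_sum_of_subset_of_nonneg hSsub fun p _ _ =>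
          Finset.sum_nonneg fun p' _ => hF0 p p'
    _ = Cc * ((∑ i ∈ Finset.range T, ∑ i' ∈ Finset.range T, Phi l ((i : ℤ) - i').natAbs)
          * (∑ j ∈ Finset.Ico n (n + c), ∑ j' ∈ Finset.Ico n (n + c), Phi l ((j : ℤ) - j').natAbs)
        + (∑ i ∈ Finset.range T, ∑ j ∈ Finset.Ico n (n + c), Phi l ((i : ℤ) - j).natAbs)
          * (∑ i ∈ Finset.range T, ∑ j ∈ Finset.Ico n (n + c), Phi l ((i : ℤ) - j).natAbs)) := by
        congr 1
        simp only [hF, Finset.sum_add_distrib]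
        congr 1
        · simp only [Finset.sum_product]
          simp only [Finset.sum_mul_sum]
        · simp only [← Finset.mul_sum, ← Finset.sum_mul]
          simp only [Finset.sum_product]
    _ ≤ Cc * ((T * R) * (c * R) + (c * R) * (c * R)) := by
        apply mul_le_mul_of_nonneg_left _ hCc0
        rw [hcomp]
        apply add_le_add
        · exact mul_le_mul hA hB' hB0' (by positivity)
        · exact mul_le_mul hB hB hB0 (by positivity)
    _ ≤ Cc * ((T * R) * (c * R) + (T * R) * (c * R)) := by
        apply mul_le_mul_of_nonneg_left _ hCc0
        have : (c * R) * (c * R) ≤ (T * R) * (c * R) := by gcongr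
        linarith
    _ = _ := by rw [hR]; ring

lemma cheb (Q : Measure Ω) [IsProbabilityMeasure Q] (Y : Ω → ℝ) (hY : Measurable Y) (B : ℝ)
    (hB : ∀ ω, |Y ω| ≤ B) (y : ℝ) (hy : 0 < y) (V : ℝ) (hV : ∫ ω, Y ω ^ 2 ∂Q ≤ V) :
    Q.real {ω | y < |Y ω|} ≤ V / y ^ 2 := by
  have hi : Integrable (fun ω => Y ω ^ 2) Q := integrable_bdd _ _ (hY.pow_const 2) (B ^ 2) fun ω => by
    rw [abs_pow]; exact pow_le_pow_left₀ (abs_nonneg _) (hB ω) 2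
  have h := mul_meas_ge_le_integral_of_nonneg (Eventually.of_forall fun ω => sq_nonneg (Y ω)) hi (y ^ 2)
  rw [le_div_iff₀ (by positivity), mul_comm]
  refine le_trans ?_ (h.trans hV)
  apply mul_le_mul_of_nonneg_left _ (by positivity)
  refine measureReal_mono ?_ (measure_ne_top _ _)
  intro ω hω
  simp only [mem_ofPred_eq] at hω ⊢
  rw [← sq_abs (Y ω)]
  exact pow_le_pow_left₀ hy.le hω.le 2

lemma pairSum_abs (q : ℝ → ℝ → ℝ) (B : ℝ) (hB : ∀ x y, |q x y| ≤ B) (x : ℕ → ℝ) (n : ℕ) :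
    |pairSum q x n| ≤ n * (n * B) := by
  have hB0 : 0 ≤ B := (abs_nonneg _).trans (hB 0 0)
  unfold pairSum
  refine (Finset.abs_sum_le_sum_abs _ _).trans ?_
  refine (Finset.sum_le_card_nsmul _ _ (n * B) fun j hj => ?_).trans (le_of_eq (by simp))
  rw [Finset.mem_range] at hj
  refine (Finset.abs_sum_le_sum_abs _ _).trans ?_
  refine (Finset.sum_le_card_nsmul _ _ B fun i _ => hB _ _).trans ?_
  rw [Finset.card_range, nsmul_eq_mul]
  have : (j : ℝ) ≤ n := by exact_mod_cast hj.le
  gcongr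

/-- Maximal inequality for the degenerate part. -/
lemma Mix.deg_chain (m : Mix P X) (hk : BK k M) (C : ℝ) (hC : 0 ≤ C)
    (hb : ∀ k : ℕ, m.bt k ≤ C / ((k : ℝ) + 1) ^ 2) (l a : ℕ) (x : ℝ) (hx : 0 < x) :
    P.real {ω | ∃ n ≤ 2 ^ a, x < |pairSum (deg (m.nu l) k) (m.xi l ω) n|}
      ≤ 16 * M ^ 2 * (C + 1) * 8 * (2 * l + 1) ^ 2 * ((a : ℝ) + 1) ^ 5 * (2 ^ a) ^ 2 / x ^ 2 := by
  set f : Ω → ℕ → ℝ := fun ω n => pairSum (deg (m.nu l) k) (m.xi l ω) n with hf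
  have hfm : ∀ n, Measurable fun ω => f ω n := fun n => by
    refine Finset.measurable_sum _ fun j _ => Finset.measurable_sum _ fun i _ => ?_
    exact hk.deg_meas.comp ((m.hξ l _).prodMk (m.hξ l _))
  have hapos : (0 : ℝ) < (a : ℝ) + 1 := by positivity
  set y := x / ((a : ℝ) + 1) with hy
  have hy0 : 0 < y := by positivity
  set Cc := 16 * M ^ 2 * (C + 1) with hCc
  have hCc0 : 0 ≤ Cc := by positivity
  set I := (Finset.range (a + 1)).sigma fun v => Finset.range (2 ^ v) with hI
  set Bad : (Σ _ : ℕ, ℕ) → Set Ω := fun vc =>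
    {ω | y < |f ω ((vc.2 + 1) * 2 ^ (a - vc.1)) - f ω (vc.2 * 2 ^ (a - vc.1))|} with hBad
  have hsub : {ω | ∃ n ≤ 2 ^ a, x < |f ω n|} ⊆ ⋃ vc ∈ I, Bad vc := by
    intro ω hω
    obtain ⟨n, hn, hxn⟩ := hω
    by_contra hcon
    have hall : ∀ v ≤ a, ∀ c < 2 ^ v,
        |f ω ((c + 1) * 2 ^ (a - v)) - f ω (c * 2 ^ (a - v))| ≤ y := by
      intro v hv c hc
      by_contra h
      apply hcon
      refine mem_iUnion₂.2 ⟨⟨v, c⟩, ?_, not_le.1 h⟩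
      simp only [hI, Finset.mem_sigma, Finset.mem_range]
      exact ⟨by omega, hc⟩
    have := dyadic_chain (f ω) a (fun _ => y) hall n hn
    rw [Finset.sum_const, Finset.card_range, nsmul_eq_mul] at this
    have h0 : f ω 0 = 0 := by simp [hf, pairSum]
    rw [h0, sub_zero] at this
    have hyx : ((a + 1 : ℕ) : ℝ) * y = x := by rw [hy]; push_cast; field_simp
    linarith
  have hone : ∀ vc ∈ I, P.real (Bad vc)
      ≤ Cc * (8 * (2 * l + 1) ^ 2 * ((a : ℝ) + 1) ^ 2 * 2 ^ a * 2 ^ (a - vc.1)) / y ^ 2 := by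
    intro vc hvc
    simp only [hI, Finset.mem_sigma, Finset.mem_range] at hvc
    have hle : vc.2 * 2 ^ (a - vc.1) + 2 ^ (a - vc.1) ≤ 2 ^ a := by
      calc vc.2 * 2 ^ (a - vc.1) + 2 ^ (a - vc.1) = (vc.2 + 1) * 2 ^ (a - vc.1) := by ring
        _ ≤ 2 ^ vc.1 * 2 ^ (a - vc.1) := Nat.mul_le_mul_right _ hvc.2
        _ = 2 ^ a := by rw [← pow_add]; congr 1; omega
    have h2 := m.deg_second hk C hC hb l (vc.2 * 2 ^ (a - vc.1)) (2 ^ (a - vc.1)) (2 ^ a) hle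
    rw [show vc.2 * 2 ^ (a - vc.1) + 2 ^ (a - vc.1) = (vc.2 + 1) * 2 ^ (a - vc.1) by ring] at h2
    have h3 : Cc * (8 * (2 * l + 1) ^ 2 * harm (2 ^ a) ^ 2 * (2 ^ a : ℕ) * (2 ^ (a - vc.1) : ℕ))
        ≤ Cc * (8 * (2 * l + 1) ^ 2 * ((a : ℝ) + 1) ^ 2 * 2 ^ a * 2 ^ (a - vc.1)) := by
      have h4 := harm_pow a
      have h5 := harm_nonneg (2 ^ a)
      push_cast
      gcongr
    apply cheb P _ ((hfm _).sub (hfm _)) _ _ y hy0 _ (h2.trans h3)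
    · exact (((vc.2 + 1) * 2 ^ (a - vc.1) : ℕ) : ℝ) * ((((vc.2 + 1) * 2 ^ (a - vc.1) : ℕ) : ℝ) * (2 * M))
        + ((vc.2 * 2 ^ (a - vc.1) : ℕ) : ℝ) * (((vc.2 * 2 ^ (a - vc.1) : ℕ) : ℝ) * (2 * M))
    · intro ω
      exact (abs_sub _ _).trans (add_le_add (pairSum_abs _ _ hk.deg_abs _ _)
        (pairSum_abs _ _ hk.deg_abs _ _))
  calc P.real {ω | ∃ n ≤ 2 ^ a, x < |f ω n|} ≤ P.real (⋃ vc ∈ I, Bad vc) := measureReal_mono hsub (measure_ne_top _ _)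
    _ ≤ ∑ vc ∈ I, P.real (Bad vc) := measureReal_biUnion_finset_le _ _
    _ ≤ ∑ vc ∈ I, Cc * (8 * (2 * l + 1) ^ 2 * ((a : ℝ) + 1) ^ 2 * 2 ^ a * 2 ^ (a - vc.1)) / y ^ 2 :=
        Finset.sum_le_sum hone
    _ = ∑ v ∈ Finset.range (a + 1),
          Cc * (8 * (2 * l + 1) ^ 2 * ((a : ℝ) + 1) ^ 2 * 2 ^ a * 2 ^ a) / y ^ 2 := by
        rw [hI, Finset.sum_sigma]
        apply Finset.sum_congr rfl
        intro v hv
        rw [Finset.mem_range] at hv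
        dsimp only
        rw [Finset.sum_const, Finset.card_range, nsmul_eq_mul]
        have : (2 : ℝ) ^ a = 2 ^ v * 2 ^ (a - v) := by rw [← pow_add]; congr 1; omega
        push_cast
        have e : (2 : ℝ) ^ a * 2 ^ a = 2 ^ a * (2 ^ v * 2 ^ (a - v)) := by rw [← this]
        rw [mul_assoc _ ((2 : ℝ) ^ a) (2 ^ a), e]
        ring
    _ = _ := by
        rw [Finset.sum_const, Finset.card_range, nsmul_eq_mul, hy]
        push_cast
        field_simp

end DegSec

end UQuantile

namespace UQuantile

section LinMax

variable {Ω : Type*} [MeasurableSpace Ω] {P : Measure Ω} [IsProbabilityMeasure P]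
  {X : ℤ → Ω → ℝ}

lemma sum_blocks (g : ℕ → ℝ) (K k : ℕ) :
    ∑ a ∈ Finset.range (2 * K * k), g a =
      ∑ b ∈ Finset.range k, ∑ i ∈ Finset.range K, g (2 * K * b + i)
      + ∑ b ∈ Finset.range k, ∑ i ∈ Finset.range K, g (2 * K * b + K + i) := by
  induction k with
  | zero => simp
  | succ k ih =>
    rw [Finset.sum_range_succ, Finset.sum_range_succ, show 2 * K * (k + 1) = 2 * K * k + K + K by ring,
      Finset.sum_range_add, Finset.sum_range_add, ih]
    ring

/-- Block sums. -/
def Mix.Yb {E : Type} (m : Mix P X) (l K par : ℕ) (f : E → ℝ → ℝ) (b : ℕ) (ω : Ω) (e : E) : ℝ :=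
  ∑ i ∈ Finset.range K, f e (m.ξ l (((2 * K * b + par * K + 1 : ℕ) : ℤ) + (i : ℤ)) ω)

lemma lin_half {E : Type} [Fintype E] (m : Mix P X) (l K par : ℕ) (f : E → ℝ → ℝ) {M c δ : ℝ}
    (hf : ∀ e, Cen m l (f e) M c δ) (hM : 0 ≤ M) (hc : 0 ≤ c) (hδ : 0 ≤ δ) (h2l : 2 * l ≤ K)
    (s x : ℝ) (hs : 0 ≤ s) (hsK : s * (K * M) ≤ 1) (B : ℕ) :
    P.real {ω | ∃ e, x ≤ mx (m.Yb l K par f) B 0 ω e} ≤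
      (Fintype.card E : ℝ) * (Real.exp (-(s * x)) *
        Real.exp (s ^ 2 * (covC M c * (2 * K * ∑ r ∈ Finset.range K, min δ (m.gam r)))) ^ B)
      + B * (2 * m.bt (K - 2 * l)) := by
  have hbd : ∀ b e ω, |m.Yb l K par f b ω e| ≤ K * M := by
    intro b e ω
    unfold Mix.Yb
    refine (Finset.abs_sum_le_sum_abs _ _).trans ?_
    refine (Finset.sum_le_sum fun i _ => (hf e).bd _).trans ?_
    simp
  have hYm : ∀ b, Measurable (m.Yb l K par f b) := by
    intro b
    refine measurable_pi_iff.2 fun e => ?_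
    exact Finset.measurable_sum _ fun i _ => (hf e).meas.comp (m.hξ _ _)
  have hpast : ∀ b, Measurable[m.past ((2 * K * b + par * K + K + l : ℕ) : ℤ)] (m.Yb l K par f b) := by
    intro b
    refine meas_pi _ _ fun e => ?_
    refine Finset.measurable_sum (m := m.past ((2 * K * b + par * K + K + l : ℕ) : ℤ)) _ fun i hi => ?_
    rw [Finset.mem_range] at hi
    refine (hf e).meas.comp (m.ξ_past l _ _ ?_)
    push_cast; omega
  have hfut : ∀ b b', b + 1 ≤ b' → Measurable[m.fut (((2 * K * b + par * K + K + l : ℕ) : ℤ) + ((K - 2 * l : ℕ) : ℤ))]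
      (m.Yb l K par f b') := by
    intro b b' hb
    refine meas_pi _ _ fun e => ?_
    refine Finset.measurable_sum (m := m.fut (((2 * K * b + par * K + K + l : ℕ) : ℤ) + ((K - 2 * l : ℕ) : ℤ))) _ fun i hi => ?_
    refine (hf e).meas.comp (m.ξ_fut l _ _ ?_)
    have h1 : 2 * K * (b + 1) ≤ 2 * K * b' := Nat.mul_le_mul_left _ hb
    have h2 : 2 * K * (b + 1) = 2 * K * b + K + K := by ring
    omega
  have hcl : ∀ B b, Close P (m.Yb l K par f b) (mx (m.Yb l K par f) B (b + 1)) (2 * m.bt (K - 2 * l)) := by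
    intro B b
    refine m.close _ (K - 2 * l) _ _ _ _ (hpast b) ?_
    exact mx_measurable _ B (b + 1) fun b' hb' => hfut b b' hb'
  have hσ : 0 ≤ covC M c * (2 * K * ∑ r ∈ Finset.range K, min δ (m.gam r)) := by
    have : 0 ≤ ∑ r ∈ Finset.range K, min δ (m.gam r) :=
      Finset.sum_nonneg fun r _ => le_min hδ (m.gam_nonneg r)
    unfold covC; positivity
  have hmain := maximal_chernoff P (m.Yb l K par f) hYm (2 * m.bt (K - 2 * l))
    (by have := m.bt_nonneg (K - 2 * l); positivity) hcl (fun _ => s)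
    (fun _ => Real.exp (s ^ 2 * (covC M c * (2 * K * ∑ r ∈ Finset.range K, min δ (m.gam r)))))
    (fun _ => hs) (fun _ => Real.one_le_exp (by positivity))
    (fun b e => ⟨K * M, fun ω => hbd b e ω⟩) ?_ B 0 (fun _ => x)
  · refine hmain.trans (le_of_eq ?_)
    simp
  · intro b e
    refine mgf_bound P (fun ω => m.Yb l K par f b ω e) ((measurable_pi_iff.1 (hYm b)) e) s _ ?_ ?_
      ⟨K * M, fun ω => hbd b e ω⟩ ?_
    · intro ω
      rw [abs_mul, abs_of_nonneg hs]
      exact (mul_le_mul_of_nonneg_left (hbd b e ω) hs).trans hsK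
    · unfold Mix.Yb
      rw [integral_finsetSum]
      · refine Finset.sum_eq_zero fun i _ => ?_
        rw [m.int_ξ l _ _ (hf e).meas, (hf e).zero]
      · intro i _
        exact integrable_bdd _ _ ((hf e).meas.comp (m.hξ _ _)) M fun ω => (hf e).bd _
    · exact (hf e).block_var hδ K _

lemma lin_max {E : Type} [Fintype E] (m : Mix P X) (l K : ℕ) (f : E → ℝ → ℝ) {M c δ : ℝ}
    (hf : ∀ e, Cen m l (f e) M c δ) (hM : 0 ≤ M) (hc : 0 ≤ c) (hδ : 0 ≤ δ) (hK : 1 ≤ K)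
    (h2l : 2 * l ≤ K) (s x : ℝ) (hs : 0 ≤ s) (hsK : s * (K * M) ≤ 1) (B : ℕ) :
    P.real {ω | ∃ e, ∃ n ≤ 2 * K * B, 2 * x + 2 * K * M < ∑ a ∈ Finset.range n, f e (m.xi l ω a)} ≤
      2 * ((Fintype.card E : ℝ) * (Real.exp (-(s * x)) *
        Real.exp (s ^ 2 * (covC M c * (2 * K * ∑ r ∈ Finset.range K, min δ (m.gam r)))) ^ B)
      + B * (2 * m.bt (K - 2 * l))) := by
  have hsub : {ω | ∃ e, ∃ n ≤ 2 * K * B, 2 * x + 2 * K * M < ∑ a ∈ Finset.range n, f e (m.xi l ω a)} ⊆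
      {ω | ∃ e, x ≤ mx (m.Yb l K 0 f) B 0 ω e} ∪ {ω | ∃ e, x ≤ mx (m.Yb l K 1 f) B 0 ω e} := by
    rintro ω ⟨e, n, hn, hx⟩
    have hkB : n / (2 * K) ≤ B := by
      apply Nat.div_le_of_le_mul; exact hn
    have hnn : n = 2 * K * (n / (2 * K)) + n % (2 * K) := (Nat.div_add_mod n (2 * K)).symm
    have hmod : n % (2 * K) < 2 * K := Nat.mod_lt _ (by omega)
    have e0 : ∑ b ∈ Finset.range (n / (2 * K)), ∑ i ∈ Finset.range K, f e (m.xi l ω (2 * K * b + i))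
        ≤ mx (m.Yb l K 0 f) B 0 ω e := by
      refine le_trans (le_of_eq ?_) ((sum_le_mx (m.Yb l K 0 f) ω e B 0).2 _ hkB)
      refine Finset.sum_congr rfl fun b _ => Finset.sum_congr rfl fun i _ => ?_
      unfold Mix.xi
      congr 2
      push_cast; ring
    have e1 : ∑ b ∈ Finset.range (n / (2 * K)), ∑ i ∈ Finset.range K, f e (m.xi l ω (2 * K * b + K + i))
        ≤ mx (m.Yb l K 1 f) B 0 ω e := by
      refine le_trans (le_of_eq ?_) ((sum_le_mx (m.Yb l K 1 f) ω e B 0).2 _ hkB)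
      refine Finset.sum_congr rfl fun b _ => Finset.sum_congr rfl fun i _ => ?_
      unfold Mix.xi
      congr 2
      push_cast; ring
    have e2 : ∑ a ∈ Finset.range (n % (2 * K)), f e (m.xi l ω (2 * K * (n / (2 * K)) + a)) ≤ 2 * K * M := by
      refine (Finset.sum_le_sum fun i _ => (le_abs_self _).trans ((hf e).bd _)).trans ?_
      rw [Finset.sum_const, Finset.card_range, nsmul_eq_mul]
      refine mul_le_mul_of_nonneg_right ?_ hM
      exact_mod_cast hmod.le
    rw [hnn, Finset.sum_range_add, sum_blocks] at hx
    by_contra hcon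
    rw [mem_union, not_or] at hcon
    simp only [mem_ofPred_eq, not_exists, not_le] at hcon
    have := hcon.1 e
    have := hcon.2 e
    linarith
  refine (measureReal_mono hsub (measure_ne_top _ _)).trans ((measureReal_union_le _ _).trans ?_)
  have a0 := lin_half m l K 0 f hf hM hc hδ h2l s x hs hsK B
  have a1 := lin_half m l K 1 f hf hM hc hδ h2l s x hs hsK B
  linarith

/-- Two sided version. -/
lemma lin_abs {E : Type} [Fintype E] (m : Mix P X) (l K : ℕ) (f : E → ℝ → ℝ) {M c δ : ℝ}
    (hf : ∀ e, Cen m l (f e) M c δ) (hM : 0 ≤ M) (hc : 0 ≤ c) (hδ : 0 ≤ δ) (hK : 1 ≤ K)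
    (h2l : 2 * l ≤ K) (s x : ℝ) (hs : 0 ≤ s) (hsK : s * (K * M) ≤ 1) (B : ℕ) :
    P.real {ω | ∃ e, ∃ n ≤ 2 * K * B, 2 * x + 2 * K * M < |∑ a ∈ Finset.range n, f e (m.xi l ω a)|} ≤
      4 * ((Fintype.card E : ℝ) * (Real.exp (-(s * x)) *
        Real.exp (s ^ 2 * (covC M c * (2 * K * ∑ r ∈ Finset.range K, min δ (m.gam r)))) ^ B)
      + B * (2 * m.bt (K - 2 * l))) := by
  have a0 := lin_max m l K f hf hM hc hδ hK h2l s x hs hsK B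
  have a1 := lin_max m l K (fun e x => - f e x) (fun e => (hf e).neg) hM hc hδ hK h2l s x hs hsK B
  have hsub : {ω | ∃ e, ∃ n ≤ 2 * K * B, 2 * x + 2 * K * M < |∑ a ∈ Finset.range n, f e (m.xi l ω a)|} ⊆
      {ω | ∃ e, ∃ n ≤ 2 * K * B, 2 * x + 2 * K * M < ∑ a ∈ Finset.range n, f e (m.xi l ω a)} ∪
      {ω | ∃ e, ∃ n ≤ 2 * K * B, 2 * x + 2 * K * M < ∑ a ∈ Finset.range n, - f e (m.xi l ω a)} := by
    rintro ω ⟨e, n, hn, hx⟩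
    rcases lt_abs.1 hx with h | h
    · exact Or.inl ⟨e, n, hn, h⟩
    · exact Or.inr ⟨e, n, hn, by rw [Finset.sum_neg_distrib]; exact h⟩
  refine (measureReal_mono hsub (measure_ne_top _ _)).trans ((measureReal_union_le _ _).trans ?_)
  linarith

end LinMax

end UQuantile

namespace UQuantile

section Repl

variable {Ω : Type*} [MeasurableSpace Ω] {P : Measure Ω} [IsProbabilityMeasure P]
  {X : ℤ → Ω → ℝ}

lemma Mix.gam_sum (m : Mix P X) : Summable fun r : ℕ => ((r : ℝ) + 1) * m.gam r := by
  have h1 : Summable fun r : ℕ => ((r : ℝ) + 1) * m.bt (r / 3) := by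
    have hnn : ∀ r : ℕ, 0 ≤ ((r : ℝ) + 1) * m.bt (r / 3) := fun r =>
      mul_nonneg (by positivity) (m.bt_nonneg _)
    have hnn' : ∀ r : ℕ, 0 ≤ ((r : ℝ) + 1) * m.bt r := fun r =>
      mul_nonneg (by positivity) (m.bt_nonneg _)
    refine summable_of_sum_range_le (c := 9 * ∑' k : ℕ, ((k : ℝ) + 1) * m.bt k) hnn fun n => ?_
    have key : ∀ n : ℕ, ∑ r ∈ Finset.range (3 * n), ((r : ℝ) + 1) * m.bt (r / 3)
        ≤ 9 * ∑ k ∈ Finset.range n, ((k : ℝ) + 1) * m.bt k := by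
      intro n
      induction n with
      | zero => simp
      | succ n ih =>
        rw [show 3 * (n + 1) = 3 * n + 1 + 1 + 1 by ring, Finset.sum_range_succ, Finset.sum_range_succ,
          Finset.sum_range_succ, Finset.sum_range_succ,
          show (3 * n + 1 + 1) / 3 = n by omega, show (3 * n + 1) / 3 = n by omega,
          show (3 * n) / 3 = n by omega]
        have := m.bt_nonneg n
        have hn : (0 : ℝ) ≤ n := by positivity
        push_cast
        nlinarith [mul_nonneg hn this]
    calc ∑ r ∈ Finset.range n, ((r : ℝ) + 1) * m.bt (r / 3)
        ≤ ∑ r ∈ Finset.range (3 * n), ((r : ℝ) + 1) * m.bt (r / 3) :=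
          Finset.sum_le_sum_of_subset_of_nonneg (Finset.range_mono (by omega)) fun r _ _ => hnn r
      _ ≤ _ := key n
      _ ≤ _ := mul_le_mul_of_nonneg_left (m.bt_sum.sum_le_tsum _ fun r _ => hnn' r) (by norm_num)
  have h2 : Summable fun r : ℕ => 1 / ((r : ℝ) + 1) ^ 2 := by
    have := (summable_nat_add_iff 1).2 (Real.summable_one_div_nat_pow.2 (by norm_num : 1 < 2))
    simpa using this
  refine (h1.add h2).congr fun r => ?_
  unfold Mix.gam
  have : ((r : ℝ) + 1) ≠ 0 := by positivity
  field_simp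

lemma Mix.gam_bdd (m : Mix P X) : ∃ S : ℝ, 0 ≤ S ∧ ∀ R, ∑ r ∈ Finset.range R, m.gam r ≤ S := by
  refine ⟨∑' r : ℕ, ((r : ℝ) + 1) * m.gam r,
    tsum_nonneg fun r => mul_nonneg (by positivity) (m.gam_nonneg r), fun R => ?_⟩
  refine le_trans (Finset.sum_le_sum fun r _ => ?_)
    (m.gam_sum.sum_le_tsum (Finset.range R) fun r _ => mul_nonneg (by positivity) (m.gam_nonneg r))
  have := m.gam_nonneg r
  have h0 : (0 : ℝ) ≤ r := by positivity
  nlinarith [mul_nonneg h0 this]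

lemma Mix.bt_bdd (m : Mix P X) : ∃ S : ℝ, 0 ≤ S ∧ ∀ R, ∑ r ∈ Finset.range R, m.bt r ≤ S := by
  refine ⟨∑' r : ℕ, ((r : ℝ) + 1) * m.bt r,
    tsum_nonneg fun r => mul_nonneg (by positivity) (m.bt_nonneg r), fun R => ?_⟩
  refine le_trans (Finset.sum_le_sum fun r _ => ?_)
    (m.bt_sum.sum_le_tsum (Finset.range R) fun r _ => mul_nonneg (by positivity) (m.bt_nonneg r))
  have := m.bt_nonneg r
  have h0 : (0 : ℝ) ≤ r := by positivity
  nlinarith [mul_nonneg h0 this]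

lemma pairSum_hoeffding (ν : Measure ℝ) (k : ℝ → ℝ → ℝ) (x : ℕ → ℝ) (n : ℕ) :
    pairSum k x n = n * ((n : ℝ) - 1) / 2 * uu ν k + ((n : ℝ) - 1) * ∑ a ∈ Finset.range n, cen ν k (x a)
      + pairSum (deg ν k) x n := by
  induction n with
  | zero => simp [pairSum]
  | succ n ih =>
    have e : ∀ q, pairSum q x (n + 1) = pairSum q x n + ∑ i ∈ Finset.range n, q (x i) (x n) := by
      intro q; unfold pairSum; rw [Finset.sum_range_succ]
    rw [e, e, ih, Finset.sum_range_succ]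
    have e2 : ∑ i ∈ Finset.range n, deg ν k (x i) (x n) = ∑ i ∈ Finset.range n, k (x i) (x n)
        - ∑ i ∈ Finset.range n, cen ν k (x i) - n * (cen ν k (x n)) - n * uu ν k := by
      have : ∀ i ∈ Finset.range n, deg ν k (x i) (x n)
          = k (x i) (x n) - cen ν k (x i) - cen ν k (x n) - uu ν k := by
        intro i _; unfold deg cen; ring
      rw [Finset.sum_congr rfl this]
      simp [Finset.sum_sub_distrib]
    rw [e2]
    push_cast
    ring

/-- The observed sequence. -/
def xs (X : ℤ → Ω → ℝ) (ω : Ω) (i : ℕ) : ℝ := X (i + 1) ω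

lemma Ustat_eq (h : ℝ → ℝ → ℝ → ℝ) (n : ℕ) (t : ℝ) (ω : Ω) :
    Ustat X h n t ω = 2 / ((n : ℝ) * ((n : ℝ) - 1)) * pairSum (fun x y => h x y t) (xs X ω) n := by
  unfold Ustat
  congr 1
  unfold pairSum xs
  have h1 : ∑ j ∈ Finset.range n, ∑ i ∈ Finset.range j, h (X ((i : ℤ) + 1) ω) (X ((j : ℤ) + 1) ω) t
      = ∑ i ∈ Finset.range n, ∑ j ∈ Finset.Ioo i n, h (X ((i : ℤ) + 1) ω) (X ((j : ℤ) + 1) ω) t := by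
    apply Finset.sum_comm'
    intro a b
    simp only [Finset.mem_range, Finset.mem_Ioo]
    omega
  rw [h1]
  symm
  refine Finset.sum_bij (fun (i : ℕ) _ => (i : ℤ) + 1) ?_ ?_ ?_ ?_
  · intro i hi
    simp only [Finset.mem_range, Finset.mem_Icc] at hi ⊢
    omega
  · intro i _ j _ hij
    simpa using hij
  · intro b hb
    simp only [Finset.mem_Icc] at hb
    exact ⟨(b - 1).toNat, by simp only [Finset.mem_range]; omega, by omega⟩
  · intro i hi
    refine Finset.sum_bij (fun (i : ℕ) _ => (i : ℤ) + 1) ?_ ?_ ?_ ?_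
    · intro i hi
      simp only [Finset.mem_Ioo, Finset.mem_Ioc] at hi ⊢
      omega
    · intro i _ j _ hij
      simpa using hij
    · intro b hb
      simp only [Finset.mem_Ioc] at hb
      exact ⟨(b - 1).toNat, by simp only [Finset.mem_Ioo]; omega, by omega⟩
    · intro j _; rfl

lemma Mix.replace (m : Mix P X) {k : ℝ → ℝ → ℝ} {M L : ℝ} (hk : Ker (P.map (X 0)) k M L)
    (S : ℝ) (hS : ∀ R, ∑ r ∈ Finset.range R, m.bt r ≤ S)
    (l : ℕ) (hl : 1 ≤ l) (N : ℕ) (x : ℝ) (hx : 0 < x) :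
    P.real {ω | ∃ n ≤ N, x + N * (2 * l * M) < |pairSum k (xs X ω) n - pairSum k (m.xi l ω) n|}
      ≤ N * (m.C1 M L * (S + N / (l : ℝ) ^ 3)) / x := by
  have hM0 : 0 ≤ M := by linarith [hk.Mpos]
  have hC1 : 0 ≤ m.C1 M L := by linarith [m.C1_pos M L hk.Mpos]
  set d : ℕ → ℕ → Ω → ℝ := fun i j ω =>
    |k (xs X ω i) (xs X ω j) - k (m.xi l ω i) (m.xi l ω j)| with hd
  have hdm : ∀ i j, Measurable (d i j) := by
    intro i j
    exact ((hk.meas.comp ((m.hX _).prodMk (m.hX _))).sub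
      (hk.meas.comp ((m.hξ l _).prodMk (m.hξ l _)))).abs
  have hdM : ∀ i j ω, d i j ω ≤ M := fun i j ω => hk.abs_sub_le _ _ _ _
  have hd0 : ∀ i j ω, 0 ≤ d i j ω := fun i j ω => abs_nonneg _
  set D : Ω → ℝ := fun ω => ∑ j ∈ Finset.range N, ∑ i ∈ Finset.range (j + 1 - 2 * l), d i j ω with hD
  have hdi : ∀ i j, Integrable (d i j) P := fun i j => integrable_bdd _ _ (hdm i j) M fun ω => by
    rw [abs_of_nonneg (hd0 i j ω)]; exact hdM i j ω
  have hDi : Integrable D P := integrable_finsetSum _ fun j _ => integrable_finsetSum _ fun i _ => hdi i j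
  have hD0 : ∀ ω, 0 ≤ D ω := fun ω => Finset.sum_nonneg fun j _ => Finset.sum_nonneg fun i _ => hd0 _ _ _
  have hED : ∫ ω, D ω ∂P ≤ N * (m.C1 M L * (S + N / (l : ℝ) ^ 3)) := by
    rw [hD, integral_finsetSum _ fun j _ => integrable_finsetSum _ fun i _ => hdi i j]
    refine (Finset.sum_le_card_nsmul _ _ (m.C1 M L * (S + N / (l : ℝ) ^ 3)) fun j hj => ?_).trans
      (le_of_eq (by simp))
    rw [Finset.mem_range] at hj
    rw [integral_finsetSum _ fun i _ => hdi i j]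
    have h1 : ∀ i ∈ Finset.range (j + 1 - 2 * l), ∫ ω, d i j ω ∂P
        ≤ m.C1 M L * (m.bt (j + 1 - 2 * l - 1 - i) + 1 / (l : ℝ) ^ 3) := by
      intro i hi
      rw [Finset.mem_range] at hi
      refine m.far hk l hl _ _ _ ?_
      omega
    refine (Finset.sum_le_sum h1).trans ?_
    rw [← Finset.mul_sum, Finset.sum_add_distrib]
    refine mul_le_mul_of_nonneg_left (add_le_add ?_ ?_) hC1
    · rw [Finset.sum_range_reflect (fun i => m.bt i)]
      exact hS _
    · rw [Finset.sum_const, Finset.card_range, nsmul_eq_mul, mul_one_div]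
      refine div_le_div_of_nonneg_right ?_ (by positivity)
      exact_mod_cast (by omega : j + 1 - 2 * l ≤ N)
  have hsub : {ω | ∃ n ≤ N, x + N * (2 * l * M) < |pairSum k (xs X ω) n - pairSum k (m.xi l ω) n|}
      ⊆ {ω | x ≤ D ω} := by
    rintro ω ⟨n, hn, hxn⟩
    rw [mem_ofPred_eq]
    have h1 : |pairSum k (xs X ω) n - pairSum k (m.xi l ω) n|
        ≤ ∑ j ∈ Finset.range N, ∑ i ∈ Finset.range j, d i j ω := by
      unfold pairSum
      rw [← Finset.sum_sub_distrib]
      refine (Finset.abs_sum_le_sum_abs _ _).trans ?_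
      refine le_trans (Finset.sum_le_sum fun j _ => ?_)
        (Finset.sum_le_sum_of_subset_of_nonneg (Finset.range_mono hn) fun j _ _ =>
          Finset.sum_nonneg fun i _ => hd0 _ _ _)
      rw [← Finset.sum_sub_distrib]
      exact Finset.abs_sum_le_sum_abs _ _
    have h2 : ∀ j ∈ Finset.range N, ∑ i ∈ Finset.range j, d i j ω
        ≤ ∑ i ∈ Finset.range (j + 1 - 2 * l), d i j ω + 2 * l * M := by
      intro j _
      have hle : j + 1 - 2 * l ≤ j := by omega
      rw [← Finset.sum_range_add_sum_Ico _ hle]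
      refine add_le_add le_rfl ?_
      refine (Finset.sum_le_card_nsmul _ _ M fun i _ => hdM i j ω).trans ?_
      rw [Nat.card_Ico, nsmul_eq_mul]
      refine mul_le_mul_of_nonneg_right ?_ hM0
      exact_mod_cast (by omega : j - (j + 1 - 2 * l) ≤ 2 * l)
    have h3 := Finset.sum_le_sum h2
    rw [Finset.sum_add_distrib, Finset.sum_const, Finset.card_range, nsmul_eq_mul] at h3
    have : D ω = ∑ j ∈ Finset.range N, ∑ i ∈ Finset.range (j + 1 - 2 * l), d i j ω := rfl
    linarith
  refine (measureReal_mono hsub (measure_ne_top _ _)).trans ?_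
  rw [le_div_iff₀ hx, mul_comm]
  exact (mul_meas_ge_le_integral_of_nonneg (Eventually.of_forall hD0) hDi x).trans hED

lemma Mix.cen_Cen (m : Mix P X) {k : ℝ → ℝ → ℝ} {M L : ℝ} (hk : Ker (P.map (X 0)) k M L) (l : ℕ) :
    Cen m l (cen (m.nu l) k) M (2 * m.C1 M L) M := by
  have hM0 : 0 ≤ M := by linarith [hk.Mpos]
  have hC1 : 0 ≤ m.C1 M L := by linarith [m.C1_pos M L hk.Mpos]
  refine ⟨hk.bk.cen_meas, hk.bk.cen_abs, hM0, by positivity, ?_, ?_, ?_⟩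
  · rw [m.int_nu l 0 _ hk.bk.cen_meas, hk.bk.cen_zero]
  · intro n h1 h2
    refine le_trans (le_of_eq ?_) (m.u1_close hk n l h1 h2)
    refine integral_congr_ae (Eventually.of_forall fun ω => ?_)
    simp only [cen, sub_sub_sub_cancel_right]
  · have h1 : Measurable fun ω => |cen (m.nu l) k (m.ξ l 0 ω)| := (hk.bk.cen_meas.comp (m.hξ l 0)).abs
    calc ∫ ω, |cen (m.nu l) k (m.ξ l 0 ω)| ∂P ≤ ∫ _, M ∂P :=
          integral_mono (integrable_bdd _ _ h1 M fun ω => by rw [abs_abs]; exact hk.bk.cen_abs _)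
            (integrable_const _) fun ω => hk.bk.cen_abs _
      _ = M := by simp

lemma Mix.cen_diff_Cen (m : Mix P X) {k k' : ℝ → ℝ → ℝ} {M L : ℝ} (hk : Ker (P.map (X 0)) k M L)
    (hk' : Ker (P.map (X 0)) k' M L) (hkk : ∀ x y, k x y ≤ k' x y) (l : ℕ) (δ : ℝ)
    (hδ : 2 * (uu (m.nu l) k' - uu (m.nu l) k) ≤ δ) :
    Cen m l (fun x => cen (m.nu l) k' x - cen (m.nu l) k x) (2 * M) (4 * m.C1 M L) δ := by
  have hM0 : 0 ≤ M := by linarith [hk.Mpos]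
  have hC1 : 0 ≤ m.C1 M L := by linarith [m.C1_pos M L hk.Mpos]
  have c1 := m.cen_Cen hk l
  have c2 := m.cen_Cen hk' l
  have hi : ∀ n, Integrable (fun ω => cen (m.nu l) k (m.ξ n 0 ω)) P := fun n =>
    integrable_bdd _ _ (c1.meas.comp (m.hξ _ _)) M fun ω => c1.bd _
  have hi' : ∀ n, Integrable (fun ω => cen (m.nu l) k' (m.ξ n 0 ω)) P := fun n =>
    integrable_bdd _ _ (c2.meas.comp (m.hξ _ _)) M fun ω => c2.bd _
  refine ⟨c2.meas.sub c1.meas, fun x => ?_, by positivity, by positivity, ?_, ?_, ?_⟩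
  · have := c1.bd x
    have := c2.bd x
    exact (abs_sub _ _).trans (by linarith)
  · rw [integral_sub (hi' l) (hi l), c1.zero, c2.zero, sub_zero]
  · intro n h1 h2
    have b1 := c1.apx n h1 h2
    have b2 := c2.apx n h1 h2
    have i1 : Integrable (fun ω => |cen (m.nu l) k (m.ξ n 0 ω) - cen (m.nu l) k (m.ξ l 0 ω)|) P :=
      ((hi n).sub (hi l)).abs
    have i2 : Integrable (fun ω => |cen (m.nu l) k' (m.ξ n 0 ω) - cen (m.nu l) k' (m.ξ l 0 ω)|) P :=
      ((hi' n).sub (hi' l)).abs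
    calc _ ≤ ∫ ω, (|cen (m.nu l) k' (m.ξ n 0 ω) - cen (m.nu l) k' (m.ξ l 0 ω)|
          + |cen (m.nu l) k (m.ξ n 0 ω) - cen (m.nu l) k (m.ξ l 0 ω)|) ∂P := by
          refine integral_mono ((((hi' n).sub (hi n)).sub ((hi' l).sub (hi l))).abs) (i2.add i1) fun ω => ?_
          refine le_trans (le_of_eq ?_) (abs_sub _ _)
          congr 1; simp only [Pi.sub_apply]; ring
      _ = _ := integral_add i2 i1
      _ ≤ _ := add_le_add b2 b1
      _ = _ := by ring
  · have j1 : Integrable (fun ω => u1 (m.nu l) k (m.ξ l 0 ω)) P :=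
      integrable_bdd _ _ (hk.bk.u1_meas.comp (m.hξ _ _)) M fun ω => by
        rw [abs_of_nonneg (hk.bk.u1_nonneg _)]; exact hk.bk.u1_le _
    have j2 : Integrable (fun ω => u1 (m.nu l) k' (m.ξ l 0 ω)) P :=
      integrable_bdd _ _ (hk'.bk.u1_meas.comp (m.hξ _ _)) M fun ω => by
        rw [abs_of_nonneg (hk'.bk.u1_nonneg _)]; exact hk'.bk.u1_le _
    have e1 : ∫ ω, u1 (m.nu l) k (m.ξ l 0 ω) ∂P = uu (m.nu l) k := m.int_nu l 0 _ hk.bk.u1_meas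
    have e2 : ∫ ω, u1 (m.nu l) k' (m.ξ l 0 ω) ∂P = uu (m.nu l) k' := m.int_nu l 0 _ hk'.bk.u1_meas
    have hu : ∀ x, u1 (m.nu l) k x ≤ u1 (m.nu l) k' x := fun x =>
      integral_mono (hk.bk.int x) (hk'.bk.int x) (hkk x)
    have hle : uu (m.nu l) k ≤ uu (m.nu l) k' := integral_mono hk.bk.u1_int hk'.bk.u1_int hu
    refine le_trans ?_ hδ
    calc _ ≤ ∫ ω, ((u1 (m.nu l) k' (m.ξ l 0 ω) - u1 (m.nu l) k (m.ξ l 0 ω))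
          + (uu (m.nu l) k' - uu (m.nu l) k)) ∂P := by
          refine integral_mono (((hi' l).sub (hi l)).abs) ((j2.sub j1).add (integrable_const _)) fun ω => ?_
          simp only [cen, Pi.sub_apply]
          have := hu (m.ξ l 0 ω)
          rw [abs_le]; constructor <;> linarith
      _ = _ := by
        have : Integrable (fun ω => u1 (m.nu l) k' (m.ξ l 0 ω) - u1 (m.nu l) k (m.ξ l 0 ω)) P := j2.sub j1
        rw [integral_add this (integrable_const _), integral_sub j2 j1, e1, e2]
        simp; ring

end Repl

lemma quantile_sandwich (U : ℝ → ℝ) (hU : Monotone U) (t0 p u0 η D : ℝ) (hu : 0 < u0) (hη : 0 < η)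
    (hD : 0 ≤ D) (Mm : ℕ)
    (hinc : ∀ i : ℕ, i ≤ 2 * Mm → |U (t0 - Mm * η + i * η) - U t0 - u0 * ((t0 - Mm * η + i * η) - t0)| ≤ D * η)
    (hdev : |U t0 - p| ≤ u0 * (Mm * η / 2)) (hbig : (D / u0 + 3) * η ≤ Mm * η / 2) :
    |sInf {t | p ≤ U t} - t0 + (U t0 - p) / u0| ≤ (D / u0 + 3) * η := by
  set y : ℝ := (U t0 - p) / u0 with hy
  have hyU : u0 * y = U t0 - p := by rw [hy]; field_simp
  have hya : |y| ≤ Mm * η / 2 := by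
    rw [hy, abs_div, abs_of_pos hu, div_le_iff₀ hu]; linarith
  rw [abs_le] at hya
  set r : ℝ := D / u0 with hr
  have hru : u0 * r = D := by rw [hr]; field_simp
  have hr0 : 0 ≤ r := by positivity
  have hrη0 : 0 ≤ r * η := by positivity
  have hD' : u0 * (r * η) = D * η := by rw [← mul_assoc, hru]
  have huη := mul_pos hu hη
  have hMη : 0 ≤ Mm * η := by positivity
  -- upper point
  set a : ℝ := (Mm * η - y + r * η) / η with ha
  have haη : a * η = Mm * η - y + r * η := by rw [ha]; field_simp
  have ha0 : 0 ≤ a := by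
    rw [ha]; apply div_nonneg _ hη.le
    linarith
  have hca : a ≤ (⌈a⌉₊ : ℝ) := Nat.le_ceil a
  have hcb : (⌈a⌉₊ : ℝ) < a + 1 := Nat.ceil_lt_add_one ha0
  have hcM : ⌈a⌉₊ ≤ 2 * Mm := by
    apply Nat.ceil_le.2
    rw [ha, div_le_iff₀ hη]
    push_cast
    linarith
  have hup := hinc _ hcM
  rw [abs_le] at hup
  set g : ℝ := t0 - Mm * η + (⌈a⌉₊ : ℝ) * η with hg
  have hg1 : t0 - y + r * η ≤ g := by
    have := mul_le_mul_of_nonneg_right hca hη.le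
    linarith
  have hg2 : g ≤ t0 - y + r * η + η := by
    have := mul_le_mul_of_nonneg_right hcb.le hη.le
    linarith
  have hgp : p ≤ U g := by
    have := mul_le_mul_of_nonneg_left hg1 hu.le
    linarith
  -- lower point
  set b : ℝ := (Mm * η - y - r * η - η) / η with hb
  have hbη : b * η = Mm * η - y - r * η - η := by rw [hb]; field_simp
  have hb0 : 0 ≤ b := by
    rw [hb]; apply div_nonneg _ hη.le
    linarith
  have hfa : (⌊b⌋₊ : ℝ) ≤ b := Nat.floor_le hb0
  have hfb : b < (⌊b⌋₊ : ℝ) + 1 := Nat.lt_floor_add_one b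
  have hfM : ⌊b⌋₊ ≤ 2 * Mm := by
    have : (⌊b⌋₊ : ℝ) ≤ ((2 * Mm : ℕ) : ℝ) := by
      refine hfa.trans ?_
      rw [hb, div_le_iff₀ hη]
      push_cast
      linarith
    exact_mod_cast this
  have hlo := hinc _ hfM
  rw [abs_le] at hlo
  set g' : ℝ := t0 - Mm * η + (⌊b⌋₊ : ℝ) * η with hg'
  have hg1' : g' ≤ t0 - y - r * η - η := by
    have := mul_le_mul_of_nonneg_right hfa hη.le
    linarith
  have hg2' : t0 - y - r * η - 2 * η ≤ g' := by
    have := mul_le_mul_of_nonneg_right hfb.le hη.le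
    linarith
  have hgp' : U g' < p := by
    have := mul_le_mul_of_nonneg_left hg1' hu.le
    linarith
  have hlb : ∀ t ∈ {t | p ≤ U t}, g' ≤ t := by
    intro t ht
    by_contra hcon
    push Not at hcon
    have h1 := hU hcon.le
    have h2 : p ≤ U t := ht
    linarith
  have s1 : sInf {t | p ≤ U t} ≤ g := csInf_le ⟨g', hlb⟩ hgp
  have s2 : g' ≤ sInf {t | p ≤ U t} := le_csInf ⟨g, hgp⟩ hlb
  rw [abs_le]
  constructor <;> linarith

end UQuantile

namespace UQuantile

section Scale

variable {Ω : Type*} [MeasurableSpace Ω] {P : Measure Ω} [IsProbabilityMeasure P]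
  {X : ℤ → Ω → ℝ}

/-- Kernel at level `t`. -/
abbrev kt (h : ℝ → ℝ → ℝ → ℝ) (t : ℝ) : ℝ → ℝ → ℝ := fun x y => h x y t

structure Ctx (m : Mix P X) (h : ℝ → ℝ → ℝ → ℝ) (M L t0 p u0 δ0 : ℝ) : Prop where
  M1 : 1 ≤ M
  u0pos : 0 < u0
  δ0pos : 0 < δ0
  ker : ∀ t, |t - t0| < δ0 → Ker (P.map (X 0)) (kt h t) M L
  mono : ∀ x y, Monotone (h x y)
  taylor : ∀ t, |t - t0| < δ0 →
    |uu (P.map (X 0)) (kt h t) - p - u0 * (t - t0)| ≤ |t - t0| ^ ((3 : ℝ) / 2)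

/-- Grid points. -/
def gr (t0 : ℝ) (j r i : ℕ) : ℝ :=
  t0 - ((2 ^ (6 * j + r) : ℕ) : ℝ) * (1 / ((2 : ℝ) ^ j) ^ 30) + i * (1 / ((2 : ℝ) ^ j) ^ 30)

lemma gr_mid (t0 : ℝ) (j r : ℕ) : gr t0 j r (2 ^ (6 * j + r)) = t0 := by
  unfold gr; ring

lemma gr_near (t0 : ℝ) (j r i : ℕ) (hr : r ≤ j) (hi : i ≤ 2 ^ (6 * j + r + 1)) :
    |gr t0 j r i - t0| ≤ 1 / ((2 : ℝ) ^ j) ^ 20 := by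
  have hi' : (i : ℝ) ≤ 2 * 2 ^ (6 * j + r) := by
    have : (i : ℝ) ≤ ((2 ^ (6 * j + r + 1) : ℕ) : ℝ) := by exact_mod_cast hi
    refine this.trans (le_of_eq ?_)
    push_cast; rw [pow_succ]; ring
  have hq : (0 : ℝ) < 2 ^ j := by positivity
  have hq1 : (1 : ℝ) ≤ 2 ^ j := one_le_pow₀ (by norm_num)
  have h1 : |gr t0 j r i - t0| ≤ 2 ^ (6 * j + r) * (1 / ((2 : ℝ) ^ j) ^ 30) := by
    have hη : (0 : ℝ) < 1 / ((2 : ℝ) ^ j) ^ 30 := by positivity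
    have := mul_le_mul_of_nonneg_right hi' hη.le
    have h0 : 0 ≤ (i : ℝ) * (1 / ((2 : ℝ) ^ j) ^ 30) := by positivity
    unfold gr
    push_cast
    rw [abs_le]; constructor <;> linarith
  refine h1.trans ?_
  have h2 : (2 : ℝ) ^ (6 * j + r) ≤ (2 ^ j) ^ 7 := by
    rw [← pow_mul]; exact pow_le_pow_right₀ (by norm_num) (by omega)
  calc (2 : ℝ) ^ (6 * j + r) * (1 / ((2 : ℝ) ^ j) ^ 30) ≤ (2 ^ j) ^ 10 * (1 / ((2 : ℝ) ^ j) ^ 30) := by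
        refine mul_le_mul_of_nonneg_right (h2.trans ?_) (by positivity)
        exact pow_le_pow_right₀ hq1 (by norm_num)
    _ = _ := by field_simp

lemma rpow_aux (q : ℝ) (hq : 0 < q) : (1 / q ^ 20) ^ ((3 : ℝ) / 2) = 1 / q ^ 30 := by
  have : 1 / q ^ 20 = (1 / q) ^ (20 : ℝ) := by
    rw [show (20 : ℝ) = ((20 : ℕ) : ℝ) by norm_num, Real.rpow_natCast]; simp
  rw [this, ← Real.rpow_mul (by positivity), show (20 : ℝ) * (3 / 2) = ((30 : ℕ) : ℝ) by norm_num,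
    Real.rpow_natCast]
  simp

variable {m : Mix P X} {h : ℝ → ℝ → ℝ → ℝ} {M L t0 p u0 δ0 : ℝ}

lemma Ctx.uu_near (cx : Ctx m h M L t0 p u0 δ0) (j : ℕ) (hj : 1 / ((2 : ℝ) ^ j) ^ 20 < δ0) (t : ℝ)
    (ht : |t - t0| ≤ 1 / ((2 : ℝ) ^ j) ^ 20) :
    |uu (m.nu ((2 ^ j) ^ 13)) (kt h t) - p - u0 * (t - t0)| ≤ (1 + m.C1 M L) / ((2 : ℝ) ^ j) ^ 30 := by
  have hq : (0 : ℝ) < 2 ^ j := by positivity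
  have hq1 : (1 : ℝ) ≤ 2 ^ j := one_le_pow₀ (by norm_num)
  have hC1 : 0 ≤ m.C1 M L := by linarith [m.C1_pos M L cx.M1]
  have h1 := cx.taylor t (ht.trans_lt hj)
  have h2 : |t - t0| ^ ((3 : ℝ) / 2) ≤ 1 / ((2 : ℝ) ^ j) ^ 30 := by
    rw [← rpow_aux _ hq]
    exact Real.rpow_le_rpow (abs_nonneg _) ht (by norm_num)
  have h3 := m.uu_close (cx.ker t (ht.trans_lt hj)) ((2 ^ j) ^ 13) (Nat.one_le_pow _ _ (by positivity))
  have h4 : m.C1 M L / (((2 ^ j) ^ 13 : ℕ) : ℝ) ^ 3 ≤ m.C1 M L / ((2 : ℝ) ^ j) ^ 30 := by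
    refine div_le_div_of_nonneg_left hC1 (by positivity) ?_
    push_cast
    rw [← pow_mul (2 ^ j : ℝ) 13 3]
    exact pow_le_pow_right₀ hq1 (by norm_num)
  have h5 : (1 + m.C1 M L) / ((2 : ℝ) ^ j) ^ 30 = 1 / ((2 : ℝ) ^ j) ^ 30 + m.C1 M L / ((2 : ℝ) ^ j) ^ 30 := by ring
  rw [h5]
  rw [abs_le] at *
  constructor <;> linarith

lemma Ctx.uu_inc (cx : Ctx m h M L t0 p u0 δ0) (j : ℕ) (hj : 1 / ((2 : ℝ) ^ j) ^ 20 < δ0) (s t : ℝ)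
    (hs : |s - t0| ≤ 1 / ((2 : ℝ) ^ j) ^ 20) (ht : |t - t0| ≤ 1 / ((2 : ℝ) ^ j) ^ 20) :
    |uu (m.nu ((2 ^ j) ^ 13)) (kt h t) - uu (m.nu ((2 ^ j) ^ 13)) (kt h s) - u0 * (t - s)|
      ≤ 2 * (1 + m.C1 M L) / ((2 : ℝ) ^ j) ^ 30 := by
  have h1 := cx.uu_near j hj s hs
  have h2 := cx.uu_near j hj t ht
  have h5 : 2 * (1 + m.C1 M L) / ((2 : ℝ) ^ j) ^ 30 = (1 + m.C1 M L) / ((2 : ℝ) ^ j) ^ 30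
    + (1 + m.C1 M L) / ((2 : ℝ) ^ j) ^ 30 := by ring
  rw [h5]
  rw [abs_le] at *
  constructor <;> linarith

lemma poly_geom (d : ℕ) : ∃ A : ℝ, 0 ≤ A ∧ ∀ n : ℕ, (n : ℝ) ^ d ≤ A * 2 ^ n := by
  have hs : Summable fun n : ℕ => (n : ℝ) ^ d * (1 / 2 : ℝ) ^ n :=
    summable_pow_mul_geometric_of_norm_lt_one d (by norm_num)
  have h0 : ∀ n : ℕ, 0 ≤ (n : ℝ) ^ d * (1 / 2 : ℝ) ^ n := fun n => by positivity
  refine ⟨∑' n : ℕ, (n : ℝ) ^ d * (1 / 2 : ℝ) ^ n, tsum_nonneg h0, fun n => ?_⟩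
  have := hs.le_tsum n fun i _ => h0 i
  have h2 : (0 : ℝ) < 2 ^ n := by positivity
  rw [← div_le_iff₀ h2]
  refine le_trans (le_of_eq ?_) this
  rw [div_eq_mul_inv, one_div, inv_pow]

lemma fourth_bound (z T : ℝ) (hz : z ^ 4 ≤ T) (hT : 0 ≤ T) : z ≤ 1 + T := by
  by_contra hc
  push Not at hc
  have h1 : 1 < z := by linarith
  have h2 : z ≤ z ^ 4 := by
    calc z = z ^ 1 := by ring
      _ ≤ z ^ 4 := pow_le_pow_right₀ h1.le (by norm_num)
  linarith

lemma Mix.bt_scale (m : Mix P X) (Cb : ℝ) (hCb : 0 ≤ Cb) (hb : ∀ k : ℕ, m.bt k ≤ Cb / ((k : ℝ) + 1) ^ 2)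
    (c j : ℕ) (hj1 : 1 ≤ j) :
    ((c * (2 ^ j) ^ 31 : ℕ) : ℝ) * (2 * m.bt ((2 ^ j) ^ 17 - 2 * (2 ^ j) ^ 13))
      ≤ 8 * c * Cb / ((2 : ℝ) ^ j) ^ 3 := by
  have hq2 : (2 : ℝ) ≤ 2 ^ j := by
    calc (2 : ℝ) = 2 ^ 1 := by norm_num
      _ ≤ 2 ^ j := pow_le_pow_right₀ (by norm_num) hj1
  have h1 := hb ((2 ^ j) ^ 17 - 2 * (2 ^ j) ^ 13)
  set q : ℝ := 2 ^ j with hq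
  have hq0 : 0 < q := by linarith
  have h4 : 16 ≤ q ^ 4 := by
    calc (16 : ℝ) = 2 ^ 4 := by norm_num
      _ ≤ q ^ 4 := pow_le_pow_left₀ (by norm_num) hq2 4
  have h17 : q ^ 17 = q ^ 13 * q ^ 4 := by ring
  have h13 : 0 < q ^ 13 := by positivity
  have hge : q ^ 17 / 2 ≤ (((2 ^ j) ^ 17 - 2 * (2 ^ j) ^ 13 : ℕ) : ℝ) + 1 := by
    have : ((2 ^ j) ^ 17 : ℕ) ≤ ((2 ^ j) ^ 17 - 2 * (2 ^ j) ^ 13) + 2 * (2 ^ j) ^ 13 := by omega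
    have h' : (((2 ^ j) ^ 17 : ℕ) : ℝ) ≤ (((2 ^ j) ^ 17 - 2 * (2 ^ j) ^ 13 : ℕ) : ℝ) + ((2 * (2 ^ j) ^ 13 : ℕ) : ℝ) := by
      exact_mod_cast this
    have e1 : (((2 ^ j) ^ 17 : ℕ) : ℝ) = q ^ 17 := by rw [hq]; push_cast; rfl
    have e2 : ((2 * (2 ^ j) ^ 13 : ℕ) : ℝ) = 2 * q ^ 13 := by rw [hq]; push_cast; rfl
    rw [e1, e2] at h'
    nlinarith
  have h2 : m.bt ((2 ^ j) ^ 17 - 2 * (2 ^ j) ^ 13) ≤ Cb / (q ^ 17 / 2) ^ 2 :=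
    h1.trans (div_le_div_of_nonneg_left hCb (by positivity) (pow_le_pow_left₀ (by positivity) hge 2))
  have e3 : ((c * (2 ^ j) ^ 31 : ℕ) : ℝ) = c * q ^ 31 := by rw [hq]; push_cast; rfl
  rw [e3]
  calc c * q ^ 31 * (2 * m.bt ((2 ^ j) ^ 17 - 2 * (2 ^ j) ^ 13))
      ≤ c * q ^ 31 * (2 * (Cb / (q ^ 17 / 2) ^ 2)) := by gcongr
    _ = _ := by field_simp; ring

lemma var_alg (Bn Kn s cv G Cd Γ c q w T : ℝ) (hc : 0 ≤ c) (hcv : 0 ≤ cv) (hCd : 0 ≤ Cd)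
    (hG : G ≤ Cd * Γ) (hB : Bn = c * q ^ 31) (hK : Kn = q ^ 17) (hs : s = w ^ 4 / q ^ 18) (hq : 0 < q)
    (hwY : w ^ 8 * (q ^ 12 * Γ) ≤ T) :
    Bn * (s ^ 2 * (cv * (2 * Kn * G))) ≤ 2 * c * cv * Cd * T := by
  have h1 : Bn * (s ^ 2 * (cv * (2 * Kn * G))) = (2 * c * cv) * (w ^ 8 * q ^ 12) * G := by
    rw [hB, hK, hs]; field_simp
  have hw8 : 0 ≤ w ^ 8 := by positivity
  rw [h1]
  calc (2 * c * cv) * (w ^ 8 * q ^ 12) * G ≤ (2 * c * cv) * (w ^ 8 * q ^ 12) * (Cd * Γ) :=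
        mul_le_mul_of_nonneg_left hG (by positivity)
    _ = (2 * c * cv * Cd) * (w ^ 8 * (q ^ 12 * Γ)) := by ring
    _ ≤ _ := mul_le_mul_of_nonneg_left hwY (by positivity)

set_option maxHeartbeats 1000000 in
lemma Ctx.level (cx : Ctx m h M L t0 p u0 δ0) (ρ : ℕ → ℕ) (Cρ : ℝ) (hCρ : 0 < Cρ) (hρ : ∀ j, ρ j ≤ j)
    (hρb : ∀ j v R, (((2 : ℝ) ^ j) ^ 12 * ∑ r ∈ Finset.range R,
        min ((2 : ℝ) ^ (ρ j) / 2 ^ v / ((2 : ℝ) ^ j) ^ 24) (m.gam r)) ^ 4 ≤ Cρ / 2 ^ (ρ j + v)) :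
    ∃ C : ℝ, 0 ≤ C ∧ ∀ j : ℕ, 1 ≤ j → 1 / ((2 : ℝ) ^ j) ^ 20 < δ0 → 2 * M * (8 * (j : ℝ) + 2) ^ 4 ≤ 2 ^ j →
      ∀ v ≤ 6 * j + ρ j + 1,
      P.real {ω | ∃ c : Fin (2 ^ v), ∃ n ≤ 2 ^ (48 * (j + 1)),
        2 * (((2 : ℝ) ^ j) ^ 18 / ((ρ j : ℝ) + v + 1) ^ 2) + 4 * M * ((2 : ℝ) ^ j) ^ 17 <
        |∑ a ∈ Finset.range n, (cen (m.nu ((2 ^ j) ^ 13)) (kt h (gr t0 j (ρ j) ((c + 1) * 2 ^ (6 * j + ρ j + 1 - v)))) (m.xi ((2 ^ j) ^ 13) ω a)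
          - cen (m.nu ((2 ^ j) ^ 13)) (kt h (gr t0 j (ρ j) (c * 2 ^ (6 * j + ρ j + 1 - v)))) (m.xi ((2 ^ j) ^ 13) ω a))|}
        ≤ C * (2 ^ v * Real.exp (-((ρ j : ℝ) + v + 1) ^ 2) + 1 / ((2 : ℝ) ^ j) ^ 3) := by
  obtain ⟨Cb, hCb, hb⟩ := m.bt_sq
  obtain ⟨A, hA, hAb⟩ := poly_geom 32
  obtain ⟨c47, hc47⟩ : ∃ c : ℕ, c = 2 ^ 47 := ⟨_, rfl⟩
  have hM0 : 0 < M := by linarith [cx.M1]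
  have hC1 : 1 ≤ m.C1 M L := m.C1_pos M L cx.M1
  have hu0 := cx.u0pos
  set Cd : ℝ := 4 * (u0 + 2 * (1 + m.C1 M L)) with hCd
  have hCd1 : 1 ≤ Cd := by rw [hCd]; linarith
  set Cv : ℝ := 2 * c47 * covC (2 * M) (4 * m.C1 M L) * Cd with hCv
  have hcov : 0 ≤ covC (2 * M) (4 * m.C1 M L) := by unfold covC; positivity
  have hCv0 : 0 ≤ Cv := by positivity
  set T : ℝ := 1 + 2 * A * Cρ with hT
  have hT0 : 0 ≤ T := by positivity
  refine ⟨4 * Real.exp (Cv * T) + 32 * c47 * Cb, by positivity, ?_⟩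
  intro j hj1 hjδ hjM v hv
  have hq2 : (2 : ℝ) ≤ 2 ^ j := by
    calc (2 : ℝ) = 2 ^ 1 := by norm_num
      _ ≤ 2 ^ j := pow_le_pow_right₀ (by norm_num) hj1
  have hq2n : 2 ≤ 2 ^ j := by
    calc 2 = 2 ^ 1 := by norm_num
      _ ≤ 2 ^ j := pow_le_pow_right₀ (by norm_num) hj1
  have hqdef : (((2 : ℕ) ^ j : ℕ) : ℝ) = (2 : ℝ) ^ j := by push_cast; rfl
  set q : ℝ := (2 : ℝ) ^ j with hq
  have hq0 : 0 < q := by linarith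
  set w : ℝ := (ρ j : ℝ) + v + 1 with hw
  have hw1 : 1 ≤ w := by
    rw [hw]
    have : (0 : ℝ) ≤ (ρ j : ℝ) + v := by positivity
    linarith
  have hρj : (ρ j : ℝ) ≤ j := by exact_mod_cast hρ j
  have hvj : (v : ℝ) ≤ 6 * j + ρ j + 1 := by exact_mod_cast hv
  have hw8 : w ≤ 8 * j + 2 := by rw [hw]; linarith
  set l : ℕ := (2 ^ j) ^ 13 with hl
  set K : ℕ := (2 ^ j) ^ 17 with hK
  set B : ℕ := c47 * (2 ^ j) ^ 31 with hB
  have hKr : (K : ℝ) = q ^ 17 := by rw [hK]; push_cast; rfl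
  have hBr : (B : ℝ) = c47 * q ^ 31 := by rw [hB]; push_cast; rfl
  have hKB : 2 ^ (48 * (j + 1)) = 2 * K * B := by
    have e48 : 2 ^ 48 = 2 * c47 := by rw [hc47]; norm_num
    rw [hK, hB, show 48 * (j + 1) = j * 48 + 48 by ring, pow_add, pow_mul, e48]; ring
  set mm : ℕ := 6 * j + ρ j + 1 with hmm
  set g : ℕ → ℝ := fun i => gr t0 j (ρ j) i with hg
  set f : Fin (2 ^ v) → ℝ → ℝ := fun c x =>
    cen (m.nu l) (kt h (g ((c + 1) * 2 ^ (mm - v)))) x - cen (m.nu l) (kt h (g (c * 2 ^ (mm - v)))) x with hf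
  have hgn : ∀ i ≤ 2 ^ mm, |g i - t0| ≤ 1 / q ^ 20 := fun i hi => gr_near t0 j (ρ j) i (hρ j) hi
  have hcle : ∀ c ≤ 2 ^ v, c * 2 ^ (mm - v) ≤ 2 ^ mm := by
    intro c hc
    calc c * 2 ^ (mm - v) ≤ 2 ^ v * 2 ^ (mm - v) := Nat.mul_le_mul_right _ hc
      _ = 2 ^ mm := by rw [← pow_add, Nat.add_sub_of_le hv]
  have hstep : ∀ c : ℕ, g ((c + 1) * 2 ^ (mm - v)) - g (c * 2 ^ (mm - v)) = 2 * (2 ^ ρ j / 2 ^ v / q ^ 24) := by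
    intro c
    have e1 : (2 : ℝ) ^ (mm - v) = 2 * (q ^ 6 * 2 ^ ρ j) / 2 ^ v := by
      rw [eq_div_iff (by positivity), ← pow_add, show mm - v + v = j * 6 + ρ j + 1 by omega, pow_succ,
        pow_add, pow_mul]; ring
    simp only [hg, gr]
    push_cast
    rw [e1, ← hq]
    field_simp
    ring
  have hstepge : ∀ c : ℕ, 1 / q ^ 30 ≤ g ((c + 1) * 2 ^ (mm - v)) - g (c * 2 ^ (mm - v)) := by
    intro c
    have e1 : (1 : ℝ) ≤ (2 : ℝ) ^ (mm - v) := one_le_pow₀ (by norm_num)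
    have : g ((c + 1) * 2 ^ (mm - v)) - g (c * 2 ^ (mm - v)) = 2 ^ (mm - v) * (1 / q ^ 30) := by
      simp only [hg, gr]
      push_cast
      ring
    rw [this]
    exact le_mul_of_one_le_left (by positivity) e1
  set δ : ℝ := 2 ^ ρ j / 2 ^ v / q ^ 24 with hδ
  have hδ0 : 0 ≤ δ := by positivity
  have hcen : ∀ c, Cen m l (f c) (2 * M) (4 * m.C1 M L) (Cd * δ) := by
    intro c
    have a1 := hgn _ (hcle (c + 1) c.2)
    have a2 := hgn _ (hcle c c.2.le)
    have hst := hstep c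
    have hsg := hstepge c
    refine m.cen_diff_Cen (cx.ker _ (a2.trans_lt hjδ)) (cx.ker _ (a1.trans_lt hjδ)) ?_ l _ ?_
    · intro x y
      refine cx.mono x y ?_
      have : 0 ≤ 1 / q ^ 30 := by positivity
      linarith
    · have hinc := (abs_le.1 (cx.uu_inc j hjδ _ _ a2 a1)).2
      have e : 2 * (1 + m.C1 M L) / q ^ 30 = 2 * (1 + m.C1 M L) * (1 / q ^ 30) := by ring
      have h3 : 2 * (1 + m.C1 M L) * (1 / q ^ 30) ≤ 2 * (1 + m.C1 M L) * (2 * δ) := by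
        rw [← hst]
        exact mul_le_mul_of_nonneg_left hsg (by positivity)
      rw [e, hst] at hinc
      rw [hCd]
      linarith
  set s : ℝ := w ^ 4 / q ^ 18 with hs
  set x : ℝ := q ^ 18 / w ^ 2 with hx
  have hsx : s * x = w ^ 2 := by
    rw [hs, hx]; field_simp
  have hsK : s * (K * (2 * M)) ≤ 1 := by
    rw [hKr, hs]
    have h4 : w ^ 4 ≤ (8 * (j : ℝ) + 2) ^ 4 := pow_le_pow_left₀ (by linarith) hw8 4
    have : w ^ 4 / q ^ 18 * (q ^ 17 * (2 * M)) = 2 * M * w ^ 4 / q := by field_simp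
    rw [this, div_le_one hq0]
    refine le_trans ?_ hjM
    gcongr
  have h2l : 2 * l ≤ K := by
    rw [hl, hK]
    calc 2 * (2 ^ j) ^ 13 ≤ 2 ^ j * (2 ^ j) ^ 13 := Nat.mul_le_mul_right _ hq2n
      _ = (2 ^ j) ^ 14 := by ring
      _ ≤ (2 ^ j) ^ 17 := Nat.pow_le_pow_right (by omega) (by norm_num)
  have hs0 : 0 ≤ s := by rw [hs]; exact div_nonneg (pow_nonneg (by linarith) 4) (pow_nonneg hq0.le 18)
  have hK1 : 1 ≤ K := Nat.one_le_pow _ _ (Nat.pow_pos (by norm_num))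
  have main := lin_abs m l K f hcen (by linarith) (by linarith) (mul_nonneg (by linarith) hδ0)
    hK1 h2l s x hs0 hsK B
  rw [← hKB] at main
  have hthr : 2 * x + 2 * K * (2 * M) = 2 * (q ^ 18 / w ^ 2) + 4 * M * q ^ 17 := by
    rw [hKr, hx]; ring
  rw [hthr] at main
  refine main.trans ?_
  have hbt : (B : ℝ) * (2 * m.bt (K - 2 * l)) ≤ 8 * c47 * Cb / q ^ 3 := m.bt_scale Cb hCb hb c47 j hj1
  have hY : ∀ R, (q ^ 12 * ∑ r ∈ Finset.range R, min δ (m.gam r)) ^ 4 ≤ Cρ / 2 ^ (ρ j + v) := hρb j v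
  clear main
  clear_value s x B K l δ
  clear_value w q
  clear_value T Cv
  clear_value Cd
  -- variance estimate
  set Γ : ℝ := ∑ r ∈ Finset.range K, min δ (m.gam r) with hΓ
  have hΓ0 : 0 ≤ Γ := Finset.sum_nonneg fun r _ => le_min hδ0 (m.gam_nonneg r)
  have hΓle : ∑ r ∈ Finset.range K, min (Cd * δ) (m.gam r) ≤ Cd * Γ := by
    rw [hΓ, Finset.mul_sum]
    refine Finset.sum_le_sum fun r _ => ?_
    rw [mul_min_of_nonneg _ _ (by linarith)]
    refine min_le_min le_rfl ?_
    exact le_mul_of_one_le_left (m.gam_nonneg r) hCd1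
  have hwY : w ^ 8 * (q ^ 12 * Γ) ≤ T := by
    rw [hT]
    refine fourth_bound _ _ ?_ (by positivity)
    have hA' := hAb (ρ j + v + 1)
    have ew : (((ρ j + v + 1 : ℕ)) : ℝ) = w := by rw [hw]; push_cast; rfl
    rw [ew] at hA'
    calc (w ^ 8 * (q ^ 12 * Γ)) ^ 4 = w ^ 32 * (q ^ 12 * Γ) ^ 4 := by ring
      _ ≤ (A * 2 ^ (ρ j + v + 1)) * (Cρ / 2 ^ (ρ j + v)) := by
          refine mul_le_mul hA' (hY K) (by positivity) (by positivity)
      _ = 2 * A * Cρ := by rw [pow_succ]; field_simp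
  have hvar : (B : ℝ) * (s ^ 2 * (covC (2 * M) (4 * m.C1 M L) *
      (2 * K * ∑ r ∈ Finset.range K, min (Cd * δ) (m.gam r)))) ≤ Cv * T := by
    rw [hCv]
    exact var_alg (B : ℝ) K s _ _ Cd Γ c47 q w T (Nat.cast_nonneg _) hcov (by linarith) hΓle hBr hKr hs hq0 hwY
  have hexp : Real.exp (s ^ 2 * (covC (2 * M) (4 * m.C1 M L) *
      (2 * K * ∑ r ∈ Finset.range K, min (Cd * δ) (m.gam r)))) ^ B ≤ Real.exp (Cv * T) := by
    rw [← Real.exp_nat_mul]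
    exact Real.exp_le_exp.2 hvar
  rw [hsx, Fintype.card_fin]
  have c1 : ((2 ^ v : ℕ) : ℝ) * (Real.exp (-w ^ 2) * Real.exp (s ^ 2 * (covC (2 * M) (4 * m.C1 M L) *
      (2 * K * ∑ r ∈ Finset.range K, min (Cd * δ) (m.gam r)))) ^ B)
      ≤ Real.exp (Cv * T) * (2 ^ v * Real.exp (-w ^ 2)) := by
    have : ((2 ^ v : ℕ) : ℝ) = 2 ^ v := by push_cast; rfl
    rw [this]
    refine (mul_le_mul_of_nonneg_left (mul_le_mul_of_nonneg_left hexp (Real.exp_pos _).le)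
      (pow_nonneg (by norm_num) v)).trans (le_of_eq ?_)
    ring
  have c2 : 8 * c47 * Cb / q ^ 3 = 8 * c47 * Cb * (1 / q ^ 3) := by ring
  have c3 : 0 ≤ Real.exp (Cv * T) * (1 / q ^ 3) := by positivity
  have c4 : 0 ≤ c47 * Cb * (2 ^ v * Real.exp (-w ^ 2)) := by positivity
  rw [c2] at hbt
  linarith

end Scale

end UQuantile

namespace UQuantile

section Scale2

variable {Ω : Type*} [MeasurableSpace Ω] {P : Measure Ω} [IsProbabilityMeasure P]
  {X : ℤ → Ω → ℝ}

variable {m : Mix P X} {h : ℝ → ℝ → ℝ → ℝ} {M L t0 p u0 δ0 : ℝ}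

lemma sum_inv_sq (n : ℕ) : ∑ v ∈ Finset.range n, 1 / ((v : ℝ) + 1) ^ 2 ≤ 2 - 1 / (n : ℝ) := by
  induction n with
  | zero => norm_num
  | succ n ih =>
    rw [Finset.sum_range_succ]
    push_cast
    rcases Nat.eq_zero_or_pos n with rfl | hn
    · norm_num
    · have hn' : (0 : ℝ) < n := by exact_mod_cast hn
      have h1 : 1 / ((n : ℝ) + 1) ^ 2 ≤ 1 / (n : ℝ) - 1 / ((n : ℝ) + 1) := by
        rw [div_sub_div _ _ hn'.ne' (by positivity), div_le_div_iff₀ (by positivity) (by positivity)]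
        nlinarith
      linarith

lemma sum_half (n : ℕ) : ∑ v ∈ Finset.range n, (1 / 2 : ℝ) ^ v ≤ 2 := by
  have := geom_sum_eq (show (1 / 2 : ℝ) ≠ 1 by norm_num) n
  rw [this]
  have h0 : (0 : ℝ) ≤ (1 / 2 : ℝ) ^ n := by positivity
  have : ((1 / 2 : ℝ) ^ n - 1) / (1 / 2 - 1) = 2 - 2 * (1 / 2 : ℝ) ^ n := by ring
  rw [this]
  linarith

lemma exp_lvl (r v : ℕ) : (2 : ℝ) ^ v * Real.exp (-((r : ℝ) + v + 1) ^ 2)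
    ≤ Real.exp 25 * ((1 / 2 : ℝ) ^ (8 * r) * (1 / 2 : ℝ) ^ v) := by
  have h1 : Real.exp (-1) ≤ 1 / 2 := by
    rw [Real.exp_neg, inv_eq_one_div]
    refine one_div_le_one_div_of_le (by norm_num) ?_
    linarith [Real.add_one_le_exp (1 : ℝ)]
  have h2 : Real.exp (-((r : ℝ) + v + 1) ^ 2) ≤ Real.exp 25 * Real.exp (-1) ^ (10 * (r + v + 1)) := by
    rw [← Real.exp_nat_mul, ← Real.exp_add]
    refine Real.exp_le_exp.2 ?_
    push_cast
    nlinarith [sq_nonneg ((r : ℝ) + v + 1 - 5)]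
  have h3 : Real.exp (-1) ^ (10 * (r + v + 1)) ≤ (1 / 2 : ℝ) ^ (10 * (r + v + 1)) :=
    pow_le_pow_left₀ (Real.exp_pos _).le h1 _
  have h4 : (1 / 2 : ℝ) ^ (10 * (r + v + 1)) ≤ (1 / 2 : ℝ) ^ (8 * r + 2 * v) :=
    pow_le_pow_of_le_one (by norm_num) (by norm_num) (by omega)
  calc (2 : ℝ) ^ v * Real.exp (-((r : ℝ) + v + 1) ^ 2)
      ≤ (2 : ℝ) ^ v * (Real.exp 25 * (1 / 2 : ℝ) ^ (8 * r + 2 * v)) := by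
        refine mul_le_mul_of_nonneg_left (h2.trans ?_) (by positivity)
        exact mul_le_mul_of_nonneg_left (h3.trans h4) (Real.exp_pos _).le
    _ = _ := by
        have : (2 : ℝ) ^ v * (1 / 2 : ℝ) ^ v = 1 := by rw [← mul_pow]; norm_num
        rw [pow_add, show 2 * v = v + v by ring, pow_add]
        calc _ = Real.exp 25 * ((1 / 2 : ℝ) ^ (8 * r) * (1 / 2 : ℝ) ^ v) * ((2 : ℝ) ^ v * (1 / 2 : ℝ) ^ v) := by ring
          _ = _ := by rw [this, mul_one]

lemma lam_sum (q M : ℝ) (j r : ℕ) (hq0 : 0 < q) (hM1 : 1 ≤ M) (hr : r ≤ j)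
    (hjM : 2 * M * (8 * (j : ℝ) + 2) ^ 4 ≤ q) :
    ∑ v ∈ Finset.range (6 * j + r + 1 + 1),
        (2 * (q ^ 18 / ((r : ℝ) + v + 1) ^ 2) + 4 * M * q ^ 17) ≤ 6 * q ^ 18 := by
  have hρj : (r : ℝ) ≤ j := by exact_mod_cast hr
  rw [Finset.sum_add_distrib, Finset.sum_const, Finset.card_range, nsmul_eq_mul]
  have s1 : ∑ v ∈ Finset.range (6 * j + r + 1 + 1), 2 * (q ^ 18 / ((r : ℝ) + v + 1) ^ 2)
      ≤ 2 * q ^ 18 * 2 := by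
    calc _ ≤ ∑ v ∈ Finset.range (6 * j + r + 1 + 1), 2 * q ^ 18 * (1 / ((v : ℝ) + 1) ^ 2) := by
          refine Finset.sum_le_sum fun v _ => ?_
          rw [mul_assoc, mul_one_div]
          refine mul_le_mul_of_nonneg_left ?_ (by norm_num)
          refine div_le_div_of_nonneg_left (by positivity) (by positivity) ?_
          refine pow_le_pow_left₀ (by positivity) ?_ 2
          have : (0 : ℝ) ≤ r := by positivity
          linarith
      _ ≤ _ := by
          rw [← Finset.mul_sum]
          refine mul_le_mul_of_nonneg_left ?_ (by positivity)
          refine (sum_inv_sq _).trans ?_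
          have : (0 : ℝ) ≤ 1 / (((6 * j + r + 1 + 1 : ℕ) : ℝ)) := by positivity
          linarith
  have s2 : ((6 * j + r + 1 + 1 : ℕ) : ℝ) * (4 * M * q ^ 17) ≤ 2 * q ^ 18 := by
    have b1 : ((6 * j + r + 1 + 1 : ℕ) : ℝ) ≤ 8 * (j : ℝ) + 2 := by push_cast; linarith
    have b2 : 8 * (j : ℝ) + 2 ≤ (8 * (j : ℝ) + 2) ^ 4 := by
      refine le_self_pow₀ ?_ (by norm_num)
      have : (0 : ℝ) ≤ j := by positivity
      linarith
    have b3 : 2 * M * ((6 * j + r + 1 + 1 : ℕ) : ℝ) ≤ q :=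
      (mul_le_mul_of_nonneg_left (b1.trans b2) (by linarith)).trans hjM
    calc _ = (2 * M * ((6 * j + r + 1 + 1 : ℕ) : ℝ)) * (2 * q ^ 17) := by ring
      _ ≤ q * (2 * q ^ 17) := mul_le_mul_of_nonneg_right b3 (by positivity)
      _ = _ := by ring
  linarith

lemma Ctx.lin_inc (cx : Ctx m h M L t0 p u0 δ0) (ρ : ℕ → ℕ) (Cρ : ℝ) (hCρ : 0 < Cρ) (hρ : ∀ j, ρ j ≤ j)
    (hρb : ∀ j v R, (((2 : ℝ) ^ j) ^ 12 * ∑ r ∈ Finset.range R,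
        min ((2 : ℝ) ^ (ρ j) / 2 ^ v / ((2 : ℝ) ^ j) ^ 24) (m.gam r)) ^ 4 ≤ Cρ / 2 ^ (ρ j + v)) :
    ∃ C : ℝ, 0 ≤ C ∧ ∀ j : ℕ, 1 ≤ j → 1 / ((2 : ℝ) ^ j) ^ 20 < δ0 → 2 * M * (8 * (j : ℝ) + 2) ^ 4 ≤ 2 ^ j →
      P.real {ω | ∃ i ≤ 2 ^ (6 * j + ρ j + 1), ∃ n ≤ 2 ^ (48 * (j + 1)),
        12 * ((2 : ℝ) ^ j) ^ 18 <
        |∑ a ∈ Finset.range n, cen (m.nu ((2 ^ j) ^ 13)) (kt h (gr t0 j (ρ j) i)) (m.xi ((2 ^ j) ^ 13) ω a)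
          - ∑ a ∈ Finset.range n, cen (m.nu ((2 ^ j) ^ 13)) (kt h t0) (m.xi ((2 ^ j) ^ 13) ω a)|}
        ≤ C * ((1 / 2 : ℝ) ^ (8 * ρ j) + ((j : ℝ) + 1) / ((2 : ℝ) ^ j) ^ 3) := by
  obtain ⟨C, hC, hlev⟩ := cx.level ρ Cρ hCρ hρ hρb
  have hM1 := cx.M1
  refine ⟨C * (2 * Real.exp 25 + 8), by positivity, ?_⟩
  intro j hj1 hjδ hjM
  have hl := hlev j hj1 hjδ hjM
  clear hlev
  set E : ℕ → Set Ω := fun v => {ω | ∃ c : Fin (2 ^ v), ∃ n ≤ 2 ^ (48 * (j + 1)),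
        2 * (((2 : ℝ) ^ j) ^ 18 / ((ρ j : ℝ) + v + 1) ^ 2) + 4 * M * ((2 : ℝ) ^ j) ^ 17 <
        |∑ a ∈ Finset.range n, (cen (m.nu ((2 ^ j) ^ 13)) (kt h (gr t0 j (ρ j) ((c + 1) * 2 ^ (6 * j + ρ j + 1 - v)))) (m.xi ((2 ^ j) ^ 13) ω a)
          - cen (m.nu ((2 ^ j) ^ 13)) (kt h (gr t0 j (ρ j) (c * 2 ^ (6 * j + ρ j + 1 - v)))) (m.xi ((2 ^ j) ^ 13) ω a))|} with hE
  have hρj : (ρ j : ℝ) ≤ j := by exact_mod_cast hρ j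
  have hq0 : (0 : ℝ) < 2 ^ j := by positivity
  have hsub : {ω | ∃ i ≤ 2 ^ (6 * j + ρ j + 1), ∃ n ≤ 2 ^ (48 * (j + 1)),
        12 * ((2 : ℝ) ^ j) ^ 18 <
        |∑ a ∈ Finset.range n, cen (m.nu ((2 ^ j) ^ 13)) (kt h (gr t0 j (ρ j) i)) (m.xi ((2 ^ j) ^ 13) ω a)
          - ∑ a ∈ Finset.range n, cen (m.nu ((2 ^ j) ^ 13)) (kt h t0) (m.xi ((2 ^ j) ^ 13) ω a)|}
      ⊆ ⋃ v ∈ Finset.range (6 * j + ρ j + 1 + 1), E v := by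
    intro ω hω
    obtain ⟨i, hi, n, hn, hlt⟩ := hω
    by_contra hcon
    simp only [mem_iUnion, not_exists] at hcon
    set f : ℕ → ℝ := fun i => ∑ a ∈ Finset.range n, cen (m.nu ((2 ^ j) ^ 13)) (kt h (gr t0 j (ρ j) i)) (m.xi ((2 ^ j) ^ 13) ω a) with hf
    have hch := dyadic_chain f (6 * j + ρ j + 1)
      (fun v => 2 * (((2 : ℝ) ^ j) ^ 18 / ((ρ j : ℝ) + v + 1) ^ 2) + 4 * M * ((2 : ℝ) ^ j) ^ 17) (by
        intro v hv c hc
        have hv' := hcon v (Finset.mem_range.2 (by omega))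
        by_contra hbad
        refine hv' ⟨⟨c, hc⟩, n, hn, ?_⟩
        rw [Finset.sum_sub_distrib]
        exact not_le.1 hbad)
    have hsum : ∑ v ∈ Finset.range (6 * j + ρ j + 1 + 1),
        (2 * (((2 : ℝ) ^ j) ^ 18 / ((ρ j : ℝ) + v + 1) ^ 2) + 4 * M * ((2 : ℝ) ^ j) ^ 17) ≤ 6 * ((2 : ℝ) ^ j) ^ 18 := by
      exact lam_sum ((2 : ℝ) ^ j) M j (ρ j) hq0 hM1 (hρ j) hjM
    have hi1 := (hch i hi).trans hsum
    have hi2 := (hch (2 ^ (6 * j + ρ j)) (Nat.pow_le_pow_right (by norm_num) (by omega))).trans hsum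
    have hmid : f (2 ^ (6 * j + ρ j)) = ∑ a ∈ Finset.range n, cen (m.nu ((2 ^ j) ^ 13)) (kt h t0) (m.xi ((2 ^ j) ^ 13) ω a) := by
      simp only [hf, gr_mid]
    rw [← hmid] at hlt
    change 12 * ((2 : ℝ) ^ j) ^ 18 < |f i - f (2 ^ (6 * j + ρ j))| at hlt
    have := abs_sub_le (f i) (f 0) (f (2 ^ (6 * j + ρ j)))
    rw [abs_sub_comm (f 0)] at this
    linarith
  refine (measureReal_mono hsub (measure_ne_top _ _)).trans ?_
  refine (measureReal_biUnion_finset_le _ _).trans ?_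
  calc ∑ v ∈ Finset.range (6 * j + ρ j + 1 + 1), P.real (E v)
      ≤ ∑ v ∈ Finset.range (6 * j + ρ j + 1 + 1), C * (Real.exp 25 * ((1 / 2 : ℝ) ^ (8 * ρ j) * (1 / 2 : ℝ) ^ v) + 1 / ((2 : ℝ) ^ j) ^ 3) := by
        refine Finset.sum_le_sum fun v hv => ?_
        refine (hl v (by have := Finset.mem_range.1 hv; omega)).trans ?_
        exact mul_le_mul_of_nonneg_left (add_le_add_left (exp_lvl _ _) _) hC
    _ = C * (Real.exp 25 * (1 / 2 : ℝ) ^ (8 * ρ j) * ∑ v ∈ Finset.range (6 * j + ρ j + 1 + 1), (1 / 2 : ℝ) ^ v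
          + ((6 * j + ρ j + 1 + 1 : ℕ) : ℝ) * (1 / ((2 : ℝ) ^ j) ^ 3)) := by
        rw [← Finset.mul_sum, Finset.sum_add_distrib, Finset.sum_const, Finset.card_range, nsmul_eq_mul,
          Finset.mul_sum]
        simp only [mul_assoc]
    _ ≤ C * (Real.exp 25 * (1 / 2 : ℝ) ^ (8 * ρ j) * 2 + (8 * ((j : ℝ) + 1)) * (1 / ((2 : ℝ) ^ j) ^ 3)) := by
        refine mul_le_mul_of_nonneg_left (add_le_add ?_ ?_) hC
        · exact mul_le_mul_of_nonneg_left (sum_half _) (by positivity)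
        · refine mul_le_mul_of_nonneg_right ?_ (by positivity)
          push_cast; linarith
    _ ≤ _ := by
        have a1 : 0 ≤ C * Real.exp 25 * (((j : ℝ) + 1) / ((2 : ℝ) ^ j) ^ 3) := by positivity
        have a2 : 0 ≤ C * (1 / 2 : ℝ) ^ (8 * ρ j) := by positivity
        have e : (8 * ((j : ℝ) + 1)) * (1 / ((2 : ℝ) ^ j) ^ 3) = 8 * (((j : ℝ) + 1) / ((2 : ℝ) ^ j) ^ 3) := by ring
        rw [e]
        nlinarith

end Scale2

end UQuantile

namespace UQuantile

section Scale3

variable {Ω : Type*} [MeasurableSpace Ω] {P : Measure Ω} [IsProbabilityMeasure P]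
  {X : ℤ → Ω → ℝ}

variable {m : Mix P X} {h : ℝ → ℝ → ℝ → ℝ} {M L t0 p u0 δ0 : ℝ}

lemma var_alg2 (Bn Kn s cv G S c q : ℝ) (hc : 0 ≤ c) (hcv : 0 ≤ cv)
    (hG : G ≤ S) (hB : Bn = c * q ^ 31) (hK : Kn = q ^ 17) (hs : s = 1 / q ^ 24) (hq : 0 < q) :
    Bn * (s ^ 2 * (cv * (2 * Kn * G))) ≤ 2 * c * cv * S := by
  have h1 : Bn * (s ^ 2 * (cv * (2 * Kn * G))) = (2 * c * cv) * G := by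
    rw [hB, hK, hs]; field_simp
  rw [h1]
  exact mul_le_mul_of_nonneg_left hG (by positivity)

lemma exp_dev (b : ℝ) (hb : 0 < b) (r : ℕ) :
    Real.exp (-(b * 2 ^ r)) ≤ (40320 / b ^ 8) * (1 / 2 : ℝ) ^ (8 * r) := by
  have h1 := Real.pow_div_factorial_le_exp (b * 2 ^ r) (by positivity) 8
  have e : (Nat.factorial 8 : ℝ) = 40320 := by norm_num [Nat.factorial]
  rw [e] at h1
  have h0 : (0 : ℝ) < (b * 2 ^ r) ^ 8 / 40320 := by positivity
  rw [Real.exp_neg, inv_eq_one_div]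
  refine (one_div_le_one_div_of_le h0 h1).trans (le_of_eq ?_)
  rw [mul_comm 8 r, pow_mul, mul_pow, one_div_pow, one_div_pow]
  field_simp

lemma two_le_q {j : ℕ} (hj : 1 ≤ j) : (2 : ℝ) ≤ 2 ^ j := by
  calc (2 : ℝ) = 2 ^ 1 := by norm_num
    _ ≤ 2 ^ j := pow_le_pow_right₀ (by norm_num) hj

lemma two_le_qn {j : ℕ} (hj : 1 ≤ j) : 2 ≤ 2 ^ j := by
  calc 2 = 2 ^ 1 := by norm_num
    _ ≤ 2 ^ j := pow_le_pow_right₀ (by norm_num) hj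

set_option maxHeartbeats 400000 in
lemma Ctx.dev (cx : Ctx m h M L t0 p u0 δ0) :
    ∃ C : ℝ, 0 ≤ C ∧ ∀ j : ℕ, 1 ≤ j → M ≤ 2 ^ j → ∀ r : ℕ,
      P.real {ω | ∃ n ≤ 2 ^ (48 * (j + 1)),
        2 * ((u0 / 16) * 2 ^ r * ((2 : ℝ) ^ j) ^ 24) + 2 * M * ((2 : ℝ) ^ j) ^ 17 <
        |∑ a ∈ Finset.range n, cen (m.nu ((2 ^ j) ^ 13)) (kt h t0) (m.xi ((2 ^ j) ^ 13) ω a)|}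
        ≤ C * ((1 / 2 : ℝ) ^ (8 * r) + 1 / ((2 : ℝ) ^ j) ^ 3) := by
  obtain ⟨Cb, hCb, hb⟩ := m.bt_sq
  obtain ⟨S, hS, hSb⟩ := m.gam_bdd
  obtain ⟨c47, hc47⟩ : ∃ c : ℕ, c = 2 ^ 47 := ⟨_, rfl⟩
  have hM0 : 0 ≤ M := by linarith [cx.M1]
  have hC1 : 1 ≤ m.C1 M L := m.C1_pos M L cx.M1
  have hu0 := cx.u0pos
  have hcov : 0 ≤ covC M (2 * m.C1 M L) := by unfold covC; positivity
  obtain ⟨V, hV⟩ : ∃ V, V = Real.exp (2 * c47 * covC M (2 * m.C1 M L) * S) := ⟨_, rfl⟩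
  have hV0 : 0 < V := by rw [hV]; exact Real.exp_pos _
  obtain ⟨b, hbd⟩ : ∃ b, b = u0 / 16 := ⟨_, rfl⟩
  have hb0 : 0 < b := by rw [hbd]; positivity
  refine ⟨4 * (40320 / b ^ 8 * V) + 32 * c47 * Cb, by positivity, ?_⟩
  intro j hj1 hjM r
  rw [← hbd]
  have hq2n := two_le_qn hj1
  obtain ⟨q, hq⟩ : ∃ q : ℝ, q = (2 : ℝ) ^ j := ⟨_, rfl⟩
  have hq2 : 2 ≤ q := by rw [hq]; exact two_le_q hj1
  have hq0 : 0 < q := by linarith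
  have hbt := m.bt_scale Cb hCb hb c47 j hj1
  obtain ⟨l, hl⟩ : ∃ l : ℕ, l = (2 ^ j) ^ 13 := ⟨_, rfl⟩
  obtain ⟨K, hK⟩ : ∃ l : ℕ, l = (2 ^ j) ^ 17 := ⟨_, rfl⟩
  obtain ⟨B, hB⟩ : ∃ l : ℕ, l = c47 * (2 ^ j) ^ 31 := ⟨_, rfl⟩
  have hKr : (K : ℝ) = q ^ 17 := by rw [hK, hq]; push_cast; rfl
  have hBr : (B : ℝ) = c47 * q ^ 31 := by rw [hB, hq]; push_cast; rfl
  have hKB : 2 ^ (48 * (j + 1)) = 2 * K * B := by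
    have e48 : 2 ^ 48 = 2 * c47 := by rw [hc47]; norm_num
    rw [hK, hB, show 48 * (j + 1) = j * 48 + 48 by ring, pow_add, pow_mul, e48]; ring
  have h2l : 2 * l ≤ K := by
    rw [hl, hK]
    calc 2 * (2 ^ j) ^ 13 ≤ 2 ^ j * (2 ^ j) ^ 13 := Nat.mul_le_mul_right _ hq2n
      _ = (2 ^ j) ^ 14 := by ring
      _ ≤ (2 ^ j) ^ 17 := Nat.pow_le_pow_right (by omega) (by norm_num)
  have hK1 : 1 ≤ K := by rw [hK]; exact Nat.one_le_pow _ _ (Nat.pow_pos (by norm_num))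
  rw [← hl, ← hK, ← hB, ← hq] at hbt
  rw [← hl, ← hq, hKB]
  rw [← hq] at hjM
  have hsK : 1 / q ^ 24 * (K * M) ≤ 1 := by
    rw [hKr, one_div_mul_eq_div, div_le_one (by positivity)]
    calc q ^ 17 * M ≤ q ^ 17 * q := mul_le_mul_of_nonneg_left hjM (by positivity)
      _ = q ^ 18 := by ring
      _ ≤ q ^ 24 := pow_le_pow_right₀ (by linarith) (by norm_num)
  have hC : Cen m l (cen (m.nu l) (kt h t0)) M (2 * m.C1 M L) M :=
    m.cen_Cen (cx.ker t0 (by rw [sub_self, abs_zero]; exact cx.δ0pos)) l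
  have main := lin_abs m l K (fun _ : Unit => cen (m.nu l) (kt h t0)) (fun _ => hC) hM0
    (by linarith) hM0 hK1 h2l (1 / q ^ 24) (b * 2 ^ r * q ^ 24) (by positivity) hsK B
  have hsx : 1 / q ^ 24 * (b * 2 ^ r * q ^ 24) = b * 2 ^ r := by field_simp
  rw [hsx] at main
  have hvar := var_alg2 (B : ℝ) K (1 / q ^ 24) (covC M (2 * m.C1 M L))
    (∑ r ∈ Finset.range K, min M (m.gam r)) S c47 q (Nat.cast_nonneg _) hcov
    ((Finset.sum_le_sum fun r _ => min_le_right _ _).trans (hSb K)) hBr hKr rfl hq0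
  have hexp := Real.exp_le_exp.2 hvar
  rw [Real.exp_nat_mul, ← hV] at hexp
  have hset : {ω | ∃ n ≤ 2 * K * B, 2 * (b * 2 ^ r * q ^ 24) + 2 * M * q ^ 17 <
        |∑ a ∈ Finset.range n, cen (m.nu l) (kt h t0) (m.xi l ω a)|} ⊆
      {ω | ∃ _e : Unit, ∃ n ≤ 2 * K * B, 2 * (b * 2 ^ r * q ^ 24) + 2 * K * M <
        |∑ a ∈ Finset.range n, cen (m.nu l) (kt h t0) (m.xi l ω a)|} := by
    rintro ω ⟨n, hn, hlt⟩
    refine ⟨(), n, hn, ?_⟩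
    rw [hKr]
    linarith
  refine (measureReal_mono hset (measure_ne_top _ _)).trans (main.trans ?_)
  have he := exp_dev b hb0 r
  have hp := mul_le_mul he hexp (pow_nonneg (Real.exp_pos _).le _) (by positivity)
  rw [Fintype.card_unit, Nat.cast_one, one_mul]
  have a1 : 0 ≤ 40320 / b ^ 8 * V * (1 / q ^ 3) := by positivity
  have a2 : 0 ≤ c47 * Cb * (1 / 2 : ℝ) ^ (8 * r) := by positivity
  have a3 : 8 * c47 * Cb / q ^ 3 = 8 * c47 * Cb * (1 / q ^ 3) := by ring
  rw [a3] at hbt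
  have hadd := add_le_add hp hbt
  linarith

lemma grid_card (j r : ℕ) (hr : r ≤ j) : ((2 ^ (6 * j + r + 1) + 1 : ℕ) : ℝ) ≤ 3 * ((2 : ℝ) ^ j) ^ 7 := by
  have h1 : (2 : ℝ) ^ (6 * j + r) ≤ (2 ^ j) ^ 7 := by
    rw [← pow_mul]; exact pow_le_pow_right₀ (by norm_num) (by omega)
  have h2 : (1 : ℝ) ≤ (2 ^ j) ^ 7 := one_le_pow₀ (one_le_pow₀ (by norm_num))
  push_cast
  rw [pow_succ]
  linarith

/-- Union bound over the grid. -/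
lemma grid_union (P : Measure Ω) [IsProbabilityMeasure P] (N : ℕ) (F : ℕ → Ω → Prop) (b : ℝ)
    (hb : ∀ i ≤ N, P.real {ω | F i ω} ≤ b) :
    P.real {ω | ∃ i ≤ N, F i ω} ≤ ((N + 1 : ℕ) : ℝ) * b := by
  have hsub : {ω | ∃ i ≤ N, F i ω} ⊆ ⋃ i ∈ Finset.range (N + 1), {ω | F i ω} := by
    rintro ω ⟨i, hi, hF⟩
    simp only [mem_iUnion]
    exact ⟨i, Finset.mem_range.2 (by omega), hF⟩
  refine (measureReal_mono hsub (measure_ne_top _ _)).trans ?_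
  refine (measureReal_biUnion_finset_le _ _).trans ?_
  refine (Finset.sum_le_sum fun i hi => hb i (by have := Finset.mem_range.1 hi; omega)).trans ?_
  rw [Finset.sum_const, Finset.card_range, nsmul_eq_mul]

lemma degen_alg (M Cb q J c : ℝ) (hq : 2 ≤ q) (hJ : 0 ≤ J) (hCb : 0 ≤ Cb) :
    3 * q ^ 7 * (16 * M ^ 2 * (Cb + 1) * 8 * (2 * q ^ 13 + 1) ^ 2 * (49 * J) ^ 5 * (c * q ^ 48) ^ 2 / (q ^ 66) ^ 2)
      ≤ 3 * (16 * M ^ 2 * (Cb + 1) * 8 * 9 * 49 ^ 5 * c ^ 2) * (J ^ 5 / q ^ 3) := by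
  have hq0 : 0 < q := by linarith
  have h1 : (2 * q ^ 13 + 1) ^ 2 ≤ 9 * q ^ 26 := by
    have : (1 : ℝ) ≤ q ^ 13 := one_le_pow₀ (by linarith)
    calc (2 * q ^ 13 + 1) ^ 2 ≤ (3 * q ^ 13) ^ 2 := pow_le_pow_left₀ (by positivity) (by linarith) 2
      _ = _ := by ring
  have e : 3 * q ^ 7 * (16 * M ^ 2 * (Cb + 1) * 8 * (2 * q ^ 13 + 1) ^ 2 * (49 * J) ^ 5 * (c * q ^ 48) ^ 2 / (q ^ 66) ^ 2)
     = (3 * (16 * M ^ 2 * (Cb + 1) * 8 * 49 ^ 5 * c ^ 2) * J ^ 5 / q ^ 29) * (2 * q ^ 13 + 1) ^ 2 := by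
    field_simp
  rw [e]
  refine (mul_le_mul_of_nonneg_left h1 (by positivity)).trans (le_of_eq ?_)
  field_simp

lemma Ctx.degen (cx : Ctx m h M L t0 p u0 δ0) :
    ∃ C : ℝ, 0 ≤ C ∧ ∀ j : ℕ, 1 ≤ j → 1 / ((2 : ℝ) ^ j) ^ 20 < δ0 → ∀ r ≤ j,
      P.real {ω | ∃ i ≤ 2 ^ (6 * j + r + 1), ∃ n ≤ 2 ^ (48 * (j + 1)),
        ((2 : ℝ) ^ j) ^ 66 <
        |pairSum (deg (m.nu ((2 ^ j) ^ 13)) (kt h (gr t0 j r i))) (m.xi ((2 ^ j) ^ 13) ω) n|}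
        ≤ C * (((j : ℝ) + 1) ^ 5 / ((2 : ℝ) ^ j) ^ 3) := by
  obtain ⟨Cb, hCb, hb⟩ := m.bt_sq
  obtain ⟨c, hc⟩ : ∃ c : ℝ, c = 2 ^ 48 := ⟨_, rfl⟩
  refine ⟨3 * (16 * M ^ 2 * (Cb + 1) * 8 * 9 * 49 ^ 5 * c ^ 2), by positivity, ?_⟩
  intro j hj1 hjδ r hr
  refine le_trans ?_ (degen_alg M Cb ((2 : ℝ) ^ j) ((j : ℝ) + 1) c (two_le_q hj1) (by positivity) hCb)
  refine (grid_union P (2 ^ (6 * j + r + 1)) (fun i ω => ∃ n ≤ 2 ^ (48 * (j + 1)),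
        ((2 : ℝ) ^ j) ^ 66 <
        |pairSum (deg (m.nu ((2 ^ j) ^ 13)) (kt h (gr t0 j r i))) (m.xi ((2 ^ j) ^ 13) ω) n|) _ ?_).trans
      (mul_le_mul_of_nonneg_right (grid_card j r hr) ?_)
  · intro i hi
    have hk := (cx.ker _ ((gr_near t0 j r i hr hi).trans_lt hjδ)).bk
    refine (m.deg_chain hk Cb hCb hb ((2 ^ j) ^ 13) (48 * (j + 1)) (((2 : ℝ) ^ j) ^ 66) (by positivity)).trans ?_
    have e1 : (2 : ℝ) ^ (48 * (j + 1)) = c * ((2 : ℝ) ^ j) ^ 48 := by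
      rw [hc, show 48 * (j + 1) = j * 48 + 48 by ring, pow_add, pow_mul]; ring
    have e2 : ((((2 ^ j) ^ 13 : ℕ)) : ℝ) = ((2 : ℝ) ^ j) ^ 13 := by push_cast; rfl
    have e3 : (((48 * (j + 1) : ℕ) : ℝ) + 1) ≤ 49 * ((j : ℝ) + 1) := by
      push_cast
      have : (0 : ℝ) ≤ j := Nat.cast_nonneg _
      linarith
    rw [e1, e2]
    refine div_le_div_of_nonneg_right ?_ (by positivity)
    refine mul_le_mul_of_nonneg_right ?_ (by positivity)
    refine mul_le_mul_of_nonneg_left ?_ (by positivity)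
    exact pow_le_pow_left₀ (by positivity) e3 5
  · positivity

lemma repl_alg (q C1 S c : ℝ) (hq : 2 ≤ q) (hC1 : 0 ≤ C1) (hS : 0 ≤ S) (hc : 0 ≤ c) :
    3 * q ^ 7 * ((c * q ^ 48) * (C1 * (S + c * q ^ 48 / (q ^ 13) ^ 3)) / q ^ 66)
      ≤ 3 * c * C1 * (S + c) * (1 / q ^ 2) := by
  have hq0 : 0 < q := by linarith
  have h1 : 1 / q ^ 11 ≤ 1 / q ^ 2 :=
    one_div_le_one_div_of_le (by positivity) (pow_le_pow_right₀ (by linarith) (by norm_num))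
  have e : 3 * q ^ 7 * ((c * q ^ 48) * (C1 * (S + c * q ^ 48 / (q ^ 13) ^ 3)) / q ^ 66)
      = 3 * c * C1 * S * (1 / q ^ 11) + 3 * c * C1 * c * (1 / q ^ 2) := by
    field_simp
  rw [e]
  have := mul_le_mul_of_nonneg_left h1 (show 0 ≤ 3 * c * C1 * S by positivity)
  linarith

lemma Ctx.repl (cx : Ctx m h M L t0 p u0 δ0) :
    ∃ C : ℝ, 0 ≤ C ∧ ∀ j : ℕ, 1 ≤ j → 1 / ((2 : ℝ) ^ j) ^ 20 < δ0 → ∀ r ≤ j,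
      P.real {ω | ∃ i ≤ 2 ^ (6 * j + r + 1), ∃ n ≤ 2 ^ (48 * (j + 1)),
        (1 + 2 ^ 49 * M) * ((2 : ℝ) ^ j) ^ 66 <
        |pairSum (kt h (gr t0 j r i)) (xs X ω) n - pairSum (kt h (gr t0 j r i)) (m.xi ((2 ^ j) ^ 13) ω) n|}
        ≤ C * (1 / ((2 : ℝ) ^ j) ^ 2) := by
  obtain ⟨S, hS, hSb⟩ := m.bt_bdd
  obtain ⟨c, hc⟩ : ∃ c : ℝ, c = 2 ^ 48 := ⟨_, rfl⟩
  have hc0 : 0 ≤ c := by rw [hc]; positivity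
  have hM0 : 0 ≤ M := by linarith [cx.M1]
  have hC1 : 1 ≤ m.C1 M L := m.C1_pos M L cx.M1
  refine ⟨3 * c * m.C1 M L * (S + c), by positivity, ?_⟩
  intro j hj1 hjδ r hr
  have e49 : (2 : ℝ) ^ 49 = 2 * c := by rw [hc]; norm_num
  rw [e49]
  have hq2 := two_le_q hj1
  refine le_trans ?_ (repl_alg ((2 : ℝ) ^ j) (m.C1 M L) S c hq2 (by linarith) hS hc0)
  refine (grid_union P (2 ^ (6 * j + r + 1)) (fun i ω => ∃ n ≤ 2 ^ (48 * (j + 1)),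
        (1 + 2 * c * M) * ((2 : ℝ) ^ j) ^ 66 <
        |pairSum (kt h (gr t0 j r i)) (xs X ω) n - pairSum (kt h (gr t0 j r i)) (m.xi ((2 ^ j) ^ 13) ω) n|) _ ?_).trans
      (mul_le_mul_of_nonneg_right (grid_card j r hr) ?_)
  · intro i hi
    have hk := cx.ker _ ((gr_near t0 j r i hr hi).trans_lt hjδ)
    have hq0 : (0 : ℝ) < 2 ^ j := by positivity
    have main := m.replace hk S hSb ((2 ^ j) ^ 13) (Nat.one_le_pow _ _ (Nat.pow_pos (by norm_num)))
      (2 ^ (48 * (j + 1))) (((2 : ℝ) ^ j) ^ 66) (by positivity)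
    have e1 : ((2 ^ (48 * (j + 1)) : ℕ) : ℝ) = c * ((2 : ℝ) ^ j) ^ 48 := by
      push_cast
      rw [hc, show 48 * (j + 1) = j * 48 + 48 by ring, pow_add, pow_mul]; ring
    have e2 : ((((2 ^ j) ^ 13 : ℕ)) : ℝ) = ((2 : ℝ) ^ j) ^ 13 := by push_cast; rfl
    rw [e1, e2] at main
    refine le_trans (measureReal_mono ?_ (measure_ne_top _ _)) main
    rintro ω ⟨n, hn, hlt⟩
    refine ⟨n, hn, lt_of_le_of_lt ?_ hlt⟩
    have hp : ((2 : ℝ) ^ j) ^ 61 ≤ ((2 : ℝ) ^ j) ^ 66 := pow_le_pow_right₀ (by linarith) (by norm_num)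
    have hp2 := mul_le_mul_of_nonneg_left hp (show 0 ≤ 2 * c * M by positivity)
    have e3 : c * ((2 : ℝ) ^ j) ^ 48 * (2 * ((2 : ℝ) ^ j) ^ 13 * M) = 2 * c * M * ((2 : ℝ) ^ j) ^ 61 := by ring
    rw [e3]
    linarith
  · positivity

end Scale3

end UQuantile

namespace UQuantile

section Combine

variable {Ω : Type*} [MeasurableSpace Ω] {P : Measure Ω} [IsProbabilityMeasure P]
  {X : ℤ → Ω → ℝ}

variable {m : Mix P X} {h : ℝ → ℝ → ℝ → ℝ} {M L t0 p u0 δ0 : ℝ}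

lemma Ustat_decomp (X : ℤ → Ω → ℝ) (ν : Measure ℝ) (h : ℝ → ℝ → ℝ → ℝ) (t : ℝ) (n : ℕ) (hn : 2 ≤ n) (ω : Ω)
    (x : ℕ → ℝ) :
    Ustat X h n t ω = uu ν (kt h t) + 2 / (n : ℝ) * ∑ a ∈ Finset.range n, cen ν (kt h t) (x a)
      + 2 / ((n : ℝ) * ((n : ℝ) - 1)) * (pairSum (deg ν (kt h t)) x n
        + (pairSum (kt h t) (xs X ω) n - pairSum (kt h t) x n)) := by
  have hn' : (2 : ℝ) ≤ n := by exact_mod_cast hn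
  have h0 : (n : ℝ) ≠ 0 := by linarith
  have h1 : (n : ℝ) - 1 ≠ 0 := by linarith
  rw [Ustat_eq]
  have e := pairSum_hoeffding ν (kt h t) x n
  have e2 : pairSum (kt h t) (xs X ω) n = pairSum (kt h t) x n +
      (pairSum (kt h t) (xs X ω) n - pairSum (kt h t) x n) := by ring
  change 2 / ((n : ℝ) * ((n : ℝ) - 1)) * pairSum (kt h t) (xs X ω) n = _
  generalize pairSum (kt h t) (xs X ω) n - pairSum (kt h t) x n = d at *
  rw [e2, e]
  field_simp
  ring

lemma Ustat_mono (X : ℤ → Ω → ℝ) (hm : ∀ x y, Monotone (h x y)) (n : ℕ) (ω : Ω) :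
    Monotone fun t => Ustat X h n t ω := by
  intro s t hst
  unfold Ustat
  refine mul_le_mul_of_nonneg_left ?_ ?_
  · exact Finset.sum_le_sum fun i _ => Finset.sum_le_sum fun j _ => hm _ _ hst
  · rcases Nat.eq_zero_or_pos n with rfl | hn
    · simp
    · have : (1 : ℝ) ≤ n := by exact_mod_cast hn
      exact div_nonneg (by norm_num) (mul_nonneg (by linarith) (by linarith))

lemma small1 (n q e c : ℝ) (hq : 0 < q) (hn : q ^ 48 ≤ n) (hn2 : 2 ≤ n) (hc : 0 ≤ c) (he : |e| ≤ c * q ^ 66) :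
    |2 / (n * (n - 1)) * e| ≤ 4 * c / q ^ 30 := by
  have hn0 : 0 < n := by linarith
  have h1 : 2 / (n * (n - 1)) ≤ 4 / q ^ 96 := by
    rw [div_le_div_iff₀ (mul_pos hn0 (by linarith)) (by positivity)]
    have h96 : q ^ 96 ≤ n * n := by
      calc q ^ 96 = q ^ 48 * q ^ 48 := by ring
        _ ≤ n * n := mul_le_mul hn hn (by positivity) hn0.le
    nlinarith
  have h0 : 0 ≤ 2 / (n * (n - 1)) := div_nonneg (by norm_num) (mul_nonneg hn0.le (by linarith))
  rw [abs_mul, abs_of_nonneg h0]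
  calc _ ≤ 4 / q ^ 96 * (c * q ^ 66) := mul_le_mul h1 he (abs_nonneg _) (by positivity)
    _ = _ := by field_simp

lemma small2 (n q e c : ℝ) (hq : 0 < q) (hn : q ^ 48 ≤ n) (hc : 0 ≤ c) (he : |e| ≤ c) :
    |2 / n * e| ≤ 2 * c / q ^ 48 := by
  have hq48 : 0 < q ^ 48 := by positivity
  have hn0 : 0 < n := by linarith
  rw [abs_mul, abs_of_nonneg (div_nonneg (by norm_num) hn0.le)]
  calc _ ≤ 2 / q ^ 48 * c := mul_le_mul (div_le_div_of_nonneg_left (by norm_num) hq48 hn) he (abs_nonneg _) (by positivity)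
    _ = _ := by ring

/-- Deterministic combination at one scale. -/
lemma Ctx.good (cx : Ctx m h M L t0 p u0 δ0) (j r : ℕ) (hj1 : 1 ≤ j) (hr : r ≤ j)
    (hjδ : 1 / ((2 : ℝ) ^ j) ^ 20 < δ0) (c2 D : ℝ) (hc2 : 0 ≤ c2)
    (hD : D = 2 * (1 + m.C1 M L) + 24 + 8 * (1 + c2))
    (hL1 : 1 + m.C1 M L + 4 * (1 + c2) + 4 * M ≤ u0 / 4 * 2 ^ j)
    (hL2 : D / u0 + 3 ≤ 2 ^ j / 2)
    (n : ℕ) (hn : ((2 : ℝ) ^ j) ^ 48 ≤ n) (hn2 : n ≤ 2 ^ (48 * (j + 1))) (ω : Ω)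
    (g1 : ∀ i ≤ 2 ^ (6 * j + r + 1), 
        |∑ a ∈ Finset.range n, cen (m.nu ((2 ^ j) ^ 13)) (kt h (gr t0 j r i)) (m.xi ((2 ^ j) ^ 13) ω a)
          - ∑ a ∈ Finset.range n, cen (m.nu ((2 ^ j) ^ 13)) (kt h t0) (m.xi ((2 ^ j) ^ 13) ω a)|
          ≤ 12 * ((2 : ℝ) ^ j) ^ 18)
    (g2 : |∑ a ∈ Finset.range n, cen (m.nu ((2 ^ j) ^ 13)) (kt h t0) (m.xi ((2 ^ j) ^ 13) ω a)|
        ≤ 2 * ((u0 / 16) * 2 ^ r * ((2 : ℝ) ^ j) ^ 24) + 2 * M * ((2 : ℝ) ^ j) ^ 17)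
    (g3 : ∀ i ≤ 2 ^ (6 * j + r + 1),
        |pairSum (deg (m.nu ((2 ^ j) ^ 13)) (kt h (gr t0 j r i))) (m.xi ((2 ^ j) ^ 13) ω) n| ≤ ((2 : ℝ) ^ j) ^ 66)
    (g4 : ∀ i ≤ 2 ^ (6 * j + r + 1),
        |pairSum (kt h (gr t0 j r i)) (xs X ω) n - pairSum (kt h (gr t0 j r i)) (m.xi ((2 ^ j) ^ 13) ω) n|
          ≤ c2 * ((2 : ℝ) ^ j) ^ 66) :
    |UinvEmp X h n p ω - t0 + (Ustat X h n t0 ω - p) / u0| ≤ (D / u0 + 3) * (1 / ((2 : ℝ) ^ j) ^ 30) := by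
  have hu0 := cx.u0pos
  have hM1 := cx.M1
  have hC1 : 1 ≤ m.C1 M L := m.C1_pos M L cx.M1
  have huu := cx.uu_inc j hjδ
  have hun := cx.uu_near j hjδ t0 (by rw [sub_self, abs_zero]; positivity)
  have hq2 := two_le_q hj1
  have hnear : ∀ i ≤ 2 ^ (6 * j + r + 1), |gr t0 j r i - t0| ≤ 1 / ((2 : ℝ) ^ j) ^ 20 :=
    fun i hi => gr_near t0 j r i hr hi
  have ht0 : |t0 - t0| ≤ 1 / ((2 : ℝ) ^ j) ^ 20 := by rw [sub_self, abs_zero]; positivity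
  have hmid := gr_mid t0 j r
  have e6 : ((2 ^ (6 * j + r) : ℕ) : ℝ) = ((2 : ℝ) ^ j) ^ 6 * 2 ^ r := by
    push_cast; rw [pow_add, mul_comm 6 j, pow_mul]
  have h2r : (1 : ℝ) ≤ 2 ^ r := one_le_pow₀ (by norm_num)
  have hgr : ∀ i : ℕ, gr t0 j r i = t0 - ((2 ^ (6 * j + r) : ℕ) : ℝ) * (1 / ((2 : ℝ) ^ j) ^ 30) + i * (1 / ((2 : ℝ) ^ j) ^ 30) :=
    fun i => rfl
  have hn48 : 2 ≤ n := by
    have : ((2 : ℝ) ^ j) ^ 1 ≤ ((2 : ℝ) ^ j) ^ 48 := pow_le_pow_right₀ (by linarith) (by norm_num)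
    have : (2 : ℝ) ≤ n := by linarith
    exact_mod_cast this
  have hn2' : (2 : ℝ) ≤ n := by exact_mod_cast hn48
  generalize (2 : ℝ) ^ j = q at *
  have hq0 : 0 < q := by linarith
  have hdec := fun t => Ustat_decomp X (m.nu ((2 ^ j) ^ 13)) h t n hn48 ω (m.xi ((2 ^ j) ^ 13) ω)
  have hmle : 2 ^ (6 * j + r) ≤ 2 ^ (6 * j + r + 1) := Nat.pow_le_pow_right (by norm_num) (by omega)
  have hrem : ∀ i ≤ 2 ^ (6 * j + r + 1), |2 / ((n : ℝ) * ((n : ℝ) - 1)) *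
      (pairSum (deg (m.nu ((2 ^ j) ^ 13)) (kt h (gr t0 j r i))) (m.xi ((2 ^ j) ^ 13) ω) n
        + (pairSum (kt h (gr t0 j r i)) (xs X ω) n - pairSum (kt h (gr t0 j r i)) (m.xi ((2 ^ j) ^ 13) ω) n))|
      ≤ 4 * (1 + c2) / q ^ 30 := by
    intro i hi
    refine small1 n q _ (1 + c2) hq0 hn hn2' (by linarith) ?_
    refine (abs_add_le _ _).trans ?_
    have := g3 i hi
    have := g4 i hi
    linarith
  have hrem0 := hrem _ hmle
  rw [hmid] at hrem0
  have hD0 : 0 ≤ D := by rw [hD]; linarith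
  have hq30 : 0 < 1 / q ^ 30 := by positivity
  refine quantile_sandwich (fun t => Ustat X h n t ω) (Ustat_mono X cx.mono n ω) t0 p u0 (1 / q ^ 30) D hu0
    hq30 hD0 (2 ^ (6 * j + r)) ?_ ?_ ?_
  · intro i hi
    have hi' : i ≤ 2 ^ (6 * j + r + 1) := by rw [pow_succ]; omega
    rw [← hgr i]
    have b1 := huu t0 (gr t0 j r i) ht0 (hnear i hi')
    have b2 := hrem i hi'
    have b3 := small2 n q _ _ hq0 hn (by positivity) (g1 i hi')
    rw [mul_sub] at b3
    have e3 : 2 * (12 * q ^ 18) / q ^ 48 = 24 * (1 / q ^ 30) := by field_simp; norm_num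
    have e2 : 4 * (1 + c2) / q ^ 30 = 4 * (1 + c2) * (1 / q ^ 30) := by ring
    have e1 : 2 * (1 + m.C1 M L) / q ^ 30 = 2 * (1 + m.C1 M L) * (1 / q ^ 30) := by ring
    rw [e3] at b3
    rw [e2] at b2 hrem0
    rw [e1] at b1
    change |Ustat X h n (gr t0 j r i) ω - Ustat X h n t0 ω - u0 * (gr t0 j r i - t0)| ≤ D * (1 / q ^ 30)
    rw [hdec (gr t0 j r i), hdec t0, hD]
    generalize 2 / ((n : ℝ) * ((n : ℝ) - 1)) * (pairSum (deg (m.nu ((2 ^ j) ^ 13)) (kt h (gr t0 j r i))) (m.xi ((2 ^ j) ^ 13) ω) n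
        + (pairSum (kt h (gr t0 j r i)) (xs X ω) n - pairSum (kt h (gr t0 j r i)) (m.xi ((2 ^ j) ^ 13) ω) n)) = R1 at *
    generalize 2 / ((n : ℝ) * ((n : ℝ) - 1)) * (pairSum (deg (m.nu ((2 ^ j) ^ 13)) (kt h t0)) (m.xi ((2 ^ j) ^ 13) ω) n
        + (pairSum (kt h t0) (xs X ω) n - pairSum (kt h t0) (m.xi ((2 ^ j) ^ 13) ω) n)) = R0 at *
    rw [abs_le] at b1 b2 b3 hrem0 ⊢
    constructor <;> linarith
  · change |Ustat X h n t0 ω - p| ≤ u0 * (((2 ^ (6 * j + r) : ℕ) : ℝ) * (1 / q ^ 30) / 2)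
    rw [hdec t0, e6]
    have b3 := small2 n q _ _ hq0 hn (by positivity) g2
    rw [sub_self, mul_zero, sub_zero] at hun
    have hmain : (1 + m.C1 M L) / q ^ 30 + 2 * (2 * (u0 / 16 * 2 ^ r * q ^ 24) + 2 * M * q ^ 17) / q ^ 48
        + 4 * (1 + c2) / q ^ 30 ≤ u0 * (q ^ 6 * 2 ^ r * (1 / q ^ 30) / 2) := by
      have d1 : (1 + m.C1 M L) / q ^ 30 + 2 * (2 * (u0 / 16 * 2 ^ r * q ^ 24) + 2 * M * q ^ 17) / q ^ 48
        + 4 * (1 + c2) / q ^ 30 = ((1 + m.C1 M L) + 4 * (1 + c2) + 4 * M / q) * (1 / q ^ 30) + u0 / 4 * (2 ^ r * q ^ 6) * (1 / q ^ 30) := by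
        field_simp; ring
      have d2 : u0 * (q ^ 6 * 2 ^ r * (1 / q ^ 30) / 2) = u0 / 2 * (2 ^ r * q ^ 6) * (1 / q ^ 30) := by ring
      rw [d1, d2, ← add_mul]
      refine mul_le_mul_of_nonneg_right ?_ hq30.le
      have d3 : 4 * M / q ≤ 4 * M := div_le_self (by linarith) (by linarith)
      have d4 : q ≤ 2 ^ r * q ^ 6 := by
        calc q = 1 * q ^ 1 := by ring
          _ ≤ 2 ^ r * q ^ 6 := mul_le_mul h2r (pow_le_pow_right₀ (by linarith) (by norm_num)) (by positivity) (by positivity)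
      have d5 := mul_le_mul_of_nonneg_left d4 (show 0 ≤ u0 / 4 by positivity)
      linarith
    generalize 2 / ((n : ℝ) * ((n : ℝ) - 1)) * (pairSum (deg (m.nu ((2 ^ j) ^ 13)) (kt h t0)) (m.xi ((2 ^ j) ^ 13) ω) n
        + (pairSum (kt h t0) (xs X ω) n - pairSum (kt h t0) (m.xi ((2 ^ j) ^ 13) ω) n)) = R0 at *
    rw [abs_le] at b3 hun hrem0 ⊢
    constructor <;> linarith
  · rw [e6, show q ^ 6 * 2 ^ r * (1 / q ^ 30) / 2 = (q ^ 6 * 2 ^ r / 2) * (1 / q ^ 30) by ring]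
    refine mul_le_mul_of_nonneg_right (hL2.trans ?_) hq30.le
    have d4 : q ≤ q ^ 6 * 2 ^ r := by
      calc q = q ^ 1 * 1 := by ring
        _ ≤ q ^ 6 * 2 ^ r := mul_le_mul (pow_le_pow_right₀ (by linarith) (by norm_num)) h2r (by positivity) (by positivity)
    linarith

lemma scale_rpow (n j : ℕ) (hn0 : 0 < n) (hn : n ≤ 2 ^ (48 * (j + 1))) :
    1 / ((2 : ℝ) ^ j) ^ 30 ≤ 2 ^ 30 * (n : ℝ) ^ (-(5 : ℝ) / 8) := by
  have hn' : (n : ℝ) ≤ (2 : ℝ) ^ (48 * (j + 1)) := by exact_mod_cast hn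
  have hn0' : (0 : ℝ) < n := by exact_mod_cast hn0
  have h1 : ((2 : ℝ) ^ (48 * (j + 1))) ^ (-(5 : ℝ) / 8) ≤ (n : ℝ) ^ (-(5 : ℝ) / 8) :=
    Real.rpow_le_rpow_of_nonpos hn0' hn' (by norm_num)
  have h2 : ((2 : ℝ) ^ (48 * (j + 1))) ^ (-(5 : ℝ) / 8) = 1 / (2 ^ (30 * (j + 1))) := by
    rw [← Real.rpow_natCast, ← Real.rpow_mul (by norm_num), one_div, ← Real.rpow_natCast (n := 30 * (j + 1)),
      ← Real.rpow_neg (by norm_num)]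
    congr 1
    push_cast; ring
  rw [h2] at h1
  refine le_trans (le_of_eq ?_) (mul_le_mul_of_nonneg_left h1 (by positivity))
  rw [mul_add, mul_comm 30 j, pow_add, pow_mul, mul_one]
  field_simp

end Combine

end UQuantile

namespace UQuantile

section Final

variable {Ω : Type*} [MeasurableSpace Ω] {P : Measure Ω} [IsProbabilityMeasure P]
  {X : ℤ → Ω → ℝ}

variable {m : Mix P X} {h : ℝ → ℝ → ℝ → ℝ} {M L t0 p u0 δ0 : ℝ}

lemma ev_pow_ge (a : ℝ) : ∀ᶠ j : ℕ in atTop, a ≤ (2 : ℝ) ^ j :=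
  (tendsto_pow_atTop_atTop_of_one_lt (by norm_num : (1 : ℝ) < 2)).eventually_ge_atTop a

lemma ev_poly (M : ℝ) (hM : 1 ≤ M) : ∀ᶠ j : ℕ in atTop, 2 * M * (8 * (j : ℝ) + 2) ^ 4 ≤ 2 ^ j := by
  obtain ⟨A, hA, hAb⟩ := poly_geom 5
  have h1 : ∀ᶠ j : ℕ in atTop, 2 * M * 10000 * A ≤ (j : ℝ) :=
    tendsto_natCast_atTop_atTop.eventually_ge_atTop _
  filter_upwards [h1, eventually_ge_atTop 1] with j hj hj1
  have hj1' : (1 : ℝ) ≤ j := by exact_mod_cast hj1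
  have h2 : (8 * (j : ℝ) + 2) ^ 4 ≤ 10000 * (j : ℝ) ^ 4 := by
    calc (8 * (j : ℝ) + 2) ^ 4 ≤ (10 * (j : ℝ)) ^ 4 := pow_le_pow_left₀ (by positivity) (by linarith) 4
      _ = _ := by ring
  have h3 : (j : ℝ) * (2 * M * (8 * (j : ℝ) + 2) ^ 4) ≤ j * 2 ^ j := by
    calc (j : ℝ) * (2 * M * (8 * (j : ℝ) + 2) ^ 4) ≤ j * (2 * M * (10000 * (j : ℝ) ^ 4)) := by gcongr
      _ = 2 * M * 10000 * (j : ℝ) ^ 5 := by ring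
      _ ≤ 2 * M * 10000 * (A * 2 ^ j) := mul_le_mul_of_nonneg_left (hAb j) (by positivity)
      _ = 2 * M * 10000 * A * 2 ^ j := by ring
      _ ≤ j * 2 ^ j := mul_le_mul_of_nonneg_right hj (by positivity)
  exact le_of_mul_le_mul_left h3 (by linarith)

lemma tail_alg (q J A C1 C2 C3 C4 e : ℝ) (hq : 2 ≤ q) (hJ : 1 ≤ J) (hA : 0 ≤ A) (he : 0 ≤ e)
    (h1 : 0 ≤ C1) (h2 : 0 ≤ C2) (h3 : 0 ≤ C3) (h4 : 0 ≤ C4) (hJA : J ^ 5 ≤ A * (2 * q)) :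
    C1 * (e + J / q ^ 3) + C2 * (e + 1 / q ^ 3) + C3 * (J ^ 5 / q ^ 3) + C4 * (1 / q ^ 2)
      ≤ (C1 + C2 + C3 + C4) * (1 + 2 * A) * (e + 1 / q) := by
  have hq0 : 0 < q := by linarith
  have a1 : J ^ 5 / q ^ 3 ≤ 2 * A * (1 / q) := by
    calc J ^ 5 / q ^ 3 ≤ A * (2 * q) / q ^ 3 := div_le_div_of_nonneg_right hJA (by positivity)
      _ = 2 * A * (1 / q ^ 2) := by field_simp
      _ ≤ 2 * A * (1 / q) := by
          refine mul_le_mul_of_nonneg_left ?_ (by positivity)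
          exact one_div_le_one_div_of_le hq0 (by nlinarith)
  have a2 : J / q ^ 3 ≤ J ^ 5 / q ^ 3 :=
    div_le_div_of_nonneg_right (le_self_pow₀ hJ (by norm_num)) (by positivity)
  have a3 : 1 / q ^ 3 ≤ 1 / q :=
    one_div_le_one_div_of_le hq0 (le_self_pow₀ (by linarith) (by norm_num))
  have a4 : 1 / q ^ 2 ≤ 1 / q :=
    one_div_le_one_div_of_le hq0 (le_self_pow₀ (by linarith) (by norm_num))
  have hi : 0 ≤ 1 / q := by positivity
  have hz : 0 ≤ 2 * A * e := by positivity
  have hz2 : 0 ≤ 2 * A * (1 / q) := by positivity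
  have b1 : e + J / q ^ 3 ≤ (1 + 2 * A) * (e + 1 / q) := by linarith
  have b2 : e + 1 / q ^ 3 ≤ (1 + 2 * A) * (e + 1 / q) := by linarith
  have b3 : J ^ 5 / q ^ 3 ≤ (1 + 2 * A) * (e + 1 / q) := by linarith
  have b4 : 1 / q ^ 2 ≤ (1 + 2 * A) * (e + 1 / q) := by linarith
  have c1 := mul_le_mul_of_nonneg_left b1 h1
  have c2 := mul_le_mul_of_nonneg_left b2 h2
  have c3 := mul_le_mul_of_nonneg_left b3 h3
  have c4 := mul_le_mul_of_nonneg_left b4 h4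
  linarith

lemma Ctx.main (cx : Ctx m h M L t0 p u0 δ0) :
    ∀ᵐ ω ∂P, ∃ D : ℝ, ∀ᶠ n : ℕ in atTop,
      |UinvEmp X h n p ω - t0 + (Ustat X h n t0 ω - p) / u0| ≤ D * (n : ℝ) ^ (-(5 : ℝ) / 8) := by
  obtain ⟨ρ, Cρ, hCρ, hρ, hρs, hρb⟩ := rho_lemma m.gam m.gam_nonneg m.gam_sum
  obtain ⟨C1, hC1, H1⟩ := cx.lin_inc ρ Cρ hCρ hρ hρb
  obtain ⟨C2, hC2, H2⟩ := cx.dev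
  obtain ⟨C3, hC3, H3⟩ := cx.degen
  obtain ⟨C4, hC4, H4⟩ := cx.repl
  obtain ⟨A, hA, hAb⟩ := poly_geom 5
  have hM1 := cx.M1
  have hu0 := cx.u0pos
  have hδ0 := cx.δ0pos
  obtain ⟨c2, hc2⟩ : ∃ c2 : ℝ, c2 = 1 + 2 ^ 49 * M := ⟨_, rfl⟩
  have hc20 : 0 ≤ c2 := by
    rw [hc2]
    have : (0 : ℝ) ≤ 2 ^ 49 * M := mul_nonneg (by norm_num) (by linarith)
    linarith
  obtain ⟨D, hD⟩ : ∃ D : ℝ, D = 2 * (1 + m.C1 M L) + 24 + 8 * (1 + c2) := ⟨_, rfl⟩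
  rw [← hc2] at H4
  have hev : ∀ᶠ j : ℕ in atTop, 1 ≤ j ∧ 1 / ((2 : ℝ) ^ j) ^ 20 < δ0 ∧ 2 * M * (8 * (j : ℝ) + 2) ^ 4 ≤ 2 ^ j ∧
      M ≤ 2 ^ j ∧ 1 + m.C1 M L + 4 * (1 + c2) + 4 * M ≤ u0 / 4 * 2 ^ j ∧ D / u0 + 3 ≤ 2 ^ j / 2 := by
    filter_upwards [eventually_ge_atTop 1, ev_pow_ge (2 / δ0), ev_poly M hM1, ev_pow_ge M,
      ev_pow_ge ((1 + m.C1 M L + 4 * (1 + c2) + 4 * M) / (u0 / 4)), ev_pow_ge ((D / u0 + 3) * 2)]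
      with j a1 a2 a3 a4 a5 a6
    refine ⟨a1, ?_, a3, a4, ?_, ?_⟩
    · have hq2 := two_le_q a1
      have hq : (2 : ℝ) ^ j ≤ ((2 : ℝ) ^ j) ^ 20 := le_self_pow₀ (by linarith) (by norm_num)
      rw [div_lt_iff₀ (by positivity)]
      rw [div_le_iff₀ hδ0] at a2
      have := mul_le_mul_of_nonneg_left hq hδ0.le
      linarith
    · rw [div_le_iff₀ (by positivity)] at a5
      linarith
    · linarith
  obtain ⟨J0, hJ0⟩ := eventually_atTop.1 hev
  obtain ⟨E1, hE1⟩ : ∃ E : ℕ → Set Ω, ∀ j, E j = {ω | ∃ i ≤ 2 ^ (6 * j + ρ j + 1), ∃ n ≤ 2 ^ (48 * (j + 1)),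
        12 * ((2 : ℝ) ^ j) ^ 18 <
        |∑ a ∈ Finset.range n, cen (m.nu ((2 ^ j) ^ 13)) (kt h (gr t0 j (ρ j) i)) (m.xi ((2 ^ j) ^ 13) ω a)
          - ∑ a ∈ Finset.range n, cen (m.nu ((2 ^ j) ^ 13)) (kt h t0) (m.xi ((2 ^ j) ^ 13) ω a)|} := ⟨_, fun _ => rfl⟩
  obtain ⟨E2, hE2⟩ : ∃ E : ℕ → Set Ω, ∀ j, E j = {ω | ∃ n ≤ 2 ^ (48 * (j + 1)),
        2 * ((u0 / 16) * 2 ^ (ρ j) * ((2 : ℝ) ^ j) ^ 24) + 2 * M * ((2 : ℝ) ^ j) ^ 17 <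
        |∑ a ∈ Finset.range n, cen (m.nu ((2 ^ j) ^ 13)) (kt h t0) (m.xi ((2 ^ j) ^ 13) ω a)|} := ⟨_, fun _ => rfl⟩
  obtain ⟨E3, hE3⟩ : ∃ E : ℕ → Set Ω, ∀ j, E j = {ω | ∃ i ≤ 2 ^ (6 * j + ρ j + 1), ∃ n ≤ 2 ^ (48 * (j + 1)),
        ((2 : ℝ) ^ j) ^ 66 <
        |pairSum (deg (m.nu ((2 ^ j) ^ 13)) (kt h (gr t0 j (ρ j) i))) (m.xi ((2 ^ j) ^ 13) ω) n|} := ⟨_, fun _ => rfl⟩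
  obtain ⟨E4, hE4⟩ : ∃ E : ℕ → Set Ω, ∀ j, E j = {ω | ∃ i ≤ 2 ^ (6 * j + ρ j + 1), ∃ n ≤ 2 ^ (48 * (j + 1)),
        c2 * ((2 : ℝ) ^ j) ^ 66 <
        |pairSum (kt h (gr t0 j (ρ j) i)) (xs X ω) n - pairSum (kt h (gr t0 j (ρ j) i)) (m.xi ((2 ^ j) ^ 13) ω) n|} :=
      ⟨_, fun _ => rfl⟩
  have hprob : ∀ j ≥ J0, P.real (E1 j ∪ E2 j ∪ E3 j ∪ E4 j) ≤
      (C1 + C2 + C3 + C4) * (1 + 2 * A) * ((1 / 2 : ℝ) ^ (8 * ρ j) + (1 / 2 : ℝ) ^ j) := by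
    intro j hj
    obtain ⟨a1, a2, a3, a4, a5, a6⟩ := hJ0 j hj
    have p1 := H1 j a1 a2 a3
    have p2 := H2 j a1 a4 (ρ j)
    have p3 := H3 j a1 a2 (ρ j) (hρ j)
    have p4 := H4 j a1 a2 (ρ j) (hρ j)
    rw [← hE1] at p1
    rw [← hE2] at p2
    rw [← hE3] at p3
    rw [← hE4] at p4
    have u1 := measureReal_union_le (μ := P) (E1 j) (E2 j)
    have u2 := measureReal_union_le (μ := P) (E1 j ∪ E2 j) (E3 j)
    have u3 := measureReal_union_le (μ := P) (E1 j ∪ E2 j ∪ E3 j) (E4 j)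
    have hJA : ((j : ℝ) + 1) ^ 5 ≤ A * (2 * 2 ^ j) := by
      have := hAb (j + 1)
      push_cast at this
      rwa [pow_succ (2 : ℝ) j, mul_comm ((2 : ℝ) ^ j) 2] at this
    have hJ1 : (1 : ℝ) ≤ (j : ℝ) + 1 := by
      have : (0 : ℝ) ≤ j := Nat.cast_nonneg j
      linarith
    have ht := tail_alg ((2 : ℝ) ^ j) ((j : ℝ) + 1) A C1 C2 C3 C4 ((1 / 2 : ℝ) ^ (8 * ρ j)) (two_le_q a1)
      hJ1 hA (by positivity) hC1 hC2 hC3 hC4 hJA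
    have ehalf : (1 / 2 : ℝ) ^ j = 1 / 2 ^ j := one_div_pow _ _
    rw [ehalf]
    linarith
  have hsum : Summable fun j : ℕ => (C1 + C2 + C3 + C4) * (1 + 2 * A) * ((1 / 2 : ℝ) ^ (8 * ρ j) + (1 / 2 : ℝ) ^ j) :=
    (hρs.add (summable_geometric_of_lt_one (by norm_num) (by norm_num))).mul_left _
  have hsum2 := (summable_nat_add_iff J0).2 hsum
  have hbc := ae_eventually_notMem (μ := P) (s := fun j => E1 (j + J0) ∪ E2 (j + J0) ∪ E3 (j + J0) ∪ E4 (j + J0)) (by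
    refine ne_top_of_le_ne_top hsum2.tsum_ofReal_ne_top (ENNReal.tsum_le_tsum fun j => ?_)
    have := ENNReal.ofReal_le_ofReal (hprob (j + J0) (by omega))
    rwa [ofReal_measureReal] at this)
  filter_upwards [hbc] with ω hω
  obtain ⟨J1, hJ1⟩ := eventually_atTop.1 hω
  refine ⟨(D / u0 + 3) * 2 ^ 30, ?_⟩
  filter_upwards [eventually_ge_atTop (2 ^ (48 * (J0 + J1)))] with n hn
  have hn0 : 0 < n := lt_of_lt_of_le (Nat.pow_pos (by norm_num)) hn
  obtain ⟨j, hj⟩ : ∃ j, j = Nat.log 2 n / 48 := ⟨_, rfl⟩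
  have hlog : 48 * (J0 + J1) ≤ Nat.log 2 n := Nat.le_log_of_pow_le (by norm_num) hn
  have hjJ : J0 + J1 ≤ j := by omega
  have hlow : 2 ^ (48 * j) ≤ n :=
    (Nat.pow_le_pow_right (by norm_num) (by omega)).trans (Nat.pow_log_le_self 2 hn0.ne')
  have hup : n ≤ 2 ^ (48 * (j + 1)) :=
    (Nat.lt_pow_succ_log_self (by norm_num) n).le.trans (Nat.pow_le_pow_right (by norm_num) (by omega))
  have hnot := hJ1 (j - J0) (by omega)
  rw [show j - J0 + J0 = j by omega] at hnot
  obtain ⟨a1, a2, a3, a4, a5, a6⟩ := hJ0 j (by omega)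
  simp only [mem_union, not_or] at hnot
  obtain ⟨⟨⟨n1, n2⟩, n3⟩, n4⟩ := hnot
  rw [hE1] at n1
  rw [hE2] at n2
  rw [hE3] at n3
  rw [hE4] at n4
  have hlow' : ((2 : ℝ) ^ j) ^ 48 ≤ n := by
    rw [← pow_mul, mul_comm j 48]
    exact_mod_cast hlow
  have hgood := cx.good j (ρ j) a1 (hρ j) a2 c2 D hc20 hD a5 a6 n hlow' hup ω
    (fun i hi => not_lt.1 fun hlt => n1 ⟨i, hi, n, hup, hlt⟩)
    (not_lt.1 fun hlt => n2 ⟨n, hup, hlt⟩)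
    (fun i hi => not_lt.1 fun hlt => n3 ⟨i, hi, n, hup, hlt⟩)
    (fun i hi => not_lt.1 fun hlt => n4 ⟨i, hi, n, hup, hlt⟩)
  refine hgood.trans ?_
  rw [mul_assoc]
  refine mul_le_mul_of_nonneg_left (scale_rpow n j hn0 hup) ?_
  have hCC : 1 ≤ m.C1 M L := m.C1_pos M L cx.M1
  have hD0 : 0 ≤ D := by rw [hD]; linarith
  have := div_nonneg hD0 hu0.le
  linarith

end Final

end UQuantile

namespace UQuantile

/-- (Generalized Bahadur representation, part (B).) Under Assumptions 1, 2
and 3, the Bahadur remainder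
`R_n = U_n⁻¹(p) - U⁻¹(p) + (U_n(U⁻¹(p)) - p)/u(U⁻¹(p))` is `O(n^{-5/8})` almost surely. -/
theorem bahadur_remainder
    {Ω : Type*} [MeasurableSpace Ω] (P : Measure Ω) [IsProbabilityMeasure P]
    (X Z : ℤ → Ω → ℝ) (hX : ∀ i, Measurable (X i)) (hZ : ∀ i, Measurable (Z i))
    (p : ℝ) (hp : p ∈ Set.Ioo (0 : ℝ) 1)
    (h : ℝ → ℝ → ℝ → ℝ) (hker : IsUQKernel h) (u : ℝ → ℝ)
    (hA1 : Assumption1 P X Z)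
    (hA2 : Assumption2 (P.map (X 0)) h p)
    (hA3 : Assumption3 (P.map (X 0)) h p u) :
    ∀ᵐ ω ∂P, ∃ D : ℝ, ∀ᶠ n : ℕ in atTop,
      |UinvEmp X h n p ω - Uinv (P.map (X 0)) h p
        + (Ustat X h n (Uinv (P.map (X 0)) h p) ω - p) / u (Uinv (P.map (X 0)) h p)| ≤
        D * (n : ℝ) ^ (-(5 : ℝ) / 8) := by
  obtain ⟨m⟩ := exists_mix P X Z hX hZ hA1
  obtain ⟨M0, hM0⟩ := hker.bounded
  obtain ⟨L, δ, hδ, hvar⟩ := hA2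
  obtain ⟨-, hu, hlo⟩ := hA3
  obtain ⟨δ', hδ', htay⟩ := Metric.eventually_nhds_iff.1 (hlo.def one_pos)
  have cx : Ctx m h (max 1 M0) (max 1 L) (Uinv (P.map (X 0)) h p) p (u (Uinv (P.map (X 0)) h p)) (min δ δ') := by
    refine ⟨le_max_left _ _, hu, lt_min hδ hδ', ?_, hker.mono, ?_⟩
    · intro t ht
      refine ⟨?_, fun x y => hker.nonneg x y t, fun x y => (hM0 x y t).trans (le_max_right _ _),
        le_max_left _ _, lt_of_lt_of_le one_pos (le_max_left _ _), fun x y => hker.symm x y t, ?_⟩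
      · exact hker.measurable.comp (measurable_fst.prodMk (measurable_snd.prodMk measurable_const))
      · intro ε hε
        refine (hvar t (lt_of_lt_of_le ht (min_le_left _ _)) ε hε).trans ?_
        exact ENNReal.ofReal_le_ofReal (mul_le_mul_of_nonneg_right (le_max_right _ _) hε.le)
    · intro t ht
      have := htay (y := t) (by rw [Real.dist_eq]; exact lt_of_lt_of_le ht (min_le_right _ _))
      rw [one_mul, Real.norm_eq_abs, Real.norm_eq_abs, abs_of_nonneg (Real.rpow_nonneg (abs_nonneg _) _)] at this
      exact this
  exact cx.main

end UQuantile
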